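/- For every Δ ∈ ℕ and δ > 0 there exists a constant C = C(Δ,δ) with the following property. For every γ > 0 there exists n₀ such that for all n ≥ n₀: if G is an n-vertex graph with minimum degree δ(G) ≥ (1/2 + δ)·n and T is an n-vertex tree with maximum degree Δ(T) ≤ Δ, then the random subgraph G(C·log n / n) contains a copy of T (a subgraph isomorphic to T) with probability at least 1 − γ. -/

import Mathlib

open Finset

open Classical in
/-- The probability that the binomial random subset of `E` with retention probability `p`
satisfies the property `P`. -/
noncomputable def edgeProb {β : Type*} [DecidableEq β] (E : Finset β) (p : ℝ)
    (P : Finset β → Prop) : ℝ :=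
  ∑ F ∈ E.powerset, if P F then p ^ F.card * (1 - p) ^ (E.card - F.card) else 0

/-- `G'` contains a copy of `T`: there is an injective map preserving adjacency. -/
def ContainsCopy {W V : Type*} (T : SimpleGraph W) (G' : SimpleGraph V) : Prop :=
  ∃ f : W → V, Function.Injective f ∧ ∀ u v, T.Adj u v → G'.Adj (f u) (f v)

section FiniteProbability
open scoped Classical

/-- A probability weight on a finite type. -/
structure IsProb {α : Type*} [Fintype α] (w : α → ℝ) : Prop where
  nonneg : ∀ a, 0 ≤ w a
  sum_eq : ∑ a, w a = 1

/-- The real-valued indicator of a proposition. -/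
noncomputable def ind (P : Prop) : ℝ := if P then 1 else 0

theorem ind_nonneg (P : Prop) : 0 ≤ ind P := by unfold ind; split_ifs <;> norm_num

theorem ind_le_one (P : Prop) : ind P ≤ 1 := by unfold ind; split_ifs <;> norm_num

theorem ind_of {P : Prop} (h : P) : ind P = 1 := if_pos h

theorem ind_not {P : Prop} (h : ¬ P) : ind P = 0 := if_neg h

theorem ind_mono {P Q : Prop} (h : P → Q) : ind P ≤ ind Q := by
  by_cases hp : P
  · rw [ind_of hp, ind_of (h hp)]
  · rw [ind_not hp]; exact ind_nonneg _

/-- The weight of an event. -/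
noncomputable def pr {α : Type*} [Fintype α] (w : α → ℝ) (E : α → Prop) : ℝ :=
  ∑ a, w a * ind (E a)

/-- The mixture of the weights `κ a` with respect to the weight `w`. -/
noncomputable def mix {α β : Type*} [Fintype α] (w : α → ℝ) (κ : α → β → ℝ) (b : β) : ℝ :=
  ∑ a, w a * κ a b

variable {α β : Type*} [Fintype α] [Fintype β] {w : α → ℝ}

theorem pr_nonneg (hw : ∀ a, 0 ≤ w a) (E : α → Prop) : 0 ≤ pr w E :=
  Finset.sum_nonneg fun a _ => mul_nonneg (hw a) (ind_nonneg _)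

theorem pr_mono (hw : ∀ a, 0 ≤ w a) {E F : α → Prop} (h : ∀ a, w a ≠ 0 → E a → F a) :
    pr w E ≤ pr w F := by
  refine Finset.sum_le_sum fun a _ => ?_
  by_cases h0 : w a = 0
  · simp [h0]
  · exact mul_le_mul_of_nonneg_left (ind_mono (h a h0)) (hw a)

theorem pr_le_one (hw : IsProb w) (E : α → Prop) : pr w E ≤ 1 := by
  rw [← hw.sum_eq]
  exact Finset.sum_le_sum fun a _ => mul_le_of_le_one_right (hw.nonneg a) (ind_le_one _)

theorem pr_congr {E F : α → Prop} (h : ∀ a, w a ≠ 0 → (E a ↔ F a)) : pr w E = pr w F := by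
  refine Finset.sum_congr rfl fun a _ => ?_
  by_cases h0 : w a = 0
  · simp [h0]
  · rw [h a h0]

theorem pr_compl (hw : IsProb w) (E : α → Prop) : pr w E + pr w (fun a => ¬ E a) = 1 := by
  rw [← hw.sum_eq, pr, pr, ← Finset.sum_add_distrib]
  refine Finset.sum_congr rfl fun a _ => ?_
  by_cases h : E a <;> simp [h, ind]

theorem pr_union {γ : Type*} (hw : ∀ a, 0 ≤ w a) (s : Finset γ) (E : γ → α → Prop) :
    pr w (fun a => ∃ i ∈ s, E i a) ≤ ∑ i ∈ s, pr w (E i) := by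
  unfold pr
  rw [Finset.sum_comm]
  refine Finset.sum_le_sum fun a _ => ?_
  have hn : ∀ i ∈ s, 0 ≤ w a * ind (E i a) := fun i _ => mul_nonneg (hw a) (ind_nonneg _)
  by_cases h : ∃ i ∈ s, E i a
  · obtain ⟨i, hi, hE⟩ := h
    calc _ ≤ w a * 1 := mul_le_mul_of_nonneg_left (ind_le_one _) (hw a)
      _ = w a * ind (E i a) := by rw [ind_of hE]
      _ ≤ _ := Finset.single_le_sum hn hi
  · rw [ind_not h, mul_zero]
    exact Finset.sum_nonneg hn

theorem pr_markov (hw : ∀ a, 0 ≤ w a) (f : α → ℝ) (hf : ∀ a, w a ≠ 0 → 0 ≤ f a) {t : ℝ}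
    (ht : 0 < t) : pr w (fun a => t ≤ f a) ≤ (∑ a, w a * f a) / t := by
  rw [le_div_iff₀ ht, pr, Finset.sum_mul]
  refine Finset.sum_le_sum fun a _ => ?_
  have h1 := hw a
  by_cases h0 : w a = 0
  · simp [h0]
  have h2 := hf a h0
  rw [mul_assoc]
  refine mul_le_mul_of_nonneg_left ?_ h1
  by_cases h : t ≤ f a
  · simpa [ind_of h] using h
  · simpa [ind_not h] using h2

theorem sum_mix_mul (w : α → ℝ) (κ : α → β → ℝ) (h : β → ℝ) :
    ∑ b, mix w κ b * h b = ∑ a, w a * ∑ b, κ a b * h b := by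
  simp_rw [mix, Finset.sum_mul, Finset.mul_sum]
  rw [Finset.sum_comm]
  simp [mul_assoc]

theorem pr_mix (w : α → ℝ) (κ : α → β → ℝ) (E : β → Prop) :
    pr (mix w κ) E = ∑ a, w a * pr (κ a) E := by
  exact sum_mix_mul w κ (fun b => ind (E b))

theorem IsProb.mix {κ : α → β → ℝ} (hw : IsProb w) (hκ : ∀ a, w a ≠ 0 → IsProb (κ a)) :
    IsProb (mix w κ) := by
  constructor
  · intro b
    refine Finset.sum_nonneg fun a _ => ?_
    by_cases h0 : w a = 0
    · simp [h0]
    · exact mul_nonneg (hw.nonneg a) ((hκ a h0).nonneg b)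
  · have := sum_mix_mul w κ (fun _ => 1)
    simp only [mul_one] at this
    rw [this, ← hw.sum_eq]
    refine Finset.sum_congr rfl fun a _ => ?_
    by_cases h0 : w a = 0
    · simp [h0]
    · simp [(hκ a h0).sum_eq]

theorem mix_ne_zero {γ : Type*} {κ : α → γ → ℝ} {b : γ} (h : mix w κ b ≠ 0) :
    ∃ a, w a ≠ 0 ∧ κ a b ≠ 0 := by
  obtain ⟨a, -, ha⟩ := Finset.exists_ne_zero_of_sum_ne_zero h
  exact ⟨a, left_ne_zero_of_mul ha, right_ne_zero_of_mul ha⟩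

/-- Conditioning on an event of probability at least `1 / 2`. -/
theorem IsProb.exists_cond (hw : IsProb w) {E : α → Prop} (hE : 1 / 2 ≤ pr w E) :
    ∃ w' : α → ℝ, IsProb w' ∧ (∀ a, w' a ≤ 2 * w a) ∧ ∀ a, w' a ≠ 0 → w a ≠ 0 ∧ E a := by
  have hpos : 0 < pr w E := by linarith
  refine ⟨fun a => w a * ind (E a) / pr w E, ⟨fun a => ?_, ?_⟩, fun a => ?_, fun a ha => ?_⟩
  · exact div_nonneg (mul_nonneg (hw.nonneg a) (ind_nonneg _)) hpos.le
  · rw [← Finset.sum_div]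
    exact div_self hpos.ne'
  · have h1 := hw.nonneg a
    have h2 := mul_le_of_le_one_right h1 (ind_le_one (E a))
    have h3 := mul_nonneg h1 (ind_nonneg (E a))
    rw [div_le_iff₀ hpos]; nlinarith
  · refine ⟨fun h0 => ha (by simp [h0]), ?_⟩
    by_contra h
    exact ha (by simp [ind_not h])

theorem pr_le_mul {w' : α → ℝ} {c : ℝ} (h : ∀ a, w' a ≤ c * w a) (E : α → Prop) :
    pr w' E ≤ c * pr w E := by
  rw [pr, pr, Finset.mul_sum]
  refine Finset.sum_le_sum fun a _ => ?_
  rw [← mul_assoc]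
  exact mul_le_mul_of_nonneg_right (h a) (ind_nonneg _)

end FiniteProbability

section Sequential
open scoped Classical

variable {ι V R : Type*} [Fintype ι] [DecidableEq ι] [Fintype V] [DecidableEq V]

/-- Sequential uniformly random choices: in step `k < N` the value at `e k` is chosen uniformly
from `Opt k f`. -/
theorem exists_seq_choice (N : ℕ) (e : ℕ → ι) (he : Set.InjOn e (Set.Iio N)) (f0 : ι → V)
    (Inv : ℕ → (ι → V) → Prop) (Opt : ℕ → (ι → V) → Finset V) {D : ℝ} (hD : 0 < D)
    (h0 : Inv 0 f0)
    (hopt : ∀ k < N, ∀ f, Inv k f → D ≤ #(Opt k f))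
    (hstep : ∀ k < N, ∀ f, Inv k f → ∀ v ∈ Opt k f, Inv (k + 1) (Function.update f (e k) v))
    (M : ℕ → R → (ι → V) → ℝ)
    (hM : ∀ k < N, ∀ f, Inv k f → ∀ r,
      ∑ v ∈ Opt k f, M (k + 1) r (Function.update f (e k) v) ≤ #(Opt k f) * M k r f) :
    ∃ w : (ι → V) → ℝ, IsProb w ∧
      (∀ f, w f ≠ 0 → Inv N f ∧ ∀ i, (∀ k < N, e k ≠ i) → f i = f0 i) ∧
      (∀ (S : Finset ι) (y : ι → V), pr w (fun f => ∀ i ∈ S, f i = y i) ≤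
        (1 / D) ^ #{i ∈ S | ∃ k < N, e k = i}) ∧
      ∀ r, ∑ f, w f * M N r f ≤ M 0 r f0 := by
  induction N with
  | zero =>
    refine ⟨fun f => if f = f0 then 1 else 0, ⟨fun f => by positivity, by simp⟩, ?_, ?_, ?_⟩
    · intro f hf
      have : f = f0 := by by_contra h; simp [h] at hf
      subst this
      exact ⟨h0, fun _ _ => rfl⟩
    · intro S y
      simp only [pr, not_lt_zero, false_and, exists_false, Finset.filter_false, Finset.card_empty,
        pow_zero]
      calc _ ≤ ∑ f : ι → V, (if f = f0 then (1 : ℝ) else 0) := by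
            exact Finset.sum_le_sum fun f _ =>
              mul_le_of_le_one_right (by positivity) (ind_le_one _)
        _ = 1 := by simp
    · intro r; simp
  | succ N ih =>
    obtain ⟨w, hw, hsupp, hspread, hpot⟩ := ih (he.mono (Set.Iio_subset_Iio (Nat.le_succ N)))
      (fun k hk => hopt k (by omega)) (fun k hk => hstep k (by omega))
      (fun k hk => hM k (by omega))
    set κ : (ι → V) → (ι → V) → ℝ := fun f f' =>
      ∑ v ∈ Opt N f, if Function.update f (e N) v = f' then ((#(Opt N f) : ℝ))⁻¹ else 0 with hκ
    have hcard : ∀ f, w f ≠ 0 → D ≤ #(Opt N f) := fun f hf =>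
      hopt N (Nat.lt_succ_self N) f (hsupp f hf).1
    have hκsum : ∀ f (h : (ι → V) → ℝ), ∑ f', κ f f' * h f' =
        (#(Opt N f) : ℝ)⁻¹ * ∑ v ∈ Opt N f, h (Function.update f (e N) v) := by
      intro f h
      simp_rw [hκ, Finset.sum_mul]
      rw [Finset.sum_comm, Finset.mul_sum]
      refine Finset.sum_congr rfl fun v _ => ?_
      simp [ite_mul]
    have hκp : ∀ f, w f ≠ 0 → IsProb (κ f) := by
      intro f hf
      refine ⟨fun f' => Finset.sum_nonneg fun v _ => by positivity, ?_⟩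
      have := hκsum f (fun _ => 1)
      simp only [mul_one, Finset.sum_const, nsmul_eq_mul] at this
      rw [this, inv_mul_cancel₀]
      exact (hD.trans_le (hcard f hf)).ne'
    have hprκ : ∀ f (E : (ι → V) → Prop), pr (κ f) E =
        (#(Opt N f) : ℝ)⁻¹ * ∑ v ∈ Opt N f, ind (E (Function.update f (e N) v)) := by
      intro f E
      exact hκsum f (fun f' => ind (E f'))
    refine ⟨mix w κ, hw.mix hκp, ?_, ?_, ?_⟩
    · intro f' hf'
      obtain ⟨f, hf, hff'⟩ := mix_ne_zero hf'
      obtain ⟨v, hv, hne⟩ := Finset.exists_ne_zero_of_sum_ne_zero hff'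
      have heq : Function.update f (e N) v = f' := by by_contra h; simp [h] at hne
      subst heq
      refine ⟨hstep N (Nat.lt_succ_self N) f (hsupp f hf).1 v hv, fun i hi => ?_⟩
      rw [Function.update_of_ne (fun h => hi N (Nat.lt_succ_self N) h.symm)]
      exact (hsupp f hf).2 i fun k hk => hi k (by omega)
    · intro S y
      rw [pr_mix]
      by_cases hS : e N ∈ S
      · have hle : ∀ f, w f * pr (κ f) (fun f => ∀ i ∈ S, f i = y i) ≤
            (w f * ind (∀ i ∈ S.erase (e N), f i = y i)) * (1 / D) := by
          intro f
          by_cases hf : w f = 0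
          · simp [hf]
          have hc := hcard f hf
          have hc' := hD.trans_le hc
          by_cases hE : ∀ i ∈ S.erase (e N), f i = y i
          · rw [ind_of hE, mul_one]
            refine mul_le_mul_of_nonneg_left ?_ (hw.nonneg f)
            rw [hprκ, one_div]
            have h1 : ∑ v ∈ Opt N f, ind (∀ i ∈ S, Function.update f (e N) v i = y i) ≤ 1 :=
              calc _ ≤ ∑ v ∈ Opt N f, (if v = y (e N) then (1 : ℝ) else 0) := by
                    refine Finset.sum_le_sum fun v _ => ?_
                    split_ifs with hv
                    · exact ind_le_one _
                    · refine (ind_not fun h => hv ?_).le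
                      simpa using h _ hS
                _ ≤ 1 := by rw [Finset.sum_ite_eq']; split_ifs <;> norm_num
            calc _ ≤ (#(Opt N f) : ℝ)⁻¹ * 1 := by
                  refine mul_le_mul_of_nonneg_left ?_ (by positivity)
                  exact h1
              _ ≤ D⁻¹ := by rw [mul_one]; exact inv_anti₀ hD hc
          · rw [hprκ, Finset.sum_eq_zero, ind_not hE]
            · simp
            · refine fun v _ => ind_not fun h => hE fun i hi => ?_
              have := h i (Finset.mem_of_mem_erase hi)
              rwa [Function.update_of_ne (Finset.ne_of_mem_erase hi)] at this
        refine (Finset.sum_le_sum fun f _ => hle f).trans ?_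
        rw [← Finset.sum_mul]
        refine (mul_le_mul_of_nonneg_right (hspread (S.erase (e N)) y) (by positivity)).trans ?_
        rw [← pow_succ]
        apply le_of_eq
        congr 1
        rw [← Finset.card_erase_add_one (s := {i ∈ S | ∃ k < N + 1, e k = i}) (a := e N)
          (by simp only [Finset.mem_filter]; exact ⟨hS, N, by omega, rfl⟩)]
        congr 2
        ext i
        simp only [Finset.mem_filter, Finset.mem_erase]
        constructor
        · rintro ⟨⟨h1, h2⟩, k, hk, rfl⟩
          exact ⟨h1, h2, k, by omega, rfl⟩
        · rintro ⟨h1, h2, k, hk, rfl⟩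
          refine ⟨⟨h1, h2⟩, k, ?_, rfl⟩
          rcases Nat.lt_succ_iff_lt_or_eq.1 hk with h | rfl
          · exact h
          · exact absurd rfl h1
      · have hle : ∀ f, w f * pr (κ f) (fun f => ∀ i ∈ S, f i = y i) ≤
            w f * ind (∀ i ∈ S, f i = y i) := by
          intro f
          by_cases hf : w f = 0
          · simp [hf]
          by_cases hE : ∀ i ∈ S, f i = y i
          · rw [ind_of hE, mul_one]
            exact mul_le_of_le_one_right (hw.nonneg f) (pr_le_one (hκp f hf) _)
          · rw [hprκ, Finset.sum_eq_zero, ind_not hE]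
            · simp
            · refine fun v _ => ind_not fun h => hE fun i hi => ?_
              have := h i hi
              rwa [Function.update_of_ne (fun h : i = e N => hS (h ▸ hi))] at this
        refine (Finset.sum_le_sum fun f _ => hle f).trans ((hspread S y).trans (le_of_eq ?_))
        congr 2
        ext i
        simp only [Finset.mem_filter]
        refine and_congr_right fun hi => ⟨fun ⟨k, hk, h⟩ => ⟨k, by omega, h⟩, fun ⟨k, hk, h⟩ => ?_⟩
        refine ⟨k, ?_, h⟩
        rcases Nat.lt_succ_iff_lt_or_eq.1 hk with h' | rfl
        · exact h'
        · exact absurd (h ▸ hi) hS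
    · intro r
      rw [sum_mix_mul]
      refine le_trans (Finset.sum_le_sum fun f _ => ?_) (hpot r)
      by_cases hf : w f = 0
      · simp [hf]
      refine mul_le_mul_of_nonneg_left ?_ (hw.nonneg f)
      have hc' := hD.trans_le (hcard f hf)
      rw [hκsum, inv_mul_le_iff₀ hc']
      exact hM N (Nat.lt_succ_self N) f (hsupp f hf).1 r
end Sequential

section Injections
open scoped Classical

variable {ι V : Type*} [Fintype ι] [DecidableEq ι] [Fintype V] [DecidableEq V]

/-- The maps which agree with `φ₀` off `X` and map `X` injectively to `U`. -/
noncomputable def injExt (φ₀ : ι → V) (X : Finset ι) (U : Finset V) : Finset (ι → V) :=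
  {ψ | (∀ i, i ∉ X → ψ i = φ₀ i) ∧ Set.InjOn ψ X ∧ ∀ i ∈ X, ψ i ∈ U}

theorem mem_injExt {φ₀ : ι → V} {X : Finset ι} {U : Finset V} {ψ : ι → V} :
    ψ ∈ injExt φ₀ X U ↔ (∀ i, i ∉ X → ψ i = φ₀ i) ∧ Set.InjOn ψ X ∧ ∀ i ∈ X, ψ i ∈ U := by
  simp [injExt]

theorem injExt_nonempty {φ₀ : ι → V} {X : Finset ι} {U : Finset V} (h : #X ≤ #U) :
    (injExt φ₀ X U).Nonempty := by
  have : Fintype.card X ≤ Fintype.card U := by simpa using h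
  obtain ⟨g⟩ := Function.Embedding.nonempty_of_card_le this
  refine ⟨fun i => if h : i ∈ X then g ⟨i, h⟩ else φ₀ i, mem_injExt.2 ⟨?_, ?_, ?_⟩⟩
  · intro i hi; simp [hi]
  · intro i hi j hj hij
    rw [Finset.mem_coe] at hi hj
    simp only [hi, hj, dif_pos] at hij
    have := g.injective (Subtype.ext hij)
    simpa using this
  · intro i hi; simp only [hi, dif_pos]; exact (g ⟨i, hi⟩).2

theorem card_injExt_insert_le (φ₀ : ι → V) {X : Finset ι} {U : Finset V} {S : Finset ι}
    (hS : S ⊆ X) {x : ι} (hx : x ∈ X) (hxS : x ∉ S) (y : ι → V) :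
    (#U - #S) * #{ψ ∈ injExt φ₀ X U | ∀ i ∈ insert x S, ψ i = y i} ≤
      #{ψ ∈ injExt φ₀ X U | ∀ i ∈ S, ψ i = y i} := by
  by_cases hne : {ψ ∈ injExt φ₀ X U | ∀ i ∈ insert x S, ψ i = y i} = ∅
  · rw [hne]; simp
  obtain ⟨ψ₀, hψ₀⟩ := Finset.nonempty_iff_ne_empty.2 hne
  obtain ⟨hψ₀, hψ₀y⟩ := Finset.mem_filter.1 hψ₀
  obtain ⟨-, hinj, hU⟩ := mem_injExt.1 hψ₀
  have hyU : ∀ i ∈ insert x S, y i ∈ U := fun i hi => by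
    rw [← hψ₀y i hi]; exact hU i (Finset.insert_subset hx hS hi)
  have hyx : y x ∉ S.image y := by
    intro h
    obtain ⟨i, hi, hix⟩ := Finset.mem_image.1 h
    rw [← hψ₀y i (Finset.mem_insert_of_mem hi), ← hψ₀y x (Finset.mem_insert_self _ _)] at hix
    exact hxS (hinj (hS hi) hx hix ▸ hi)
  have hcardU : #U - #S ≤ #(U \ S.image y) := by
    have := Finset.le_card_sdiff (S.image y) U
    have h2 : #(S.image y) ≤ #S := Finset.card_image_le
    omega
  refine (Nat.mul_le_mul_right _ hcardU).trans ?_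
  have heach : ∀ v ∈ U \ S.image y, #{ψ ∈ injExt φ₀ X U | ∀ i ∈ insert x S, ψ i = y i} ≤
      #{ψ ∈ {ψ ∈ injExt φ₀ X U | ∀ i ∈ S, ψ i = y i} | ψ x = v} := by
    intro v hv
    obtain ⟨hvU, hvS⟩ := Finset.mem_sdiff.1 hv
    have hswU : ∀ u ∈ U, Equiv.swap v (y x) u ∈ U := by
      intro u hu
      rw [Equiv.swap_apply_def]
      split_ifs
      exacts [hyU x (Finset.mem_insert_self _ _), hvU, hu]
    refine Finset.card_le_card_of_injOn
      (fun ψ i => if i ∈ X then Equiv.swap v (y x) (ψ i) else ψ i) ?_ ?_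
    · intro ψ hψ
      obtain ⟨hψ, hψy⟩ := Finset.mem_filter.1 (Finset.mem_coe.1 hψ)
      obtain ⟨h1, h2, h3⟩ := mem_injExt.1 hψ
      refine Finset.mem_coe.2 (Finset.mem_filter.2 ⟨Finset.mem_filter.2 ⟨mem_injExt.2 ⟨?_, ?_, ?_⟩,
        ?_⟩, ?_⟩)
      · intro i hi; simp only [hi, if_false]; exact h1 i hi
      · intro i hi j hj hij
        rw [Finset.mem_coe] at hi hj
        simp only [hi, hj, if_true, EmbeddingLike.apply_eq_iff_eq] at hij
        exact h2 hi hj hij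
      · intro i hi; simp only [hi, if_true]; exact hswU _ (h3 i hi)
      · intro i hi
        simp only [hS hi, if_true]
        rw [hψy i (Finset.mem_insert_of_mem hi)]
        have hmem := Finset.mem_image_of_mem y hi
        exact Equiv.swap_apply_of_ne_of_ne (fun h => hvS (h ▸ hmem)) (fun h => hyx (h ▸ hmem))
      · simp only [hx, if_true]
        rw [hψy x (Finset.mem_insert_self _ _), Equiv.swap_apply_right]
    · intro ψ _ ψ' _ h
      funext i
      have := congrFun h i
      by_cases hi : i ∈ X
      · simpa [hi] using this
      · simpa [hi] using this
  calc _ = ∑ v ∈ U \ S.image y, #{ψ ∈ injExt φ₀ X U | ∀ i ∈ insert x S, ψ i = y i} := by simp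
    _ ≤ ∑ v ∈ U \ S.image y, #{ψ ∈ {ψ ∈ injExt φ₀ X U | ∀ i ∈ S, ψ i = y i} | ψ x = v} :=
        Finset.sum_le_sum heach
    _ ≤ ∑ v : V, #{ψ ∈ {ψ ∈ injExt φ₀ X U | ∀ i ∈ S, ψ i = y i} | ψ x = v} :=
        Finset.sum_le_sum_of_subset (Finset.subset_univ _)
    _ = _ := (Finset.card_eq_sum_card_fiberwise fun _ _ =>
        Finset.mem_coe.2 (Finset.mem_univ _)).symm

theorem card_injExt_mul_le (φ₀ : ι → V) {X : Finset ι} {U : Finset V} (S : Finset ι)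
    (hS : S ⊆ X) (y : ι → V) :
    (#U).descFactorial #S * #{ψ ∈ injExt φ₀ X U | ∀ i ∈ S, ψ i = y i} ≤ #(injExt φ₀ X U) := by
  induction S using Finset.induction_on with
  | empty => simp
  | insert x S hxS ih =>
    rw [Finset.insert_subset_iff] at hS
    rw [Finset.card_insert_of_notMem hxS, Nat.descFactorial_succ, mul_comm (#U - #S), mul_assoc]
    exact (Nat.mul_le_mul_left _ (card_injExt_insert_le φ₀ hS.2 hS.1 hxS y)).trans (ih hS.2)

/-- A uniformly random injection of `X` into `U`. -/
theorem exists_random_injection (φ₀ : ι → V) {X : Finset ι} {U : Finset V} (h : #X ≤ #U) :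
    ∃ w : (ι → V) → ℝ, IsProb w ∧
      (∀ ψ, w ψ ≠ 0 → (∀ i, i ∉ X → ψ i = φ₀ i) ∧ Set.InjOn ψ X ∧ ∀ i ∈ X, ψ i ∈ U) ∧
      ∀ S ⊆ X, ∀ y : ι → V,
        pr w (fun ψ => ∀ i ∈ S, ψ i = y i) ≤ 1 / ((#U).descFactorial #S : ℝ) := by
  have hpos : (0 : ℝ) < #(injExt φ₀ X U) := by
    exact_mod_cast Finset.card_pos.2 (injExt_nonempty h)
  refine ⟨fun ψ => ind (ψ ∈ injExt φ₀ X U) / #(injExt φ₀ X U), ⟨fun ψ =>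
    div_nonneg (ind_nonneg _) hpos.le, ?_⟩, ?_, ?_⟩
  · rw [← Finset.sum_div]
    rw [← Finset.sum_subset (Finset.subset_univ (injExt φ₀ X U)) fun ψ _ hψ => ind_not hψ,
      Finset.sum_congr rfl fun ψ hψ => ind_of hψ, Finset.sum_const, nsmul_eq_mul, mul_one]
    exact div_self hpos.ne'
  · intro ψ hψ
    by_contra hn
    rw [← mem_injExt] at hn
    simp [ind_not hn] at hψ
  · intro S hS y
    have hdf : (0 : ℝ) < (#U).descFactorial #S := by
      exact_mod_cast Nat.descFactorial_pos.2 ((Finset.card_le_card hS).trans h)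
    have h1 : pr (fun ψ => ind (ψ ∈ injExt φ₀ X U) / #(injExt φ₀ X U))
        (fun ψ => ∀ i ∈ S, ψ i = y i) =
        #{ψ ∈ injExt φ₀ X U | ∀ i ∈ S, ψ i = y i} / #(injExt φ₀ X U) := by
      rw [pr, Finset.card_filter, Nat.cast_sum, Finset.sum_div,
        ← Finset.sum_subset (Finset.subset_univ (injExt φ₀ X U))]
      · refine Finset.sum_congr rfl fun ψ hψ => ?_
        rw [ind_of hψ]
        by_cases h2 : ∀ i ∈ S, ψ i = y i
        · rw [ind_of h2, if_pos h2]; simp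
        · rw [ind_not h2, if_neg h2]; simp
      · intro ψ _ hψ
        rw [ind_not hψ]; simp
    rw [h1, div_le_div_iff₀ hpos hdf, one_mul, mul_comm]
    exact_mod_cast card_injExt_mul_le φ₀ S hS y

theorem pow_le_three_pow_mul_descFactorial (N : ℕ) :
    ∀ a ≤ N, (N : ℝ) ^ a ≤ 3 ^ a * N.descFactorial a := by
  induction N with
  | zero => intro a ha; obtain rfl : a = 0 := by omega
            simp
  | succ N ih =>
    intro a ha
    rcases a with _ | a
    · simp
    have h1 := ih a (by omega)
    rw [Nat.succ_descFactorial_succ, pow_succ, pow_succ]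
    have h2 : ((N : ℝ) + 1) ^ a ≤ 3 * (N : ℝ) ^ a := by
      rcases Nat.eq_zero_or_pos N with h | h
      · subst h
        obtain rfl : a = 0 := by omega
        norm_num
      have hN : (0 : ℝ) < N := by exact_mod_cast h
      have h3 : (N : ℝ) + 1 = N * (1 + 1 / N) := by field_simp
      rw [h3, mul_pow, mul_comm]
      refine mul_le_mul_of_nonneg_right ?_ (by positivity)
      calc (1 + 1 / (N : ℝ)) ^ a ≤ Real.exp (1 / N) ^ a := by
            gcongr
            have := Real.add_one_le_exp (1 / (N : ℝ)); linarith
        _ = Real.exp (a / N) := by rw [← Real.exp_nat_mul]; congr 1; ring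
        _ ≤ Real.exp 1 := Real.exp_le_exp.2 ((div_le_one hN).2 (by
            exact_mod_cast (by omega : a ≤ N)))
        _ ≤ 3 := by have := Real.exp_one_lt_d9; linarith
    push_cast
    calc ((N : ℝ) + 1) ^ a * (N + 1) ≤ 3 * (3 ^ a * N.descFactorial a) * (N + 1) := by
          refine mul_le_mul_of_nonneg_right (h2.trans ?_) (by positivity)
          linarith
      _ = _ := by ring

theorem one_div_descFactorial_le {N a : ℕ} (ha : a ≤ N) :
    1 / (N.descFactorial a : ℝ) ≤ (3 / N) ^ a := by
  rcases Nat.eq_zero_or_pos a with h | h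
  · subst h; simp
  have hN : (0 : ℝ) < N := by exact_mod_cast (by omega : 0 < N)
  have hdf : (0 : ℝ) < N.descFactorial a := by exact_mod_cast Nat.descFactorial_pos.2 ha
  rw [div_pow, div_le_div_iff₀ hdf (by positivity), one_mul]
  exact pow_le_three_pow_mul_descFactorial N a ha

theorem pow_le_two_mul_descFactorial {N a : ℕ} (ha : 2 * a ^ 2 ≤ N) :
    (N : ℝ) ^ a ≤ 2 * N.descFactorial a := by
  rcases Nat.eq_zero_or_pos a with h | h
  · subst h; simp
  have haN : a ≤ N := by nlinarith
  have hN : (0 : ℝ) < N := by exact_mod_cast (by omega : 0 < N)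
  have h1 : ((N - a : ℕ) : ℝ) ^ a ≤ N.descFactorial a := by
    have h2 := Nat.pow_sub_le_descFactorial N a
    have h3 : (N - a) ^ a ≤ (N + 1 - a) ^ a := Nat.pow_le_pow_left (by omega) a
    exact_mod_cast h3.trans h2
  rw [Nat.cast_sub haN] at h1
  have h4 : (-2 : ℝ) ≤ -(a / N : ℝ) := by
    have : (a / N : ℝ) ≤ 1 := (div_le_one hN).2 (by exact_mod_cast haN)
    linarith
  have h5 := one_add_mul_le_pow h4 a
  have h6 : (a : ℝ) * (a / N) ≤ 1 / 2 := by
    rw [← mul_div_assoc, div_le_iff₀ hN]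
    have : (2 * a ^ 2 : ℝ) ≤ N := by exact_mod_cast ha
    nlinarith
  have h7 : (1 : ℝ) / 2 ≤ (1 + -(a / N : ℝ)) ^ a := by linarith
  have h8 : ((N : ℝ) - a) = N * (1 + -(a / N : ℝ)) := by field_simp; ring
  rw [h8, mul_pow] at h1
  have : 0 < (N : ℝ) ^ a := by positivity
  nlinarith

/-- Composition of a spread random map with a kernel which is spread relative to it. -/
theorem pr_mix_spread {w : (ι → V) → ℝ} (hw : ∀ f, 0 ≤ w f) {κ : (ι → V) → (ι → V) → ℝ}
    {X X' : Finset ι} {A A' B : ℝ} (hA' : 0 ≤ A') (hB : 0 ≤ B)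
    (h1 : ∀ S ⊆ X, ∀ y : ι → V, pr w (fun f => ∀ i ∈ S, f i = y i) ≤ A * B ^ #S)
    (h2 : ∀ f, w f ≠ 0 → ∀ S ⊆ X', ∀ y : ι → V,
      pr (κ f) (fun ψ => ∀ i ∈ S, ψ i = y i) ≤ A' * B ^ #{i ∈ S | i ∉ X ∨ f i ≠ y i})
    (S : Finset ι) (hS : S ⊆ X') (y : ι → V) :
    pr (mix w κ) (fun ψ => ∀ i ∈ S, ψ i = y i) ≤ A * A' * (2 * B) ^ #S := by
  have hA : 0 ≤ A := by
    have := h1 ∅ (by simp) y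
    simp only [Finset.card_empty, pow_zero, mul_one] at this
    exact (pr_nonneg hw _).trans this
  rw [pr_mix]
  calc ∑ f, w f * pr (κ f) (fun ψ => ∀ i ∈ S, ψ i = y i)
      ≤ ∑ f, w f * (A' * ∑ R ∈ (S ∩ X).powerset, ind (∀ i ∈ R, f i = y i) * B ^ (#S - #R)) := by
        refine Finset.sum_le_sum fun f _ => ?_
        by_cases hf : w f = 0
        · simp [hf]
        refine mul_le_mul_of_nonneg_left ((h2 f hf S hS y).trans
          (mul_le_mul_of_nonneg_left ?_ hA')) (hw f)
        have hmem : {i ∈ S | i ∈ X ∧ f i = y i} ∈ (S ∩ X).powerset := by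
          rw [Finset.mem_powerset]; intro i hi
          simp only [Finset.mem_filter, Finset.mem_inter] at hi ⊢; tauto
        have hcard : #{i ∈ S | i ∉ X ∨ f i ≠ y i} = #S - #{i ∈ S | i ∈ X ∧ f i = y i} := by
          have := Finset.card_filter_add_card_filter_not (s := S) (fun i => i ∈ X ∧ f i = y i)
          have h3 : {i ∈ S | ¬ (i ∈ X ∧ f i = y i)} = {i ∈ S | i ∉ X ∨ f i ≠ y i} := by
            ext i; simp only [Finset.mem_filter]; tauto
          rw [h3] at this
          omega
        rw [hcard]
        refine le_trans (le_of_eq ?_) (Finset.single_le_sum (f := fun R =>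
          ind (∀ i ∈ R, f i = y i) * B ^ (#S - #R)) (fun R _ =>
          mul_nonneg (ind_nonneg _) (by positivity)) hmem)
        rw [ind_of, one_mul]
        intro i hi
        exact (Finset.mem_filter.1 hi).2.2
    _ = A' * ∑ R ∈ (S ∩ X).powerset, pr w (fun f => ∀ i ∈ R, f i = y i) * B ^ (#S - #R) := by
        simp_rw [pr, Finset.mul_sum, Finset.sum_mul, Finset.mul_sum]
        rw [Finset.sum_comm]
        refine Finset.sum_congr rfl fun _ _ => Finset.sum_congr rfl fun _ _ => by ring
    _ ≤ A' * ∑ R ∈ (S ∩ X).powerset, A * B ^ #S := by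
        refine mul_le_mul_of_nonneg_left (Finset.sum_le_sum fun R hR => ?_) hA'
        rw [Finset.mem_powerset] at hR
        have hRS := Finset.card_le_card (hR.trans Finset.inter_subset_left)
        calc _ ≤ A * B ^ #R * B ^ (#S - #R) :=
              mul_le_mul_of_nonneg_right (h1 R (hR.trans Finset.inter_subset_right) y)
                (by positivity)
          _ = A * B ^ #S := by rw [mul_assoc, ← pow_add]; congr 2; omega
    _ = A * A' * (2 ^ #(S ∩ X) * B ^ #S) := by
        rw [Finset.sum_const, Finset.card_powerset, nsmul_eq_mul]; push_cast; ring
    _ ≤ A * A' * (2 ^ #S * B ^ #S) := by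
        refine mul_le_mul_of_nonneg_left (mul_le_mul_of_nonneg_right (pow_le_pow_right₀
          (by norm_num) (Finset.card_le_card Finset.inter_subset_left)) (by positivity))
          (by positivity)
    _ = _ := by rw [mul_pow]

end Injections

section Spread
open scoped Classical

set_option linter.unusedSectionVars false

variable {β : Type*} [DecidableEq β]

/-- The expectation of `f` on the `p`-random subset of `E`. -/
noncomputable def EE (E : Finset β) (p : ℝ) (f : Finset β → ℝ) : ℝ :=
  ∑ F ∈ E.powerset, p ^ #F * (1 - p) ^ (#E - #F) * f F

theorem EE_empty (p : ℝ) (f : Finset β → ℝ) : EE ∅ p f = f ∅ := by simp [EE]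

theorem EE_insert {E : Finset β} {e : β} (he : e ∉ E) (p : ℝ) (f : Finset β → ℝ) :
    EE (insert e E) p f = (1 - p) * EE E p f + p * EE E p (fun F => f (insert e F)) := by
  rw [EE, Finset.sum_powerset_insert he, EE, EE, Finset.mul_sum, Finset.mul_sum]
  congr 1
  · refine Finset.sum_congr rfl fun F hF => ?_
    have hF' := Finset.card_le_card (Finset.mem_powerset.1 hF)
    rw [Finset.card_insert_of_notMem he, Nat.sub_add_comm hF', pow_succ]
    ring
  · refine Finset.sum_congr rfl fun F hF => ?_
    rw [Finset.card_insert_of_notMem he, Finset.card_insert_of_notMem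
      fun h => he (Finset.mem_powerset.1 hF h), Nat.add_sub_add_right, pow_succ]
    ring

theorem EE_mono {E : Finset β} {p : ℝ} (h0 : 0 ≤ p) (h1 : p ≤ 1) {f g : Finset β → ℝ}
    (h : ∀ F ⊆ E, f F ≤ g F) : EE E p f ≤ EE E p g := by
  have : 0 ≤ 1 - p := by linarith
  exact Finset.sum_le_sum fun F hF =>
    mul_le_mul_of_nonneg_left (h F (Finset.mem_powerset.1 hF)) (by positivity)

theorem EE_add (E : Finset β) (p : ℝ) (f g : Finset β → ℝ) :
    EE E p (fun F => f F + g F) = EE E p f + EE E p g := by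
  simp [EE, mul_add, Finset.sum_add_distrib]

theorem EE_mul_const (E : Finset β) (p c : ℝ) (f : Finset β → ℝ) :
    EE E p (fun F => f F * c) = EE E p f * c := by
  simp [EE, Finset.sum_mul, mul_assoc]

theorem EE_const (E : Finset β) (p c : ℝ) : EE E p (fun _ => c) = c := by
  induction E using Finset.induction_on with
  | empty => exact EE_empty _ _
  | insert e E he ih => rw [EE_insert he, ih]; ring

theorem EE_union (E : Finset β) (p q : ℝ) (f : Finset β → ℝ) :
    EE E p (fun A => EE E q fun B => f (A ∪ B)) = EE E (p + q - p * q) f := by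
  induction E using Finset.induction_on generalizing f with
  | empty => simp [EE_empty]
  | insert e E he ih =>
    have h1 := ih f
    have h2 := ih fun F => f (insert e F)
    rw [EE_insert he, EE_insert he, ← h1, ← h2]
    simp_rw [EE_insert he, Finset.insert_union, Finset.union_insert, Finset.insert_idem]
    simp_rw [EE_add, mul_comm (1 - q), mul_comm q, EE_mul_const]
    ring

theorem EE_antitone {E : Finset β} {p q : ℝ} (h0 : 0 ≤ p) (hpq : p ≤ q) (h1 : q ≤ 1)
    {f : Finset β → ℝ} (hf : Antitone f) : EE E q f ≤ EE E p f := by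
  induction E using Finset.induction_on generalizing f with
  | empty => simp [EE_empty]
  | insert e E he ih =>
    rw [EE_insert he, EE_insert he]
    have a1 := ih hf
    have a2 := ih (f := fun F => f (insert e F)) fun A B h => hf (Finset.insert_subset_insert e h)
    have a3 : EE E p (fun F => f (insert e F)) ≤ EE E p f :=
      EE_mono h0 (hpq.trans h1) fun F _ => hf (Finset.subset_insert e F)
    nlinarith

theorem spread_round {α : Type*} [Fintype α] {ν : α → ℝ} (hν : ∀ a, 0 ≤ ν a)
    {S : α → Finset β} {E : Finset β} (hS : ∀ a, S a ⊆ E) {κ : ℝ}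
    (hspread : ∀ R : Finset β, ∑ a, ν a * ind (R ⊆ S a) ≤ κ ^ #R) {t : ℕ}
    (ht : ∀ a, ν a ≠ 0 → #(S a) ≤ 2 * t) {p : ℝ} (hκ : 0 ≤ κ) (hκp : κ ≤ p) (hp : 0 < p)
    (hp1 : p ≤ 1) {T : α → Finset β → Finset β}
    (hT : ∀ a, ν a ≠ 0 → ∀ W, ∃ b, ν b ≠ 0 ∧ S b ⊆ W ∪ S a ∧ T a W = S b \ W)
    (hmin : ∀ a, ν a ≠ 0 → ∀ W b, ν b ≠ 0 → S b ⊆ W ∪ S a → #(T a W) ≤ #(S b \ W)) :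
    EE E p (fun W => ∑ a, ν a * ind (t ≤ #(T a W))) ≤ (4 * κ / p) ^ t := by
  set wt : Finset β → ℝ := fun F => p ^ #F * (1 - p) ^ (#E - #F) with hwt
  have hp' : 0 ≤ 1 - p := by linarith
  have hwt0 : ∀ F, 0 ≤ wt F := fun F => by positivity
  have hwt1 : ∑ F ∈ E.powerset, wt F = 1 := by
    have := EE_const E p 1
    simpa [EE] using this
  let Q : α → Finset β → Finset β → Prop := fun a Z T' =>
    T' ⊆ Z ∧ T a (Z \ T') = T' ∧ t ≤ #T'
  have step1 : ∀ a, ν a ≠ 0 → ∑ W ∈ E.powerset, wt W * ind (t ≤ #(T a W)) ≤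
      ∑ Z ∈ E.powerset, ∑ T' ∈ E.powerset, wt Z * ((1 / p) ^ #T' * ind (Q a Z T')) := by
    intro a ha
    have hTE : ∀ W, T a W ⊆ E := fun W => by
      obtain ⟨b, -, -, h⟩ := hT a ha W
      rw [h]; exact Finset.sdiff_subset.trans (hS b)
    have hdis : ∀ W, Disjoint W (T a W) := fun W => by
      obtain ⟨b, -, -, h⟩ := hT a ha W
      rw [h]; exact Finset.disjoint_sdiff
    have hsd : ∀ W, (W ∪ T a W) \ T a W = W := fun W =>
      Finset.union_sdiff_cancel_right (hdis W)
    rw [← Finset.sum_product']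
    have hinj : Set.InjOn (fun W => (W ∪ T a W, T a W)) (E.powerset : Set (Finset β)) := by
      intro W _ W' _ h
      simp only [Prod.mk.injEq] at h
      rw [← hsd W, ← hsd W', h.1, h.2]
    calc _ ≤ ∑ W ∈ E.powerset, wt (W ∪ T a W) *
          ((1 / p) ^ #(T a W) * ind (Q a (W ∪ T a W) (T a W))) := by
          refine Finset.sum_le_sum fun W hW => ?_
          by_cases h : t ≤ #(T a W)
          · rw [ind_of h, ind_of (show Q a (W ∪ T a W) (T a W) from
              ⟨Finset.subset_union_right, by rw [hsd], h⟩), mul_one, mul_one]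
            have hc : #(W ∪ T a W) = #W + #(T a W) := Finset.card_union_of_disjoint (hdis W)
            have hle := Finset.card_le_card
              (Finset.union_subset (Finset.mem_powerset.1 hW) (hTE W))
            rw [hc] at hle
            simp only [hwt, hc]
            rw [show #E - #W = (#E - (#W + #(T a W))) + #(T a W) by omega, pow_add, pow_add,
              one_div, inv_pow]
            have h2 : (1 - p) ^ #(T a W) ≤ 1 := pow_le_one₀ hp' (by linarith)
            have h3 : 0 ≤ p ^ #W * (1 - p) ^ (#E - (#W + #(T a W))) := by positivity
            calc _ = p ^ #W * (1 - p) ^ (#E - (#W + #(T a W))) * (1 - p) ^ #(T a W) := by ring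
              _ ≤ p ^ #W * (1 - p) ^ (#E - (#W + #(T a W))) * 1 :=
                mul_le_mul_of_nonneg_left h2 h3
              _ = _ := by field_simp
          · rw [ind_not h, mul_zero]
            exact mul_nonneg (hwt0 _) (mul_nonneg (by positivity) (ind_nonneg _))
      _ = ∑ x ∈ E.powerset.image (fun W => (W ∪ T a W, T a W)),
            wt x.1 * ((1 / p) ^ #x.2 * ind (Q a x.1 x.2)) := by
          rw [Finset.sum_image hinj]
      _ ≤ _ := by
          refine Finset.sum_le_sum_of_subset_of_nonneg ?_ fun x _ _ =>
            mul_nonneg (hwt0 _) (mul_nonneg (by positivity) (ind_nonneg _))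
          intro x hx
          obtain ⟨W, hW, rfl⟩ := Finset.mem_image.1 hx
          simp only [Finset.mem_product, Finset.mem_powerset] at hW ⊢
          exact ⟨Finset.union_subset hW (hTE W), hTE W⟩
  have step2 : ∀ Z, ∑ a, ν a * ∑ T' ∈ E.powerset, ((1 / p) ^ #T' * ind (Q a Z T')) ≤
      (4 * κ / p) ^ t := by
    intro Z
    by_cases hb : ∃ b, ν b ≠ 0 ∧ S b ⊆ Z
    · obtain ⟨b, hb, hbZ⟩ := hb
      have hsub : ∀ a, ν a ≠ 0 → ∀ T', Q a Z T' → T' ⊆ S b ∧ T' ⊆ S a := by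
        rintro a ha T' ⟨h1, h2, -⟩
        obtain ⟨c, hc, hcs, hcT⟩ := hT a ha (Z \ T')
        rw [h2] at hcT
        have hTa : T' ⊆ S a := by
          rw [hcT]; intro x hx
          rw [Finset.mem_sdiff] at hx
          exact (Finset.mem_union.1 (hcs hx.1)).resolve_left hx.2
        have hm := hmin a ha (Z \ T') b hb (by
          intro x hx
          by_cases hxT : x ∈ T'
          · exact Finset.mem_union_right _ (hTa hxT)
          · exact Finset.mem_union_left _ (Finset.mem_sdiff.2 ⟨hbZ hx, hxT⟩))
        rw [h2] at hm
        have hsb : S b \ (Z \ T') ⊆ T' := by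
          intro x hx
          rw [Finset.mem_sdiff, Finset.mem_sdiff] at hx
          by_contra h; exact hx.2 ⟨hbZ hx.1, h⟩
        have := Finset.eq_of_subset_of_card_le hsb hm
        exact ⟨this ▸ Finset.sdiff_subset, hTa⟩
      calc _ ≤ ∑ a, ν a * ∑ T' ∈ (S b).powerset with t ≤ #T', ((1 / p) ^ #T' * ind (T' ⊆ S a)) := by
            refine Finset.sum_le_sum fun a _ => ?_
            by_cases ha : ν a = 0
            · simp [ha]
            refine mul_le_mul_of_nonneg_left ?_ (hν a)
            have : ∀ T' ∈ E.powerset, ¬ T' ∈ {T' ∈ (S b).powerset | t ≤ #T'} →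
                (1 / p) ^ #T' * ind (Q a Z T') = 0 := by
              intro T' _ h
              rw [ind_not, mul_zero]
              intro hQ
              exact h (Finset.mem_filter.2 ⟨Finset.mem_powerset.2 (hsub a ha T' hQ).1, hQ.2.2⟩)
            rw [← Finset.sum_subset (s₁ := {T' ∈ (S b).powerset | t ≤ #T'}) ?_ this]
            · refine Finset.sum_le_sum fun T' _ => mul_le_mul_of_nonneg_left
                (ind_mono fun hQ => (hsub a ha T' hQ).2) (by positivity)
            · exact (Finset.filter_subset _ _).trans (Finset.powerset_mono.2 (hS b))
        _ = ∑ T' ∈ (S b).powerset with t ≤ #T', (1 / p) ^ #T' * ∑ a, ν a * ind (T' ⊆ S a) := by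
            simp_rw [Finset.mul_sum]
            rw [Finset.sum_comm]
            refine Finset.sum_congr rfl fun _ _ => Finset.sum_congr rfl fun _ _ => by ring
        _ ≤ ∑ T' ∈ (S b).powerset with t ≤ #T', (κ / p) ^ t := by
            refine Finset.sum_le_sum fun T' hT' => ?_
            calc _ ≤ (1 / p) ^ #T' * κ ^ #T' :=
                  mul_le_mul_of_nonneg_left (hspread T') (by positivity)
              _ = (κ / p) ^ #T' := by rw [← mul_pow]; congr 1; ring
              _ ≤ (κ / p) ^ t := pow_le_pow_of_le_one (by positivity)
                  ((div_le_one hp).2 hκp) (Finset.mem_filter.1 hT').2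
        _ ≤ 2 ^ (2 * t) * (κ / p) ^ t := by
            rw [Finset.sum_const, nsmul_eq_mul]
            refine mul_le_mul_of_nonneg_right ?_ (by positivity)
            calc (#{T' ∈ (S b).powerset | t ≤ #T'} : ℝ) ≤ #(S b).powerset := by
                  exact_mod_cast Finset.card_filter_le _ _
              _ = 2 ^ #(S b) := by rw [Finset.card_powerset]; norm_num
              _ ≤ _ := pow_le_pow_right₀ (by norm_num) (ht b hb)
        _ = _ := by rw [pow_mul, ← mul_pow]; congr 1; ring
    · refine le_trans (le_of_eq ?_) (show 0 ≤ (4 * κ / p) ^ t by positivity)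
      refine Finset.sum_eq_zero fun a _ => ?_
      by_cases ha : ν a = 0
      · simp [ha]
      rw [Finset.sum_eq_zero, mul_zero]
      intro T' _
      rw [ind_not, mul_zero]
      rintro ⟨h1, h2, -⟩
      obtain ⟨c, hc, hcs, hcT⟩ := hT a ha (Z \ T')
      refine hb ⟨c, hc, fun x hx => ?_⟩
      by_cases hxZ : x ∈ Z \ T'
      · exact (Finset.mem_sdiff.1 hxZ).1
      · exact h1 (h2 ▸ hcT ▸ Finset.mem_sdiff.2 ⟨hx, hxZ⟩)
  calc EE E p (fun W => ∑ a, ν a * ind (t ≤ #(T a W)))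
      = ∑ a, ν a * ∑ W ∈ E.powerset, wt W * ind (t ≤ #(T a W)) := by
        simp_rw [EE, Finset.mul_sum]
        rw [Finset.sum_comm]
        refine Finset.sum_congr rfl fun _ _ => Finset.sum_congr rfl fun _ _ => by ring
    _ ≤ ∑ a, ν a * ∑ Z ∈ E.powerset, ∑ T' ∈ E.powerset,
          wt Z * ((1 / p) ^ #T' * ind (Q a Z T')) := by
        refine Finset.sum_le_sum fun a _ => ?_
        by_cases ha : ν a = 0
        · simp [ha]
        exact mul_le_mul_of_nonneg_left (step1 a ha) (hν a)
    _ = ∑ Z ∈ E.powerset, wt Z * ∑ a, ν a * ∑ T' ∈ E.powerset,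
          ((1 / p) ^ #T' * ind (Q a Z T')) := by
        simp_rw [Finset.mul_sum]
        rw [Finset.sum_comm]
        refine Finset.sum_congr rfl fun _ _ => Finset.sum_congr rfl fun _ _ =>
          Finset.sum_congr rfl fun _ _ => by ring
    _ ≤ ∑ Z ∈ E.powerset, wt Z * (4 * κ / p) ^ t :=
        Finset.sum_le_sum fun Z _ => mul_le_mul_of_nonneg_left (step2 Z) (hwt0 Z)
    _ = _ := by rw [← Finset.sum_mul, hwt1, one_mul]

/-- A spread family is unlikely to be missed by a sufficiently dense random set. -/
theorem spread_fail {α : Type*} [Fintype α] {E : Finset β} {κ : ℝ} (hκ : 0 ≤ κ) (pp : ℕ → ℝ)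
    (hpp0 : ∀ i, 0 < pp i) (hpp : ∀ i, κ ≤ pp i) (k : ℕ) :
    ∀ (ν : α → ℝ) (_ : ∀ a, 0 ≤ ν a) (S : α → Finset β) (_ : ∀ a, S a ⊆ E)
    (_ : ∀ R : Finset β, ∑ a, ν a * ind (R ⊆ S a) ≤ κ ^ #R)
    (_ : ∀ a, ν a ≠ 0 → #(S a) < 2 ^ k) {p : ℝ} (_ : p ≤ 1) (_ : ∑ i ∈ range k, pp i ≤ p),
    EE E p (fun W => ind (∀ a, ν a ≠ 0 → ¬ S a ⊆ W)) * ∑ a, ν a ≤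
      ∑ i ∈ range k, (4 * κ / pp i) ^ 2 ^ i := by
  induction k with
  | zero =>
    intro ν hν S hS hspread hk p hp1 hp
    simp only [Finset.range_zero, Finset.sum_empty]
    by_cases h : ∃ a, ν a ≠ 0
    · obtain ⟨a, ha⟩ := h
      have h0 : S a = ∅ := by
        have := hk a ha
        simpa using this
      have : (fun W : Finset β => ind (∀ a, ν a ≠ 0 → ¬ S a ⊆ W)) = fun _ => 0 := by
        funext W
        exact ind_not fun hW => hW a ha (by simp [h0])
      rw [this, EE_const, zero_mul]
    · push Not at h
      simp [h]
  | succ k ih =>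
    intro ν hν S hS hspread hk p hp1 hp
    rw [Finset.sum_range_succ] at hp ⊢
    have hs0 : 0 ≤ ∑ i ∈ range k, pp i := Finset.sum_nonneg fun i _ => (hpp0 i).le
    have hTex : ∀ a W, ∃ T : Finset β, ν a ≠ 0 →
        (∃ b, ν b ≠ 0 ∧ S b ⊆ W ∪ S a ∧ T = S b \ W) ∧
        ∀ b, ν b ≠ 0 → S b ⊆ W ∪ S a → #T ≤ #(S b \ W) := by
      intro a W
      by_cases ha : ν a = 0
      · exact ⟨∅, fun h => absurd ha h⟩
      obtain ⟨b, hb, hmin⟩ := Finset.exists_min_image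
        {b : α | ν b ≠ 0 ∧ S b ⊆ W ∪ S a} (fun b => #(S b \ W))
        ⟨a, by simp [ha, Finset.subset_union_right]⟩
      simp only [Finset.mem_filter, Finset.mem_univ, true_and] at hb hmin
      exact ⟨S b \ W, fun _ => ⟨⟨b, hb.1, hb.2, rfl⟩, fun c hc hc' => hmin c ⟨hc, hc'⟩⟩⟩
    choose T hT using hTex
    have hround := spread_round (T := T) (t := 2 ^ k) hν hS hspread (fun a ha => by
      have := hk a ha; rw [pow_succ] at this; omega) hκ (hpp k) (hpp0 k)
      (by linarith) (fun a ha W => (hT a W ha).1) (fun a ha W => (hT a W ha).2)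
    set q := ∑ i ∈ range k, pp i
    have hTS : ∀ a W, ν a ≠ 0 → T a W ⊆ S a := by
      intro a W ha
      obtain ⟨b, -, hb, h⟩ := (hT a W ha).1
      rw [h]; intro x hx
      rw [Finset.mem_sdiff] at hx
      exact (Finset.mem_union.1 (hb hx.1)).resolve_left hx.2
    have hpk := hpp0 k
    have hanti : Antitone (fun W : Finset β => ind (∀ a, ν a ≠ 0 → ¬ S a ⊆ W)) :=
      fun A B hAB => ind_mono fun h a ha hA => h a ha (hA.trans hAB)
    have h1 : EE E p (fun W => ind (∀ a, ν a ≠ 0 → ¬ S a ⊆ W)) ≤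
        EE E (pp k) (fun W => EE E q fun W' => ind (∀ a, ν a ≠ 0 → ¬ S a ⊆ W ∪ W')) := by
      rw [EE_union E (pp k) q (fun W => ind (∀ a, ν a ≠ 0 → ¬ S a ⊆ W))]
      have h3 : 0 ≤ pp k * q := by positivity
      exact EE_antitone (by nlinarith) (by linarith) hp1 hanti
    have h2 : ∀ W, EE E q (fun W' => ind (∀ a, ν a ≠ 0 → ¬ S a ⊆ W ∪ W')) * ∑ a, ν a ≤
        ∑ i ∈ range k, (4 * κ / pp i) ^ 2 ^ i + ∑ a, ν a * ind (2 ^ k ≤ #(T a W)) := by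
      intro W
      have hsplit : ∑ a, ν a = ∑ a, ν a * ind (#(T a W) < 2 ^ k) +
          ∑ a, ν a * ind (2 ^ k ≤ #(T a W)) := by
        rw [← Finset.sum_add_distrib]
        refine Finset.sum_congr rfl fun a _ => ?_
        rcases lt_or_ge (#(T a W)) (2 ^ k) with h | h
        · rw [ind_of h, ind_not (not_le.2 h)]; ring
        · rw [ind_of h, ind_not (not_lt.2 h)]; ring
      have hle1 : EE E q (fun W' => ind (∀ a, ν a ≠ 0 → ¬ S a ⊆ W ∪ W')) ≤ 1 := by
        rw [← EE_const E q 1]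
        exact EE_mono hs0 (by linarith) fun _ _ => ind_le_one _
      have hbad0 : 0 ≤ ∑ a, ν a * ind (2 ^ k ≤ #(T a W)) :=
        Finset.sum_nonneg fun a _ => mul_nonneg (hν a) (ind_nonneg _)
      have hgood0 : ∀ a, 0 ≤ ν a * ind (#(T a W) < 2 ^ k) :=
        fun a => mul_nonneg (hν a) (ind_nonneg _)
      have hih := ih (fun a => ν a * ind (#(T a W) < 2 ^ k)) hgood0
        (fun a => if ν a ≠ 0 then T a W else ∅) (fun a => by
          split_ifs with h
          · exact (hTS a W h).trans (hS a)
          · simp) (fun R => by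
          refine le_trans (Finset.sum_le_sum fun a _ => ?_) (hspread R)
          by_cases ha : ν a = 0
          · simp [ha]
          · rw [mul_assoc]
            refine mul_le_mul_of_nonneg_left ?_ (hν a)
            rw [if_pos ha]
            refine (mul_le_of_le_one_left (ind_nonneg _) (ind_le_one _)).trans ?_
            exact ind_mono fun h => h.trans (hTS a W ha)) (fun a ha => by
          rw [if_pos (left_ne_zero_of_mul ha)]
          by_contra h
          exact right_ne_zero_of_mul ha (ind_not h)) (p := q) (by linarith) le_rfl
      have hmono : EE E q (fun W' => ind (∀ a, ν a ≠ 0 → ¬ S a ⊆ W ∪ W')) ≤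
          EE E q (fun W' => ind (∀ a, ν a * ind (#(T a W) < 2 ^ k) ≠ 0 →
            ¬ (if ν a ≠ 0 then T a W else ∅) ⊆ W')) := by
        refine EE_mono hs0 (by linarith) fun W' _ => ind_mono fun h a ha hsub => ?_
        have ha' := left_ne_zero_of_mul ha
        rw [if_pos ha'] at hsub
        obtain ⟨b, hb, -, hbT⟩ := (hT a W ha').1
        refine h b hb fun x hx => ?_
        by_cases hxW : x ∈ W
        · exact Finset.mem_union_left _ hxW
        · exact Finset.mem_union_right _ (hsub (hbT ▸ Finset.mem_sdiff.2 ⟨hx, hxW⟩))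
      rw [hsplit, mul_add]
      have hg := Finset.sum_nonneg fun a (_ : a ∈ Finset.univ) => hgood0 a
      have := mul_le_mul_of_nonneg_right hmono hg
      have := mul_le_mul_of_nonneg_right hle1 hbad0
      linarith
    have hν0 : 0 ≤ ∑ a, ν a := Finset.sum_nonneg fun a _ => hν a
    refine (mul_le_mul_of_nonneg_right h1 hν0).trans ?_
    rw [← EE_mul_const]
    refine (EE_mono hpk.le (by linarith) fun W _ => h2 W).trans ?_
    rw [EE_add, EE_const]
    linarith

end Spread

section EdgeSpread
open scoped Classical

variable {n : ℕ} {V : Type*} [Fintype V] [DecidableEq V]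

/-- The edges of the image of the tree given by the parent function `par`, rooted at `0`. -/
noncomputable def treeEdges (par : Fin n → Fin n) (φ : Fin n → V) : Finset (Sym2 V) :=
  ({k : Fin n | k.val ≠ 0} : Finset (Fin n)).image fun k => s(φ k, φ (par k))

/-- Adjacency in the tree given by the parent function `par`. -/
def treeAdj (par : Fin n → Fin n) (i j : Fin n) : Prop :=
  (j.val ≠ 0 ∧ i = par j) ∨ (i.val ≠ 0 ∧ j = par i)

/-- The vertices covered by a set of edges. -/
noncomputable def coveredBy (S : Finset (Sym2 V)) : Finset V := {v | ∃ e ∈ S, v ∈ e}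

/-- The maps from the vertices covered by `S` to a tree which send edges to edges. -/
noncomputable def homSet (par : Fin n → Fin n) (d : Fin n) (S : Finset (Sym2 V)) :
    Finset (V → Fin n) :=
  {ψ | (∀ v, v ∉ coveredBy S → ψ v = d) ∧ ∀ u v, s(u, v) ∈ S → treeAdj par (ψ u) (ψ v)}

theorem card_homSet_le {par : Fin n → Fin n} (hpar : ∀ k : Fin n, k.val ≠ 0 → par k < k)
    (d : Fin n) {D : ℕ} (hD : ∀ i, #{j | treeAdj par i j} ≤ D) {φ : Fin n → V}
    (hφ : Function.Injective φ) {B b : ℝ} (hB : 0 ≤ B) (hb1 : D * B ≤ b)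
    (hb2 : n * D * B ^ 2 ≤ b) (m : ℕ) :
    ∀ S ⊆ treeEdges par φ, #S = m → #(homSet par d S) * B ^ #(coveredBy S) ≤ b ^ m := by
  have hb : 0 ≤ b := le_trans (by positivity) hb1
  induction m with
  | zero =>
    intro S _ hS
    rw [Finset.card_eq_zero] at hS
    subst hS
    have h1 : coveredBy (∅ : Finset (Sym2 V)) = ∅ := by simp [coveredBy]
    have h2 : #(homSet par d (∅ : Finset (Sym2 V))) ≤ 1 := by
      rw [Finset.card_le_one]
      intro a ha c hc
      simp only [homSet, h1, Finset.mem_filter] at ha hc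
      funext v
      rw [ha.2.1 v (by simp), hc.2.1 v (by simp)]
    rw [h1]
    simpa using h2
  | succ m ih =>
    intro S hSφ hS
    obtain ⟨k, hk, hmax⟩ := Finset.exists_max_image
      {k : Fin n | k.val ≠ 0 ∧ s(φ k, φ (par k)) ∈ S} id (by
        obtain ⟨e, he⟩ := Finset.card_pos.1 (by omega : 0 < #S)
        obtain ⟨k, hk, rfl⟩ := Finset.mem_image.1 (hSφ he)
        exact ⟨k, by simpa using ⟨by simpa using hk, he⟩⟩)
    simp only [Finset.mem_filter, Finset.mem_univ, true_and, id] at hk hmax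
    obtain ⟨hk0, hkS⟩ := hk
    set x := φ k with hx
    set y := φ (par k) with hy
    have hlt := hpar k hk0
    have hxy : x ≠ y := fun h => hlt.ne (hφ h).symm
    set S' := S.erase s(x, y) with hS'
    have hcS' : #S' = m := by rw [hS', Finset.card_erase_of_mem hkS, hS]; rfl
    have hih := ih S' ((Finset.erase_subset _ _).trans hSφ) hcS'
    have hxS' : x ∉ coveredBy S' := by
      simp only [coveredBy, Finset.mem_filter, Finset.mem_univ, true_and, not_exists, not_and]
      intro e he hxe
      rw [hS', Finset.mem_erase] at he
      obtain ⟨j, hj, rfl⟩ := Finset.mem_image.1 (hSφ he.2)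
      simp only [Finset.mem_filter, Finset.mem_univ, true_and] at hj
      have hjk := hmax j ⟨hj, he.2⟩
      rcases Sym2.mem_iff.1 hxe with h | h
      · have := hφ h
        subst this
        exact he.1 rfl
      · have := hφ h
        have h2 := hpar j hj
        rw [← this] at h2
        exact absurd hjk (not_le.2 h2)
    have hsub : ∀ v, v ∈ coveredBy S ↔ v ∈ coveredBy S' ∨ v = x ∨ v = y := by
      intro v
      simp only [coveredBy, Finset.mem_filter, Finset.mem_univ, true_and]
      constructor
      · rintro ⟨e, he, hv⟩
        by_cases h : e = s(x, y)
        · subst h; exact Or.inr (Sym2.mem_iff.1 hv)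
        · exact Or.inl ⟨e, Finset.mem_erase.2 ⟨h, he⟩, hv⟩
      · rintro (⟨e, he, hv⟩ | h)
        · exact ⟨e, Finset.mem_of_mem_erase he, hv⟩
        · exact ⟨_, hkS, Sym2.mem_iff.2 h⟩
    have hne : ∀ u v, s(u, v) ∈ S' → u ≠ x ∧ v ≠ x := by
      intro u v h
      constructor
      · rintro rfl
        exact hxS' (by simp only [coveredBy, Finset.mem_filter, Finset.mem_univ, true_and]
                       exact ⟨_, h, Sym2.mem_mk_left _ _⟩)
      · rintro rfl
        exact hxS' (by simp only [coveredBy, Finset.mem_filter, Finset.mem_univ, true_and]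
                       exact ⟨_, h, Sym2.mem_mk_right _ _⟩)
    by_cases hyS : y ∈ coveredBy S'
    · have hcov : coveredBy S = insert x (coveredBy S') := by
        ext v; rw [hsub, Finset.mem_insert]
        constructor
        · rintro (h | h | h)
          · exact Or.inr h
          · exact Or.inl h
          · exact Or.inr (h ▸ hyS)
        · tauto
      have hcard : #(homSet par d S) ≤ D * #(homSet par d S') := by
        refine (Finset.card_le_mul_card_image (f := fun ψ => Function.update ψ x d) _ D ?_).trans
          (Nat.mul_le_mul_left _ (Finset.card_le_card ?_))
        · intro ψ' _
          refine (Finset.card_le_card_of_injOn (fun ψ => ψ x) (t := {j | treeAdj par (ψ' y) j})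
            ?_ ?_).trans (hD (ψ' y))
          · intro ψ hψ
            simp only [homSet, Finset.coe_filter, Finset.mem_filter, Finset.mem_univ, true_and,
              Set.mem_ofPred_eq] at hψ ⊢
            rw [← hψ.2, Function.update_of_ne hxy.symm]
            exact hψ.1.2 y x (by rw [Sym2.eq_swap]; exact hkS)
          · intro ψ hψ ψ₂ hψ₂ h
            simp only [Finset.coe_filter, Set.mem_ofPred_eq] at hψ hψ₂
            funext v
            by_cases hv : v = x
            · subst hv; exact h
            · have := congrFun (hψ.2.trans hψ₂.2.symm) v
              rwa [Function.update_of_ne hv, Function.update_of_ne hv] at this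
        · intro ψ' h
          obtain ⟨ψ, hψ, rfl⟩ := Finset.mem_image.1 h
          simp only [homSet, Finset.mem_filter, Finset.mem_univ, true_and] at hψ ⊢
          refine ⟨fun v hv => ?_, fun u v huv => ?_⟩
          · by_cases hvx : v = x
            · subst hvx; simp
            · rw [Function.update_of_ne hvx]
              refine hψ.1 v ?_
              rw [hcov, Finset.mem_insert]; tauto
          · obtain ⟨h1, h2⟩ := hne u v huv
            rw [Function.update_of_ne h1, Function.update_of_ne h2]
            exact hψ.2 u v (Finset.mem_of_mem_erase huv)
      rw [hcov, Finset.card_insert_of_notMem hxS', pow_succ, pow_succ]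
      calc _ ≤ ((D * #(homSet par d S') : ℕ) : ℝ) * (B ^ #(coveredBy S') * B) := by
            refine mul_le_mul_of_nonneg_right (by exact_mod_cast hcard) (by positivity)
        _ = (#(homSet par d S') * B ^ #(coveredBy S')) * (D * B) := by push_cast; ring
        _ ≤ b ^ m * b := mul_le_mul hih hb1 (by positivity) (by positivity)
    · have hcov : coveredBy S = insert x (insert y (coveredBy S')) := by
        ext v; rw [hsub, Finset.mem_insert, Finset.mem_insert]; tauto
      have hcard : #(homSet par d S) ≤ n * D * #(homSet par d S') := by
        refine (Finset.card_le_mul_card_image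
          (f := fun ψ => Function.update (Function.update ψ x d) y d) _ (n * D) ?_).trans
          (Nat.mul_le_mul_left _ (Finset.card_le_card ?_))
        · intro ψ' _
          refine (Finset.card_le_card_of_injOn (fun ψ => (⟨ψ y, ψ x⟩ : (_ : Fin n) × Fin n))
            (t := Finset.univ.sigma fun i => {j | treeAdj par i j}) ?_ ?_).trans ?_
          · intro ψ hψ
            simp only [homSet, Finset.coe_filter, Finset.mem_filter, Finset.mem_univ, true_and,
              Set.mem_ofPred_eq, Finset.mem_coe, Finset.mem_sigma] at hψ ⊢
            exact hψ.1.2 y x (by rw [Sym2.eq_swap]; exact hkS)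
          · intro ψ hψ ψ₂ hψ₂ h
            simp only [Finset.coe_filter, Set.mem_ofPred_eq] at hψ hψ₂
            simp only [Sigma.mk.injEq, heq_eq_eq] at h
            funext v
            by_cases hv : v = x
            · subst hv; exact h.2
            · by_cases hvy : v = y
              · subst hvy; exact h.1
              · have := congrFun (hψ.2.trans hψ₂.2.symm) v
                rwa [Function.update_of_ne hvy, Function.update_of_ne hvy,
                  Function.update_of_ne hv, Function.update_of_ne hv] at this
          · rw [Finset.card_sigma]
            refine (Finset.sum_le_card_nsmul _ _ D fun i _ => hD i).trans ?_
            simp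
        · intro ψ' h
          obtain ⟨ψ, hψ, rfl⟩ := Finset.mem_image.1 h
          simp only [homSet, Finset.mem_filter, Finset.mem_univ, true_and] at hψ ⊢
          refine ⟨fun v hv => ?_, fun u v huv => ?_⟩
          · by_cases hvy : v = y
            · subst hvy; simp
            rw [Function.update_of_ne hvy]
            by_cases hvx : v = x
            · subst hvx; simp
            · rw [Function.update_of_ne hvx]
              refine hψ.1 v ?_
              rw [hcov, Finset.mem_insert, Finset.mem_insert]; tauto
          · obtain ⟨h1, h2⟩ := hne u v huv
            have h3 : u ≠ y := by
              rintro rfl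
              exact hyS (by simp only [coveredBy, Finset.mem_filter, Finset.mem_univ, true_and]
                            exact ⟨_, huv, Sym2.mem_mk_left _ _⟩)
            have h4 : v ≠ y := by
              rintro rfl
              exact hyS (by simp only [coveredBy, Finset.mem_filter, Finset.mem_univ, true_and]
                            exact ⟨_, huv, Sym2.mem_mk_right _ _⟩)
            rw [Function.update_of_ne h3, Function.update_of_ne h4, Function.update_of_ne h1,
              Function.update_of_ne h2]
            exact hψ.2 u v (Finset.mem_of_mem_erase huv)
      rw [hcov, Finset.card_insert_of_notMem (by simp [hxy, hxS']),
        Finset.card_insert_of_notMem hyS, pow_succ, pow_succ, pow_succ]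
      calc _ ≤ ((n * D * #(homSet par d S') : ℕ) : ℝ) * (B ^ #(coveredBy S') * B * B) := by
            refine mul_le_mul_of_nonneg_right (by exact_mod_cast hcard) (by positivity)
        _ = (#(homSet par d S') * B ^ #(coveredBy S')) * (n * D * B ^ 2) := by push_cast; ring
        _ ≤ b ^ m * b := mul_le_mul hih hb2 (by positivity) (by positivity)

/-- A vertex-spread random embedding of a bounded degree tree is edge-spread. -/
theorem pr_subset_treeEdges_le {par : Fin n → Fin n} (hpar : ∀ k : Fin n, k.val ≠ 0 → par k < k)
    (d : Fin n) {D : ℕ} (hD : ∀ i, #{j | treeAdj par i j} ≤ D) {w : (Fin n → V) → ℝ}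
    (hw : ∀ φ, 0 ≤ w φ) (hinj : ∀ φ, w φ ≠ 0 → Function.Injective φ) {A B b : ℝ}
    (hA : 0 ≤ A) (hB : 0 ≤ B) (hb1 : D * B ≤ b) (hb2 : n * D * B ^ 2 ≤ b)
    (hspread : ∀ (S : Finset (Fin n)) (y : Fin n → V),
      pr w (fun φ => ∀ i ∈ S, φ i = y i) ≤ A * B ^ #S) (S : Finset (Sym2 V)) :
    pr w (fun φ => S ⊆ treeEdges par φ) ≤ A * b ^ #S := by
  have hb : 0 ≤ b := le_trans (by positivity) hb1
  by_cases hne : ∃ φ, w φ ≠ 0 ∧ S ⊆ treeEdges par φ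
  swap
  · push Not at hne
    refine le_trans (le_of_eq ?_) (show 0 ≤ A * b ^ #S by positivity)
    refine Finset.sum_eq_zero fun φ _ => ?_
    by_cases h : w φ = 0
    · simp [h]
    · rw [ind_not (hne φ h), mul_zero]
  obtain ⟨φ₀, hφ₀, hS⟩ := hne
  have hcount := card_homSet_le hpar d hD (hinj φ₀ hφ₀) hB hb1 hb2 _ S hS rfl
  have h1 : pr w (fun φ => S ⊆ treeEdges par φ) ≤
      pr w (fun φ => ∃ ψ ∈ homSet par d S, (∀ v ∈ coveredBy S, φ (ψ v) = v)) := by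
    refine pr_mono hw fun φ hφ hSφ => ?_
    have hi := hinj φ hφ
    have hcov : ∀ v ∈ coveredBy S, ∃ i, φ i = v := by
      intro v hv
      simp only [coveredBy, Finset.mem_filter, Finset.mem_univ, true_and] at hv
      obtain ⟨e, he, hve⟩ := hv
      obtain ⟨k, -, rfl⟩ := Finset.mem_image.1 (hSφ he)
      rcases Sym2.mem_iff.1 hve with h | h
      exacts [⟨_, h.symm⟩, ⟨_, h.symm⟩]
    have : Nonempty (Fin n) := ⟨d⟩
    choose! g hg using hcov
    refine ⟨fun v => if v ∈ coveredBy S then g v else d, ?_, fun v hv => by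
      simp only [if_pos hv, hg v hv]⟩
    simp only [homSet, Finset.mem_filter, Finset.mem_univ, true_and]
    refine ⟨fun v hv => by simp [hv], fun u v huv => ?_⟩
    have hu : u ∈ coveredBy S := by
      simp only [coveredBy, Finset.mem_filter, Finset.mem_univ, true_and]
      exact ⟨_, huv, Sym2.mem_mk_left _ _⟩
    have hv : v ∈ coveredBy S := by
      simp only [coveredBy, Finset.mem_filter, Finset.mem_univ, true_and]
      exact ⟨_, huv, Sym2.mem_mk_right _ _⟩
    rw [if_pos hu, if_pos hv]
    obtain ⟨k, hk, hke⟩ := Finset.mem_image.1 (hSφ huv)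
    simp only [Finset.mem_filter, Finset.mem_univ, true_and] at hk
    rw [← hg u hu, ← hg v hv] at hke
    rcases Sym2.eq_iff.1 hke with ⟨h1, h2⟩ | ⟨h1, h2⟩
    · exact Or.inr ⟨by rw [← hi h1]; exact hk, by rw [← hi h1, ← hi h2]⟩
    · exact Or.inl ⟨by rw [← hi h1]; exact hk, by rw [← hi h1, ← hi h2]⟩
  refine h1.trans ((pr_union hw _ _).trans ?_)
  have h2 : ∀ ψ ∈ homSet par d S, pr w (fun φ => ∀ v ∈ coveredBy S, φ (ψ v) = v) ≤
      A * B ^ #(coveredBy S) := by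
    intro ψ _
    by_cases hψ : Set.InjOn ψ (coveredBy S)
    · rw [← Finset.card_image_of_injOn hψ]
      by_cases hV : Nonempty V
      · refine le_trans (pr_mono hw fun φ _ h => ?_) (hspread _ (Function.invFunOn ψ (coveredBy S)))
        intro i hi
        obtain ⟨v, hv, rfl⟩ := Finset.mem_image.1 hi
        rw [h v hv]
        exact (hψ.leftInvOn_invFunOn hv).symm
      · exact absurd ⟨φ₀ d⟩ hV
    · refine le_trans (le_of_eq ?_) (show 0 ≤ A * B ^ #(coveredBy S) by positivity)
      refine Finset.sum_eq_zero fun φ _ => ?_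
      rw [ind_not, mul_zero]
      intro h
      refine hψ fun u hu v hv huv => ?_
      rw [← h u hu, ← h v hv, huv]
  refine (Finset.sum_le_card_nsmul _ _ _ h2).trans ?_
  rw [nsmul_eq_mul]
  calc _ = A * (#(homSet par d S) * B ^ #(coveredBy S)) := by ring
    _ ≤ _ := mul_le_mul_of_nonneg_left hcount hA

end EdgeSpread

section Threshold
open scoped Classical

theorem sum_pow_threshold_le {κ L : ℝ} (hκ : 0 < κ) (hL : 1 ≤ L) (j k : ℕ) :
    ∑ i ∈ range k, (4 * κ / (if i < j then 8 * κ * L else 8 * κ)) ^ 2 ^ i ≤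
      j / (2 * L) + (1 / 2) ^ j := by
  have hterm : ∀ i, (4 * κ / (if i < j then 8 * κ * L else 8 * κ)) ^ 2 ^ i ≤
      (if i < j then 1 / (2 * L) else 0) + (if i < j then 0 else (1 / 2 : ℝ) ^ (i + 1)) := by
    intro i
    split_ifs with h
    · have h1 : 4 * κ / (8 * κ * L) = 1 / (2 * L) := by field_simp; norm_num
      rw [h1, add_zero]
      refine pow_le_of_le_one (by positivity) ?_ (by positivity)
      rw [div_le_one (by positivity)]; linarith
    · have h1 : 4 * κ / (8 * κ) = 1 / 2 := by field_simp; norm_num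
      rw [h1, zero_add]
      exact pow_le_pow_of_le_one (by norm_num) (by norm_num) Nat.lt_two_pow_self
  refine (Finset.sum_le_sum fun i _ => hterm i).trans ?_
  rw [Finset.sum_add_distrib]
  refine add_le_add ?_ ?_
  · rw [← Finset.sum_filter, Finset.sum_const, nsmul_eq_mul]
    have : #{i ∈ range k | i < j} ≤ j := by
      calc _ ≤ #(range j) := Finset.card_le_card fun i hi => by
            simp only [Finset.mem_filter, Finset.mem_range] at hi ⊢; exact hi.2
        _ = j := Finset.card_range j
    have h2 : (#{i ∈ range k | i < j} : ℝ) ≤ j := by exact_mod_cast this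
    calc _ ≤ (j : ℝ) * (1 / (2 * L)) := mul_le_mul_of_nonneg_right h2 (by positivity)
      _ = _ := by ring
  · have key : ∀ k, ∑ i ∈ range k, (if i < j then 0 else (1 / 2 : ℝ) ^ (i + 1)) ≤
        (1 / 2) ^ j - (1 / 2) ^ (max j k) := by
      intro k
      induction k with
      | zero => simp
      | succ k ih =>
        rw [Finset.sum_range_succ]
        by_cases h : k < j
        · rw [if_pos h, max_eq_left (by omega)]
          rw [max_eq_left (by omega)] at ih
          linarith
        · rw [if_neg h, max_eq_right (by omega)]
          rw [max_eq_right (by omega)] at ih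
          have : (1 / 2 : ℝ) ^ (k + 1) = (1 / 2) ^ k * (1 / 2) := pow_succ _ _
          linarith
    have := key k
    have h3 : (0 : ℝ) < (1 / 2) ^ (max j k) := by positivity
    linarith

theorem edgeProb_eq_EE {β : Type*} [DecidableEq β] (E : Finset β) (p : ℝ)
    (P : Finset β → Prop) : edgeProb E p P = EE E p fun F => ind (P F) := by
  unfold edgeProb EE
  refine Finset.sum_congr rfl fun F _ => ?_
  by_cases h : P F
  · simp [h, ind]
  · simp [h, ind]

/-- If for large `n` there is a vertex-spread random embedding of the tree in the graph, then
the logarithmic threshold follows. -/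
theorem exists_threshold_of_spread (D : ℕ) (hD : 1 ≤ D) (C : ℝ) (hC : 1 ≤ C) :
    ∃ C' : ℝ, 0 < C' ∧ ∀ γ : ℝ, 0 < γ → ∃ n₀ : ℕ, ∀ n : ℕ, n₀ ≤ n →
    ∀ (E : Finset (Sym2 (Fin n))) (par : Fin n → Fin n),
    (∀ k : Fin n, k.val ≠ 0 → par k < k) → (∀ i, #{j | treeAdj par i j} ≤ D) →
    ∀ w : (Fin n → Fin n) → ℝ, IsProb w →
    (∀ φ, w φ ≠ 0 → Function.Injective φ ∧ treeEdges par φ ⊆ E) →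
    (∀ (S : Finset (Fin n)) (y : Fin n → Fin n),
      pr w (fun φ => ∀ i ∈ S, φ i = y i) ≤ C * (C / n) ^ #S) →
    1 - γ ≤ EE E (C' * Real.log n / n) fun F => ind (∃ φ, w φ ≠ 0 ∧ treeEdges par φ ⊆ F) := by
  have hD' : (1 : ℝ) ≤ D := by exact_mod_cast hD
  set K : ℝ := D * C ^ 3 with hK
  have hK0 : 0 < K := by positivity
  refine ⟨64 * K, by positivity, fun γ hγ => ?_⟩
  obtain ⟨j, hj⟩ := exists_pow_lt_of_lt_one (half_pos hγ) (by norm_num : (1 / 2 : ℝ) < 1)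
  set L : ℝ := max 1 (j / γ) with hL
  have hL1 : 1 ≤ L := le_max_left _ _
  have hjL : (j : ℝ) / (2 * L) ≤ γ / 2 := by
    have : (j : ℝ) / γ ≤ L := le_max_right _ _
    rw [div_le_iff₀ hγ] at this
    rw [div_le_iff₀ (by positivity)]
    linarith
  have hlog : Filter.Tendsto (fun n : ℕ => Real.log n) Filter.atTop Filter.atTop :=
    Real.tendsto_log_atTop.comp tendsto_natCast_atTop_atTop
  have hlogn : Filter.Tendsto (fun n : ℕ => Real.log n / n) Filter.atTop (nhds 0) :=
    (Real.isLittleO_log_id_atTop.tendsto_div_nhds_zero).comp tendsto_natCast_atTop_atTop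
  have hev := ((hlog.eventually_ge_atTop (max 1 (L * j))).and
    (hlogn.eventually (gt_mem_nhds (show (0 : ℝ) < 1 / (64 * K) by positivity)))).and
    (Filter.eventually_ge_atTop 1)
  obtain ⟨n₀, hn₀⟩ := Filter.eventually_atTop.1 hev
  refine ⟨n₀, fun n hn E par hpar hdeg w hw hsupp hspread => ?_⟩
  obtain ⟨⟨hln, hp1⟩, hn1⟩ := hn₀ n hn
  have hn0 : (0 : ℝ) < n := by exact_mod_cast hn1
  have hln1 : 1 ≤ Real.log n := (le_max_left _ _).trans hln
  have hln2 : L * j ≤ Real.log n := (le_max_right _ _).trans hln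
  set p : ℝ := 64 * K * Real.log n / n with hp
  have hp1' : p ≤ 1 := by
    rw [lt_div_iff₀ (by positivity)] at hp1
    calc p = Real.log n / n * (64 * K) := by rw [hp]; ring
      _ ≤ 1 := hp1.le
  have hp0 : 0 ≤ p := by positivity
  set κ : ℝ := K / n with hκ
  have hκ0 : 0 < κ := by positivity
  set S : (Fin n → Fin n) → Finset (Sym2 (Fin n)) := fun φ =>
    if w φ ≠ 0 then treeEdges par φ else ∅ with hS
  set k := Nat.log 2 n + 1 with hk
  have hCn : (0 : ℝ) ≤ C / n := by positivity
  have hspr : ∀ R : Finset (Sym2 (Fin n)), ∑ φ, w φ * ind (R ⊆ S φ) ≤ κ ^ #R := by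
    intro R
    have h1 : ∑ φ, w φ * ind (R ⊆ S φ) = pr w (fun φ => R ⊆ treeEdges par φ) := by
      refine Finset.sum_congr rfl fun φ _ => ?_
      by_cases h : w φ = 0
      · simp [h]
      · simp [hS, h]
    rw [h1]
    by_cases hR : #R = 0
    · rw [hR, pow_zero]; exact pr_le_one hw _
    refine (pr_subset_treeEdges_le hpar ⟨0, hn1⟩ hdeg hw.nonneg (fun φ h => (hsupp φ h).1)
      (by linarith) hCn (b := D * C ^ 2 / n) ?_ ?_ hspread R).trans ?_
    · rw [mul_div_assoc]
      refine mul_le_mul_of_nonneg_left (div_le_div_of_nonneg_right ?_ hn0.le) (by positivity)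
      nlinarith
    · apply le_of_eq; field_simp
    · have h2 : C ≤ C ^ #R := le_self_pow₀ hC hR
      calc C * (D * C ^ 2 / n) ^ #R ≤ C ^ #R * (D * C ^ 2 / n) ^ #R :=
            mul_le_mul_of_nonneg_right h2 (by positivity)
        _ = κ ^ #R := by rw [← mul_pow]; congr 1; rw [hκ, hK]; ring
  have hfail := spread_fail (E := E) hκ0.le (fun i => if i < j then 8 * κ * L else 8 * κ)
    (fun i => by split_ifs <;> positivity)
    (fun i => by split_ifs <;> nlinarith) k w hw.nonneg S
    (fun φ => by
      simp only [hS]; split_ifs with h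
      · exact (hsupp φ h).2
      · simp) hspr
    (fun φ h => by
      simp only [hS, if_pos h]
      calc #(treeEdges par φ) ≤ #({k : Fin n | k.val ≠ 0} : Finset (Fin n)) := Finset.card_image_le
        _ ≤ n := by simpa using Finset.card_le_univ ({k : Fin n | k.val ≠ 0} : Finset (Fin n))
        _ < 2 ^ k := Nat.lt_pow_succ_log_self (by norm_num) n)
    (p := p) hp1' (by
      have hle : ∀ i ∈ range k, (if i < j then 8 * κ * L else 8 * κ) ≤
          8 * κ + (if i < j then 8 * κ * L else 0) := by
        intro i _
        split_ifs <;> nlinarith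
      refine (Finset.sum_le_sum hle).trans ?_
      rw [Finset.sum_add_distrib, Finset.sum_const, Finset.card_range, nsmul_eq_mul,
        ← Finset.sum_filter, Finset.sum_const, nsmul_eq_mul]
      have hjc : #{i ∈ range k | i < j} ≤ j := by
        calc _ ≤ #(range j) := Finset.card_le_card fun i hi => by
              simp only [Finset.mem_filter, Finset.mem_range] at hi ⊢; exact hi.2
          _ = j := Finset.card_range j
      have h2 : (#{i ∈ range k | i < j} : ℝ) ≤ j := by exact_mod_cast hjc
      have h3 : (k : ℝ) ≤ 3 * Real.log n := by
        have h4 : ((2 ^ Nat.log 2 n : ℕ) : ℝ) ≤ n := by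
          exact_mod_cast Nat.pow_log_le_self 2 (by omega)
        have h5 := Real.log_le_log (by positivity) h4
        rw [Nat.cast_pow, Real.log_pow] at h5
        have h6 := Real.log_two_gt_d9
        have h7 : (0 : ℝ) ≤ Nat.log 2 n := by positivity
        rw [hk]; push_cast at h5 ⊢
        nlinarith
      calc (k : ℝ) * (8 * κ) + #{i ∈ range k | i < j} * (8 * κ * L)
          ≤ 3 * Real.log n * (8 * κ) + j * (8 * κ * L) := by gcongr
        _ ≤ 3 * Real.log n * (8 * κ) + 8 * κ * Real.log n := by nlinarith
        _ ≤ 64 * κ * Real.log n := by nlinarith [mul_pos hκ0 (by linarith : 0 < Real.log n)]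
        _ = p := by rw [hp, hκ]; ring)
  rw [hw.sum_eq, mul_one] at hfail
  have hsum := sum_pow_threshold_le hκ0 hL1 j k
  have h1 : EE E p (fun F => ind (∃ φ, w φ ≠ 0 ∧ treeEdges par φ ⊆ F)) +
      EE E p (fun W => ind (∀ a, w a ≠ 0 → ¬ S a ⊆ W)) = 1 := by
    rw [← EE_add, ← EE_const E p 1]
    congr 1
    funext W
    by_cases h : ∃ φ, w φ ≠ 0 ∧ treeEdges par φ ⊆ W
    · rw [ind_of h, ind_not, add_zero]
      obtain ⟨φ, h1, h2⟩ := h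
      exact fun h3 => h3 φ h1 (by simpa [hS, h1] using h2)
    · rw [ind_not h, ind_of, zero_add]
      intro φ hφ hs
      exact h ⟨φ, hφ, by simpa [hS, hφ] using hs⟩
  linarith

end Threshold

section TreeEnumeration
open scoped Classical

variable {n : ℕ}

theorem exists_enum_of_connected {T : SimpleGraph (Fin n)} (hT : T.Connected) {A : Finset (Fin n)}
    (hA : A.Nonempty) (hconn : ∀ S ⊆ A, S.Nonempty → S ≠ A → ∃ s ∈ S, ∃ t ∈ A, t ∉ S ∧ T.Adj s t)
    (j : ℕ) (hj : j ≤ n) :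
    ∃ f : ℕ → Fin n, Set.InjOn f (Set.Iio j) ∧ (∀ k < j, k < #A → f k ∈ A) ∧
      (∀ k < j, #A ≤ k → f k ∉ A) ∧ ∀ k < j, 0 < k → ∃ i < k, T.Adj (f k) (f i) := by
  induction j with
  | zero => exact ⟨fun _ => hA.choose, by simp, by simp, by simp, by simp⟩
  | succ j ih =>
    obtain ⟨f, hinj, hin, hout, hadj⟩ := ih (by omega)
    set S := (range j).image f with hS
    have hScard : #S = j := by
      rw [hS, Finset.card_image_of_injOn (fun a ha b hb => hinj (by simpa using ha)
        (by simpa using hb)), Finset.card_range]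
    have key : ∃ t, t ∉ S ∧ (j < #A → t ∈ A) ∧ (#A ≤ j → t ∉ A) ∧
        (0 < j → ∃ i < j, T.Adj t (f i)) := by
      rcases Nat.eq_zero_or_pos j with h0 | h0
      · refine ⟨hA.choose, by simp [hS, h0], fun _ => hA.choose_spec, fun h => ?_, by omega⟩
        have := hA.card_pos; omega
      have hSne : S.Nonempty := Finset.card_pos.1 (by omega)
      rcases lt_or_ge j #A with h | h
      · have hSA : S ⊆ A := by
          intro x hx
          obtain ⟨k, hk, rfl⟩ := Finset.mem_image.1 hx
          rw [Finset.mem_range] at hk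
          exact hin k hk (by omega)
        obtain ⟨s, hs, t, ht, htS, hst⟩ := hconn S hSA hSne (by rintro h'; rw [h'] at hScard; omega)
        obtain ⟨i, hi, rfl⟩ := Finset.mem_image.1 hs
        exact ⟨t, htS, fun _ => ht, fun h' => by omega,
          fun _ => ⟨i, Finset.mem_range.1 hi, hst.symm⟩⟩
      · have hAS : A ⊆ S := by
          have h1 : (range #A).image f ⊆ A := by
            intro x hx
            obtain ⟨k, hk, rfl⟩ := Finset.mem_image.1 hx
            rw [Finset.mem_range] at hk
            exact hin k (by omega) hk
          have h2 : #((range #A).image f) = #A := by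
            rw [Finset.card_image_of_injOn (fun a ha b hb => hinj
              (by simp at ha ⊢; omega) (by simp at hb ⊢; omega)), Finset.card_range]
          rw [← Finset.eq_of_subset_of_card_le h1 h2.ge, hS]
          exact Finset.image_subset_image (Finset.range_mono h)
        obtain ⟨x, hx⟩ := hSne
        have : ∃ y, y ∉ S := by
          by_contra! h'
          have : S = Finset.univ := Finset.eq_univ_iff_forall.2 h'
          rw [this, Finset.card_univ, Fintype.card_fin] at hScard
          omega
        obtain ⟨y, hy⟩ := this
        obtain ⟨p⟩ := hT.preconnected x y
        obtain ⟨d, -, hd1, hd2⟩ := p.exists_boundary_dart (S : Set (Fin n)) hx hy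
        obtain ⟨i, hi, hi'⟩ := Finset.mem_image.1 (Finset.mem_coe.1 hd1)
        refine ⟨d.snd, hd2, fun h' => by omega, fun _ h' => hd2 (hAS h'),
          fun _ => ⟨i, Finset.mem_range.1 hi, ?_⟩⟩
        rw [hi']; exact d.adj.symm
    obtain ⟨t, htS, ht1, ht2, ht3⟩ := key
    have hft : ∀ k < j, f k ≠ t := fun k hk h =>
      htS (Finset.mem_image.2 ⟨k, Finset.mem_range.2 hk, h⟩)
    have hup : ∀ k < j, Function.update f j t k = f k := fun k hk =>
      Function.update_of_ne (by omega) _ _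
    refine ⟨Function.update f j t, ?_, ?_, ?_, ?_⟩
    · intro a ha b hb hab
      simp only [Set.mem_Iio] at ha hb
      rcases Nat.lt_succ_iff_lt_or_eq.1 ha with ha | rfl <;>
        rcases Nat.lt_succ_iff_lt_or_eq.1 hb with hb | rfl
      · rw [hup a ha, hup b hb] at hab; exact hinj ha hb hab
      · rw [hup a ha, Function.update_self] at hab; exact absurd hab (hft a ha)
      · rw [hup b hb, Function.update_self] at hab; exact absurd hab.symm (hft b hb)
      · rfl
    · intro k hk hkA
      rcases Nat.lt_succ_iff_lt_or_eq.1 hk with h | rfl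
      · rw [hup k h]; exact hin k h hkA
      · rw [Function.update_self]; exact ht1 hkA
    · intro k hk hkA
      rcases Nat.lt_succ_iff_lt_or_eq.1 hk with h | rfl
      · rw [hup k h]; exact hout k h hkA
      · rw [Function.update_self]; exact ht2 hkA
    · intro k hk hk0
      rcases Nat.lt_succ_iff_lt_or_eq.1 hk with h | rfl
      · obtain ⟨i, hi, hadj⟩ := hadj k h hk0
        exact ⟨i, hi, by rwa [hup k h, hup i (by omega)]⟩
      · obtain ⟨i, hi, hadj⟩ := ht3 hk0
        exact ⟨i, hi, by rwa [Function.update_self, hup i hi]⟩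

theorem exists_enum {T : SimpleGraph (Fin n)} (hT : T.IsTree) {A : Finset (Fin n)}
    (hA : A.Nonempty)
    (hconn : ∀ S ⊆ A, S.Nonempty → S ≠ A → ∃ s ∈ S, ∃ t ∈ A, t ∉ S ∧ T.Adj s t) :
    ∃ (f : Fin n ≃ Fin n) (par : Fin n → Fin n), (∀ k, k.val = 0 → par k = k) ∧
      (∀ k : Fin n, k.val ≠ 0 → par k < k) ∧ (∀ i j, T.Adj (f i) (f j) ↔ treeAdj par i j) ∧
      ∀ k, f k ∈ A ↔ k.val < #A := by
  obtain ⟨f, hinj, hin, hout, hadj⟩ := exists_enum_of_connected hT.connected hA hconn n le_rfl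
  have hbij : Function.Bijective (fun k : Fin n => f k.val) :=
    Finite.injective_iff_bijective.1 fun a b h => Fin.ext (hinj a.2 b.2 h)
  have hpar : ∀ k : Fin n, ∃ i : Fin n, (k.val = 0 → i = k) ∧
      (k.val ≠ 0 → i < k ∧ T.Adj (f k.val) (f i.val)) := by
    intro k
    by_cases hk : k.val = 0
    · exact ⟨k, fun _ => rfl, fun h => absurd hk h⟩
    · obtain ⟨i, hi, h⟩ := hadj k.val k.2 (by omega)
      exact ⟨⟨i, hi.trans k.2⟩, fun h => absurd h hk, fun _ => ⟨hi, h⟩⟩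
  choose par hpar0 hpar1 using hpar
  have hle : ∀ i : Fin n, i.val ≠ 0 → par i < i := fun i hi => (hpar1 i hi).1
  refine ⟨Equiv.ofBijective _ hbij, par, hpar0, hle, ?_, ?_⟩
  · set E := ({k : Fin n | k.val ≠ 0} : Finset (Fin n)).image
      fun k => s(f k.val, f (par k).val) with hE
    have hEsub : E ⊆ T.edgeFinset := by
      intro e he
      obtain ⟨k, hk, rfl⟩ := Finset.mem_image.1 he
      rw [SimpleGraph.mem_edgeFinset, SimpleGraph.mem_edgeSet]
      exact (hpar1 k (by simpa using hk)).2
    have hEcard : #E = #({k : Fin n | k.val ≠ 0} : Finset (Fin n)) := by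
      rw [hE, Finset.card_image_of_injOn]
      intro a ha b hb hab
      simp only [Finset.coe_filter, Finset.mem_univ, true_and, Set.mem_ofPred_eq] at ha hb
      have h1 := hle a ha
      have h2 := hle b hb
      rcases Sym2.eq_iff.1 hab with ⟨h, -⟩ | ⟨h, h'⟩
      · exact hbij.1 h
      · have e1 := hbij.1 h
        have e2 := hbij.1 h'
        rw [e2] at h1
        rw [← e1] at h2
        exact absurd h1 (lt_asymm h2)
    have hcard0 : #({k : Fin n | k.val ≠ 0} : Finset (Fin n)) + 1 = n := by
      have hpos : 0 < n := (hA.choose).pos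
      have : ({k : Fin n | k.val ≠ 0} : Finset (Fin n)) = Finset.univ.erase ⟨0, hpos⟩ := by
        ext k; simp [Fin.ext_iff]
      rw [this, Finset.card_erase_of_mem (Finset.mem_univ _), Finset.card_univ, Fintype.card_fin]
      omega
    have hTc := hT.card_edgeFinset
    rw [Fintype.card_fin] at hTc
    have hEeq : E = T.edgeFinset := Finset.eq_of_subset_of_card_le hEsub (by omega)
    intro i j
    simp only [Equiv.ofBijective_apply]
    rw [← SimpleGraph.mem_edgeSet, ← SimpleGraph.mem_edgeFinset, ← hEeq, hE, Finset.mem_image]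
    constructor
    · rintro ⟨k, hk, hke⟩
      simp only [Finset.mem_filter, Finset.mem_univ, true_and] at hk
      rcases Sym2.eq_iff.1 hke with ⟨h, h'⟩ | ⟨h, h'⟩
      · have e1 := hbij.1 h
        have e2 := hbij.1 h'
        subst e1
        exact Or.inr ⟨hk, e2.symm⟩
      · have e1 := hbij.1 h
        have e2 := hbij.1 h'
        subst e1
        exact Or.inl ⟨hk, e2.symm⟩
    · rintro (⟨h, rfl⟩ | ⟨h, rfl⟩)
      · exact ⟨j, by simpa using h, Sym2.eq_swap⟩
      · exact ⟨i, by simpa using h, rfl⟩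
  · intro k
    simp only [Equiv.ofBijective_apply]
    constructor
    · intro h
      by_contra h'
      exact hout k.val k.2 (by omega) h
    · exact hin k.val k.2

/-- The descendants of `v`. -/
noncomputable def desc (par : Fin n → Fin n) (v : Fin n) : Finset (Fin n) :=
  {k | ∃ i : ℕ, par^[i] k = v}

theorem mem_desc {par : Fin n → Fin n} {v k : Fin n} : k ∈ desc par v ↔ ∃ i : ℕ, par^[i] k = v := by
  simp [desc]

theorem par_mem_desc {par : Fin n → Fin n} {v k : Fin n} (hk : k ∈ desc par v) (hkv : k ≠ v) :
    par k ∈ desc par v := by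
  obtain ⟨i, hi⟩ := mem_desc.1 hk
  rcases i with _ | i
  · exact absurd hi hkv
  · exact mem_desc.2 ⟨i, hi⟩

theorem mem_desc_of_par {par : Fin n → Fin n} {v k : Fin n} (hk : par k ∈ desc par v) :
    k ∈ desc par v := by
  obtain ⟨i, hi⟩ := mem_desc.1 hk
  exact mem_desc.2 ⟨i + 1, hi⟩

/-- A tree of bounded degree has an enumeration by a parent function in which an initial segment
of prescribed approximate size is joined to the remaining vertices by a single edge. -/
theorem exists_split_enum {T : SimpleGraph (Fin n)} (hT : T.IsTree) {D a : ℕ} (hD : 1 ≤ D)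
    (hdeg : ∀ v, #{u | T.Adj v u} ≤ D) (ha : 1 ≤ a) (han : D * a < n) :
    ∃ (f : Fin n ≃ Fin n) (par : Fin n → Fin n) (m : Fin n),
      (∀ k, k.val = 0 → par k = k) ∧ (∀ k : Fin n, k.val ≠ 0 → par k < k) ∧
      (∀ i j, T.Adj (f i) (f j) ↔ treeAdj par i j) ∧
      a ≤ m.val ∧ m.val ≤ D * a ∧ ∀ k, m < k → m ≤ par k := by
  have hn : 0 < n := by omega
  obtain ⟨f, par, hpar0, hpar, hadj, -⟩ := exists_enum hT (A := Finset.univ)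
    ⟨⟨0, hn⟩, Finset.mem_univ _⟩ (by
      intro S _ hS hSne
      obtain ⟨x, hx⟩ := hS
      obtain ⟨y, hy⟩ : ∃ y, y ∉ S := by
        by_contra! h; exact hSne (Finset.eq_univ_iff_forall.2 h)
      obtain ⟨p⟩ := hT.connected.preconnected x y
      obtain ⟨d, -, hd1, hd2⟩ := p.exists_boundary_dart (S : Set (Fin n)) hx hy
      exact ⟨d.fst, hd1, d.snd, Finset.mem_univ _, hd2, d.adj⟩)
  have hroot : ∀ k : Fin n, k ∈ desc par ⟨0, hn⟩ := by
    intro k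
    induction k using WellFoundedLT.induction with
    | _ k ih =>
      by_cases hk : k.val = 0
      · exact mem_desc.2 ⟨0, Fin.ext hk⟩
      · exact mem_desc_of_par (ih _ (hpar k hk))
  have hfirst : #(desc par ⟨0, hn⟩) = n := by
    rw [Finset.eq_univ_iff_forall.2 hroot, Finset.card_univ, Fintype.card_fin]
  obtain ⟨v, hv, hvmax⟩ := Finset.exists_max_image ({v | a ≤ #(desc par v)} : Finset (Fin n)) id
    ⟨⟨0, hn⟩, by simp only [Finset.mem_filter, Finset.mem_univ, true_and, hfirst]; nlinarith⟩
  simp only [Finset.mem_filter, Finset.mem_univ, true_and, id] at hv hvmax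
  set A := desc par v with hA
  have hself : v ∈ A := mem_desc.2 ⟨0, rfl⟩
  have hle : ∀ k ∈ A, v ≤ k := by
    intro k
    induction k using WellFoundedLT.induction with
    | _ k ih =>
      intro hk
      by_cases hkv : k = v
      · exact hkv.ge
      · by_cases hk0 : k.val = 0
        · exfalso
          have := par_mem_desc hk hkv
          obtain ⟨i, hi⟩ := mem_desc.1 hk
          rw [Function.iterate_fixed (hpar0 k hk0)] at hi
          exact hkv hi
        · exact (ih _ (hpar k hk0) (par_mem_desc hk hkv)).trans (hpar k hk0).le
  have hAcard : #A ≤ D * a := by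
    have hsub : A ⊆ {v} ∪ ({c | par c = v ∧ c ≠ v} : Finset (Fin n)).biUnion (desc par) := by
      intro k
      induction k using WellFoundedLT.induction with
      | _ k ih =>
        intro hk
        by_cases hkv : k = v
        · simp [hkv]
        · have hk0 : k.val ≠ 0 := fun h0 => by
            have := hle k hk
            exact hkv (Fin.ext (by have := Fin.le_def.1 this; omega))
          have hpk := par_mem_desc hk hkv
          by_cases hpv : par k = v
          · refine Finset.mem_union_right _ (Finset.mem_biUnion.2 ⟨k, ?_, mem_desc.2 ⟨0, rfl⟩⟩)
            simpa using ⟨hpv, hkv⟩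
          · have := ih _ (hpar k hk0) hpk
            rcases Finset.mem_union.1 this with h | h
            · exact absurd (Finset.mem_singleton.1 h) hpv
            · obtain ⟨c, hc, h⟩ := Finset.mem_biUnion.1 h
              exact Finset.mem_union_right _ (Finset.mem_biUnion.2 ⟨c, hc, mem_desc_of_par h⟩)
    have hch : #({c | par c = v ∧ c ≠ v} : Finset (Fin n)) ≤ D := by
      refine le_trans ?_ (hdeg (f v))
      rw [← Finset.card_map f.toEmbedding]
      refine Finset.card_le_card fun x hx => ?_
      obtain ⟨c, hc, rfl⟩ := Finset.mem_map.1 hx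
      simp only [Finset.mem_filter, Finset.mem_univ, true_and, Equiv.toEmbedding_apply] at hc ⊢
      rw [hadj]
      refine Or.inl ⟨fun h0 => ?_, hc.1.symm⟩
      exact hc.2 ((hpar0 c h0).symm.trans hc.1)
    have hsmall : ∀ c ∈ ({c | par c = v ∧ c ≠ v} : Finset (Fin n)), #(desc par c) ≤ a - 1 := by
      intro c hc
      simp only [Finset.mem_filter, Finset.mem_univ, true_and] at hc
      by_contra h
      have h1 := hvmax c (by omega)
      have h2 : par c < c := hpar c fun h0 => hc.2 ((hpar0 c h0).symm.trans hc.1)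
      rw [hc.1] at h2
      exact absurd h2 (not_lt.2 h1)
    calc #A ≤ 1 + #({c | par c = v ∧ c ≠ v} : Finset (Fin n)) * (a - 1) := by
          refine (Finset.card_le_card hsub).trans ((Finset.card_union_le _ _).trans ?_)
          rw [Finset.card_singleton]
          exact Nat.add_le_add_left (Finset.card_biUnion_le_card_mul _ _ _ hsmall) _
      _ ≤ 1 + D * (a - 1) := by gcongr
      _ ≤ D * a := by
          obtain ⟨b, rfl⟩ := Nat.exists_eq_add_of_le ha
          simp only [Nat.add_sub_cancel_left]
          nlinarith
  have hv0 : v.val ≠ 0 := by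
    intro h0
    have : v = ⟨0, hn⟩ := Fin.ext h0
    rw [hA, this, hfirst] at hAcard
    omega
  have hcross : ∀ x ∈ A, ∀ y ∉ A, T.Adj (f x) (f y) → x = v := by
    intro x hx y hy hxy
    by_contra hxv
    rcases (hadj x y).1 hxy with ⟨h, rfl⟩ | ⟨h, rfl⟩
    · exact hy (mem_desc_of_par hx)
    · exact hy (par_mem_desc hx hxv)
  have hcross' : ∀ x ∈ A, ∀ y ∉ A, T.Adj (f x) (f y) → y = par v := by
    intro x hx y hy hxy
    have hxv := hcross x hx y hy hxy
    rcases (hadj x y).1 hxy with ⟨h, rfl⟩ | ⟨h, rfl⟩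
    · exact absurd (mem_desc_of_par hx) hy
    · rw [hxv]
  obtain ⟨g, par', hpar0', hpar', hadj', hmem⟩ := exists_enum hT (A := A.map f.toEmbedding)
    ⟨f v, Finset.mem_map_of_mem _ hself⟩ (by
      intro S hS hSne hSA
      have hpull : ∀ s ∈ S, ∃ k ∈ A, f k = s := fun s hs => by
        obtain ⟨k, hk, rfl⟩ := Finset.mem_map.1 (hS hs); exact ⟨k, hk, rfl⟩
      by_cases hvS : f v ∈ S
      · obtain ⟨t, ht, htm⟩ := Finset.exists_min_image (A.filter fun k => f k ∉ S) id (by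
          by_contra hne
          rw [Finset.not_nonempty_iff_eq_empty, Finset.filter_eq_empty_iff] at hne
          refine hSA (subset_antisymm hS fun x hx => ?_)
          obtain ⟨k, hk, rfl⟩ := Finset.mem_map.1 hx
          exact not_not.1 (hne hk))
        simp only [Finset.mem_filter, id, and_imp] at ht htm
        have htv : t ≠ v := by rintro rfl; exact ht.2 hvS
        have ht0 : t.val ≠ 0 := fun h0 => by
          have := Fin.le_def.1 (hle t ht.1); omega
        have hp := par_mem_desc ht.1 htv
        refine ⟨f (par t), ?_, f t, Finset.mem_map_of_mem _ ht.1, ht.2,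
          (hadj _ _).2 (Or.inl ⟨ht0, rfl⟩)⟩
        by_contra hns
        exact absurd (htm _ hp hns) (not_le.2 (hpar t ht0))
      · obtain ⟨s, hs, hsm⟩ := Finset.exists_min_image (A.filter fun k => f k ∈ S) id (by
          obtain ⟨x, hx⟩ := hSne
          obtain ⟨k, hk, rfl⟩ := hpull x hx
          exact ⟨k, Finset.mem_filter.2 ⟨hk, hx⟩⟩)
        simp only [Finset.mem_filter, id, and_imp] at hs hsm
        have hsv : s ≠ v := by rintro rfl; exact hvS hs.2
        have hs0 : s.val ≠ 0 := fun h0 => by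
          have := Fin.le_def.1 (hle s hs.1); omega
        have hp := par_mem_desc hs.1 hsv
        refine ⟨f s, hs.2, f (par s), Finset.mem_map_of_mem _ hp, ?_,
          (hadj _ _).2 (Or.inr ⟨hs0, rfl⟩)⟩
        intro hns
        exact absurd (hsm _ hp hns) (not_le.2 (hpar s hs0)))
  rw [Finset.card_map] at hmem
  have hAn : #A < n := by omega
  have hmem' : ∀ k : Fin n, f.symm (g k) ∈ A ↔ k.val < #A := by
    intro k
    rw [← hmem, Finset.mem_map_equiv]
  refine ⟨g, par', ⟨#A, hAn⟩, hpar0', hpar', hadj', hv, hAcard, fun k hk => ?_⟩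
  by_contra hlt
  rw [not_le] at hlt
  have hm0 : (⟨#A, hAn⟩ : Fin n).val ≠ 0 := by
    have := Finset.card_pos.2 ⟨v, hself⟩
    simp only; omega
  have hk0 : k.val ≠ 0 := by have := Fin.lt_def.1 hk; omega
  have key : ∀ l : Fin n, #A ≤ l.val → (par' l).val < #A → l.val ≠ 0 → f.symm (g l) = par v := by
    intro l hl hpl hl0
    refine hcross' (f.symm (g (par' l))) ((hmem' _).2 hpl) _ (fun h => ?_) ?_
    · have := (hmem' _).1 h; omega
    · rw [Equiv.apply_symm_apply, Equiv.apply_symm_apply, hadj']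
      exact Or.inl ⟨hl0, rfl⟩
  have h1 := key k hk.le hlt hk0
  have h2 := key ⟨#A, hAn⟩ le_rfl (hpar' _ hm0) hm0
  have := g.injective (f.symm.injective (h1.trans h2.symm))
  exact hk.ne' this

end TreeEnumeration

section TreeBlocks
open scoped Classical

variable {n : ℕ}

/-- A vertex of a rooted tree together with its children and its two nearest ancestors. -/
noncomputable def block (par : Fin n → Fin n) (x : Fin n) : Finset (Fin n) :=
  {par (par x), par x, x} ∪ ({c | par c = x} : Finset (Fin n))

theorem exists_maximal_disjoint {α β : Type*} [Fintype α] (A : Finset α)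
    (B : α → Finset β) (hB : ∀ x ∈ A, (B x).Nonempty) {b M : ℕ} (hb : ∀ x ∈ A, #(B x) ≤ b)
    (hM : ∀ v, #{x ∈ A | v ∈ B x} ≤ M) :
    ∃ I ⊆ A, (I : Set α).PairwiseDisjoint B ∧ #A ≤ #I * b * M := by
  obtain ⟨I, hI, hmax⟩ := Finset.exists_max_image
    (A.powerset.filter fun I : Finset α => (I : Set α).PairwiseDisjoint B) (fun I => #I)
    ⟨∅, by simp⟩
  simp only [Finset.mem_filter, Finset.mem_powerset, and_imp] at hI hmax
  refine ⟨I, hI.1, hI.2, ?_⟩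
  have hcov : A ⊆ (I.biUnion B).biUnion fun v => {x ∈ A | v ∈ B x} := by
    intro x hx
    by_contra hns
    have hdis : ∀ y ∈ I, Disjoint (B x) (B y) := fun y hy => by
      rw [Finset.disjoint_left]
      intro v hvx hvy
      exact hns (Finset.mem_biUnion.2 ⟨v, Finset.mem_biUnion.2 ⟨y, hy, hvy⟩,
        Finset.mem_filter.2 ⟨hx, hvx⟩⟩)
    have hxI : x ∉ I := fun h => by
      have := hdis x h
      rw [disjoint_self] at this
      exact (hB x hx).ne_empty this
    have h1 := hmax (insert x I) (Finset.insert_subset hx hI.1) (by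
      rw [Finset.coe_insert]
      exact hI.2.insert fun y hy _ => hdis y hy)
    rw [Finset.card_insert_of_notMem hxI] at h1
    omega
  calc #A ≤ _ := Finset.card_le_card hcov
    _ ≤ #(I.biUnion B) * M := Finset.card_biUnion_le_card_mul _ _ _ fun v _ => hM v
    _ ≤ #I * b * M := by
        gcongr
        exact Finset.card_biUnion_le_card_mul _ _ _ fun x hx => hb x (hI.1 hx)

theorem card_iterate_fiber_le {par : Fin n → Fin n} {D : ℕ}
    (hch : ∀ v, #({c | par c = v} : Finset (Fin n)) ≤ D) (i : ℕ) (v : Fin n) :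
    #({c | par^[i] c = v} : Finset (Fin n)) ≤ D ^ i := by
  induction i with
  | zero =>
    simp only [Function.iterate_zero, id, pow_zero]
    refine Finset.card_le_one.2 fun a ha b hb => ?_
    exact (Finset.mem_filter.1 ha).2.trans (Finset.mem_filter.1 hb).2.symm
  | succ i ih =>
    have : ({c | par^[i + 1] c = v} : Finset (Fin n)) ⊆
        ({c | par^[i] c = v} : Finset (Fin n)).biUnion fun u => {c | par c = u} := by
      intro c hc
      exact Finset.mem_biUnion.2 ⟨par c, Finset.mem_filter.2 ⟨Finset.mem_univ _,
        (Finset.mem_filter.1 hc).2⟩, Finset.mem_filter.2 ⟨Finset.mem_univ _, rfl⟩⟩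
    calc _ ≤ _ := Finset.card_le_card this
      _ ≤ #({c | par^[i] c = v} : Finset (Fin n)) * D :=
        Finset.card_biUnion_le_card_mul _ _ _ fun u _ => hch u
      _ ≤ D ^ (i + 1) := by rw [pow_succ]; gcongr

/-- An initial segment of a bounded degree tree contains many vertices with at most one child
whose blocks are pairwise disjoint. -/
theorem exists_blocks {par : Fin n → Fin n} {m : Fin n} (hcross : ∀ k, m < k → m ≤ par k)
    {D : ℕ} (hch : ∀ v, #({c | par c = v} : Finset (Fin n)) ≤ D) :
    ∃ I : Finset (Fin n), (I : Set (Fin n)).PairwiseDisjoint (block par) ∧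
      (∀ x ∈ I, x < m ∧ (par x).val ≠ 0 ∧ x ≠ par m ∧ #({c | par c = x} : Finset (Fin n)) ≤ 1) ∧
      m.val ≤ 8 * (2 + D + D ^ 2) * #I + 2 * (2 + D) := by
  set A : Finset (Fin n) :=
    {x | x < m ∧ (par x).val ≠ 0 ∧ x ≠ par m ∧ #({c | par c = x} : Finset (Fin n)) ≤ 1} with hA
  have hAcard : m.val ≤ 2 * #A + 2 * (2 + D) := by
    rcases Nat.eq_zero_or_pos m.val with h0 | h0
    · omega
    set P : Finset (Fin n) := {x | x < m ∧ 2 ≤ #({c | par c = x} : Finset (Fin n))} with hP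
    have hPcard : #P * 2 ≤ m.val + 1 := by
      calc #P * 2 ≤ ∑ x ∈ P, #({c | par c = x} : Finset (Fin n)) :=
            Finset.card_nsmul_le_sum P (fun x => #({c | par c = x} : Finset (Fin n))) 2
              fun x hx => (Finset.mem_filter.1 hx).2.2
        _ = #(P.biUnion fun x => ({c | par c = x} : Finset (Fin n))) := by
            rw [Finset.card_biUnion]
            intro x _ y _ hxy
            refine Finset.disjoint_left.2 fun c hc hc' => ?_
            simp only [Finset.mem_filter, Finset.mem_univ, true_and] at hc hc'
            exact hxy (hc.symm.trans hc')
        _ ≤ #(Finset.Iic m) := Finset.card_le_card fun c hc => by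
            simp only [hP, Finset.mem_biUnion, Finset.mem_filter, Finset.mem_univ, true_and] at hc
            obtain ⟨x, hx, rfl⟩ := hc
            rw [Finset.mem_Iic]
            by_contra h
            exact absurd (hcross c (not_le.1 h)) (not_le.2 hx.1)
        _ = m.val + 1 := Fin.card_Iic m
    have hroot : (0 : ℕ) < n := m.pos
    have hcov : Finset.Iio m ⊆
        A ∪ (P ∪ ({par m} ∪ ({c | par c = ⟨0, hroot⟩} : Finset (Fin n)))) := by
      intro x hx
      rw [Finset.mem_Iio] at hx
      by_contra hns
      simp only [hA, hP, Finset.mem_union, Finset.mem_filter, Finset.mem_univ, true_and,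
        Finset.mem_singleton, not_or, not_and, not_le] at hns
      obtain ⟨h1, h2, h3, h4⟩ := hns
      have h5 : (par x).val ≠ 0 := fun h => h4 (Fin.ext h)
      have h6 := h1 hx h5 h3
      have h7 := h2 hx
      omega
    have h1 := Finset.card_le_card hcov
    rw [Fin.card_Iio] at h1
    have h2 := Finset.card_union_le A (P ∪ ({par m} ∪ ({c | par c = ⟨0, hroot⟩} : Finset (Fin n))))
    have h3 := Finset.card_union_le P ({par m} ∪ ({c | par c = ⟨0, hroot⟩} : Finset (Fin n)))
    have h4 := Finset.card_union_le {par m} ({c | par c = ⟨0, hroot⟩} : Finset (Fin n))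
    have h5 := hch ⟨0, hroot⟩
    rw [Finset.card_singleton] at h4
    omega
  obtain ⟨I, hIA, hIdis, hIcard⟩ := exists_maximal_disjoint A (block par) (b := 4)
    (M := 2 + D + D ^ 2) (fun x _ => ⟨x, by simp [block]⟩) (fun x hx => by
      have hx' : #({c | par c = x} : Finset (Fin n)) ≤ 1 := by
        simp only [hA, Finset.mem_filter] at hx; exact hx.2.2.2.2
      have h1 := Finset.card_union_le {par (par x), par x, x} ({c | par c = x} : Finset (Fin n))
      have h2 : #({par (par x), par x, x} : Finset (Fin n)) ≤ 3 := Finset.card_le_three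
      rw [block]; omega) (fun v => by
      have hsub : {x ∈ A | v ∈ block par x} ⊆ {v} ∪ ({par v} ∪
          (({c | par^[1] c = v} : Finset (Fin n)) ∪ ({c | par^[2] c = v} : Finset (Fin n)))) := by
        intro x hx
        simp only [block, Finset.mem_filter, Finset.mem_union, Finset.mem_insert,
          Finset.mem_singleton, Finset.mem_univ, true_and] at hx ⊢
        rcases hx.2 with (h | h | h) | h
        · exact Or.inr (Or.inr (Or.inr h.symm))
        · exact Or.inr (Or.inr (Or.inl h.symm))
        · exact Or.inl h.symm
        · exact Or.inr (Or.inl h.symm)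
      have h0 := Finset.card_le_card hsub
      have h1 := Finset.card_union_le {v} ({par v} ∪
          (({c | par^[1] c = v} : Finset (Fin n)) ∪ ({c | par^[2] c = v} : Finset (Fin n))))
      have h2 := Finset.card_union_le {par v}
          (({c | par^[1] c = v} : Finset (Fin n)) ∪ ({c | par^[2] c = v} : Finset (Fin n)))
      have h3 := Finset.card_union_le
          ({c | par^[1] c = v} : Finset (Fin n)) ({c | par^[2] c = v} : Finset (Fin n))
      have h4 := card_iterate_fiber_le hch 1 v
      have h5 := card_iterate_fiber_le hch 2 v
      rw [pow_one] at h4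
      rw [Finset.card_singleton] at h1 h2
      have h6 : #({x ∈ A | v ∈ block par x}) ≤ 2 + D + D ^ 2 := by omega
      convert h6)
  refine ⟨I, hIdis, fun x hx => ?_, ?_⟩
  · have := hIA hx
    simpa [hA] using this
  · have : 2 * #A ≤ 8 * (2 + D + D ^ 2) * #I := by
      calc 2 * #A ≤ 2 * (#I * 4 * (2 + D + D ^ 2)) := by omega
        _ = _ := by ring
    omega

end TreeBlocks

section TreeBodies
open scoped Classical

theorem exists_equal_classes {α : Type*} (q : ℕ) (hq : 1 ≤ q) (A : Finset α) :
    ∃ A' ⊆ A, ∃ g : α → ℕ, (∀ b ∈ A', #{b' ∈ A' | g b' = g b} = q) ∧ #(A \ A') ≤ q := by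
  induction hk : #A using Nat.strong_induction_on generalizing A with
  | _ k ih =>
    rcases lt_or_ge (#A) q with h | h
    · exact ⟨∅, by simp, fun _ => 0, by simp, by simpa using h.le⟩
    obtain ⟨C, hCA, hC⟩ := Finset.exists_subset_card_eq h
    have hAC : #(A \ C) < k := by rw [Finset.card_sdiff_of_subset hCA]; omega
    obtain ⟨A', hA', g, hg, hl⟩ := ih _ hAC (A \ C) rfl
    have hdisj : ∀ a ∈ A', a ∉ C := fun a ha => (Finset.mem_sdiff.1 (hA' ha)).2
    have hfresh : ∀ a ∈ A', g a ≠ A'.sup g + 1 := fun a ha => by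
      have := Finset.le_sup (f := g) ha; omega
    refine ⟨A' ∪ C, Finset.union_subset (hA'.trans Finset.sdiff_subset) hCA,
      fun a => if a ∈ C then A'.sup g + 1 else g a, ?_, ?_⟩
    · intro b hb
      by_cases hbC : b ∈ C
      · simp only [hbC, if_true]
        rw [← hC]
        congr 1
        ext a
        simp only [Finset.mem_filter, Finset.mem_union]
        constructor
        · rintro ⟨ha | ha, h'⟩
          · rw [if_neg (hdisj a ha)] at h'; exact absurd h' (hfresh a ha)
          · exact ha
        · intro ha
          exact ⟨Or.inr ha, by rw [if_pos ha]⟩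
      · have hbA : b ∈ A' := (Finset.mem_union.1 hb).resolve_right hbC
        simp only [hbC, if_false]
        rw [← hg b hbA]
        congr 1
        ext a
        simp only [Finset.mem_filter, Finset.mem_union]
        constructor
        · rintro ⟨ha, h'⟩
          by_cases haC : a ∈ C
          · rw [if_pos haC] at h'; exact absurd h'.symm (hfresh b hbA)
          · rw [if_neg haC] at h'; exact ⟨ha.resolve_right haC, h'⟩
        · rintro ⟨ha, h'⟩
          exact ⟨Or.inl ha, by rwa [if_neg (hdisj a ha)]⟩
    · refine le_trans (Finset.card_le_card ?_) hl
      intro a ha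
      simp only [Finset.mem_sdiff, Finset.mem_union, not_or] at ha ⊢
      exact ⟨⟨ha.1, ha.2.2⟩, ha.2.1⟩

theorem exists_equal_typed_classes {α τ : Type*} (q : ℕ) (hq : 1 ≤ q) (A : Finset α)
    (t : α → τ) (S : Finset τ) (ht : ∀ a ∈ A, t a ∈ S) :
    ∃ A' ⊆ A, ∃ g : α → ℕ, (∀ b ∈ A', #{b' ∈ A' | t b' = t b ∧ g b' = g b} = q) ∧
      #(A \ A') ≤ #S * q := by
  choose B hB g hg hl using fun s => exists_equal_classes q hq (A.filter fun a => t a = s)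
  have hBt : ∀ s, ∀ a ∈ B s, a ∈ A ∧ t a = s := fun s a ha => Finset.mem_filter.1 (hB s ha)
  refine ⟨A.filter fun a => a ∈ B (t a), Finset.filter_subset _ _, fun a => g (t a) a, ?_, ?_⟩
  · intro b hb
    rw [Finset.mem_filter] at hb
    rw [← hg (t b) b hb.2]
    congr 1
    ext a
    simp only [Finset.mem_filter]
    constructor
    · rintro ⟨⟨-, ha⟩, hab, h⟩
      rw [hab] at ha h
      exact ⟨ha, h⟩
    · rintro ⟨ha, h⟩
      have := hBt _ a ha
      refine ⟨⟨this.1, ?_⟩, this.2, ?_⟩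
      · rwa [this.2]
      · rw [this.2]; exact h
  · refine le_trans (Finset.card_le_card (t := S.biUnion fun s =>
      (A.filter fun a => t a = s) \ B s) ?_) (Finset.card_biUnion_le_card_mul _ _ _ fun s _ => hl s)
    intro a ha
    simp only [Finset.mem_sdiff, Finset.mem_filter, not_and] at ha
    simp only [Finset.mem_biUnion, Finset.mem_sdiff, Finset.mem_filter]
    exact ⟨t a, ht a ha.1, ⟨ha.1, rfl⟩, ha.2 ha.1⟩

variable {n : ℕ}

theorem exists_par_rec {par : Fin n → Fin n} (hpar : ∀ k : Fin n, k.val ≠ 0 → par k < k)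
    (m : Fin n) {α : Type*} (base : α) (F : Fin n → α → α) :
    ∃ g : Fin n → α, g m = base ∧ ∀ k, m < k → g k = F k (g (par k)) := by
  have hlt : ∀ k, m < k → par k < k := fun k hk => hpar k (by have := Fin.lt_def.1 hk; omega)
  let g : Fin n → α := (wellFounded_lt (α := Fin n)).fix fun k ih =>
    if h : m < k then F k (ih (par k) (hlt k h)) else base
  have hg : ∀ k, g k = if m < k then F k (g (par k)) else base := fun k => by
    change (wellFounded_lt (α := Fin n)).fix _ k = _
    rw [WellFounded.fix_eq]
    split_ifs <;> rfl
  exact ⟨g, by rw [hg, if_neg (lt_irrefl m)], fun k hk => by rw [hg, if_pos hk]⟩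

theorem exists_sibling_label {par : Fin n → Fin n} {D : ℕ}
    (hch : ∀ v, #({c | par c = v} : Finset (Fin n)) ≤ D) :
    ∃ lab : Fin n → Fin D, ∀ a b, par a = par b → lab a = lab b → a = b := by
  have hlt : ∀ a, #({c | par c = par a ∧ c < a} : Finset (Fin n)) < D := fun a => by
    refine lt_of_lt_of_le (Finset.card_lt_card ?_) (hch (par a))
    rw [Finset.ssubset_iff_of_subset (fun c hc => Finset.mem_filter.2
      ⟨Finset.mem_univ _, (Finset.mem_filter.1 hc).2.1⟩)]
    exact ⟨a, by simp, by simp⟩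
  refine ⟨fun a => ⟨_, hlt a⟩, ?_⟩
  have key : ∀ a b, par a = par b → a < b → #({c | par c = par a ∧ c < a} : Finset (Fin n)) <
      #({c | par c = par b ∧ c < b} : Finset (Fin n)) := by
    intro a b h hab
    refine Finset.card_lt_card ((Finset.ssubset_iff_of_subset fun c hc => ?_).2 ⟨a, ?_, ?_⟩)
    · simp only [Finset.mem_filter, Finset.mem_univ, true_and] at hc ⊢
      exact ⟨hc.1.trans h, hc.2.trans hab⟩
    · simpa using ⟨h, hab⟩
    · simp
  intro a b h hab
  have hab' := congrArg Fin.val hab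
  simp only at hab'
  rcases lt_trichotomy a b with h' | h' | h'
  · exact absurd hab' (key a b h h').ne
  · exact h'
  · exact absurd hab'.symm (key b a h.symm h').ne

/-- The final part of a bounded degree tree can be cut into components of bounded size by a small
set of vertices, each of which has at most one child outside the set. -/
theorem exists_cut {par : Fin n → Fin n} (hpar : ∀ k : Fin n, k.val ≠ 0 → par k < k)
    {m : Fin n} (hcross : ∀ k, m < k → m ≤ par k) {D : ℕ} (hD : 1 ≤ D)
    (hch : ∀ v, #({c | par c = v} : Finset (Fin n)) ≤ D) {H : ℕ} (hH : 1 ≤ H) :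
    ∃ (L : Finset (Fin n)) (ad : Fin n → ℕ) (brt : Fin n → Fin n),
      m ∈ L ∧ (∀ l ∈ L, m ≤ l) ∧ (#L : ℝ) ≤ H * D ^ H + n * D / H ∧
      (∀ l ∈ L, ∀ c c', par c = l → par c' = l → m < c → m < c' → c ∉ L → c' ∉ L → c = c') ∧
      (∀ k, m < k → k ∉ L → ad k < (D + 1) ^ H) ∧
      (∀ k, m < k → par k ∈ L → ad k = 0 ∧ brt k = k) ∧
      (∀ k, m < k → par k ∉ L → brt k = brt (par k) ∧ ad k ≠ 0 ∧ (ad k - 1) / D = ad (par k)) ∧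
      ∀ k k', m < k → m < k' → k ∉ L → k' ∉ L → ad k = ad k' → brt k = brt k' → k = k' := by
  obtain ⟨lab, hlab⟩ := exists_sibling_label hch
  have hlt : ∀ k, m < k → par k < k := fun k hk => hpar k (by have := Fin.lt_def.1 hk; omega)
  obtain ⟨dep, hdep0, hdep⟩ := exists_par_rec hpar m 0 (fun _ d => d + 1)
  choose inL hinL0 hinL using fun p : ℕ × (Fin H → Fin D) => exists_par_rec hpar m True
    fun k b => (dep k + p.1) % H = 0 ∨
      (b ∧ lab k ≠ p.2 ⟨(dep k + p.1) % H, Nat.mod_lt _ hH⟩)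
  have hdiff : ∀ o (k : Fin n), m < k → (dep k + o) % H ≠ 0 →
      (dep (par k) + o) % H + 1 = (dep k + o) % H := by
    intro o k hk h
    rw [hdep k hk, add_right_comm] at h ⊢
    generalize dep (par k) + o = x at h ⊢
    have h1 : x + 1 = H * (x / H) + (x % H + 1) := by rw [← add_assoc, Nat.div_add_mod]
    rw [h1, Nat.mul_add_mod] at h ⊢
    rcases (Nat.succ_le_of_lt (Nat.mod_lt x hH)).lt_or_eq with h2 | h2
    · rw [Nat.mod_eq_of_lt h2]
    · rw [Nat.succ_eq_add_one] at h2
      rw [h2, Nat.mod_self] at h; exact absurd rfl h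
  have hforce : ∀ o j (k : Fin n), m ≤ k → j ≤ (dep k + o) % H → j ≤ dep k →
      ∃ c : Fin H → Fin D, ∀ lam, inL (o, lam) k → ∀ t : Fin H, (dep k + o) % H < t.val + j →
        t.val ≤ (dep k + o) % H → lam t ≠ c t := by
    intro o j
    induction j with
    | zero => exact fun k _ _ _ => ⟨fun _ => ⟨0, hD⟩, fun _ _ t h h' => by omega⟩
    | succ j ih =>
      intro k hk h1 h2
      have hmk : m < k := lt_of_le_of_ne hk (by rintro rfl; omega)
      have hs := hdiff o k hmk (by omega)
      obtain ⟨c, hc⟩ := ih (par k) (hcross k hmk) (by omega) (by rw [hdep k hmk] at h2; omega)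
      refine ⟨fun t => if t.val = (dep k + o) % H then lab k else c t, fun lam hlam t h3 h4 => ?_⟩
      rw [hinL _ k hmk] at hlam
      obtain ⟨hl1, hl2⟩ := hlam.resolve_left (by simp only; omega)
      by_cases ht : t.val = (dep k + o) % H
      · simp only [ht, if_true]
        have : t = ⟨(dep k + o) % H, Nat.mod_lt _ hH⟩ := Fin.ext ht
        rw [this]; exact hl2.symm
      · simp only [ht, if_false]
        exact hc lam hl1 t (by omega) (by omega)
  have hDr : (1 : ℝ) ≤ D := by exact_mod_cast hD
  have hHr : (1 : ℝ) ≤ H := by exact_mod_cast hH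
  set r : ℝ := 1 - 1 / D with hr
  have hr0 : 0 ≤ r := by rw [hr, sub_nonneg, div_le_one (by linarith)]; exact hDr
  have hcount : ∀ o (k : Fin n), m ≤ k → H ≤ dep k →
      (#{lam | inL (o, lam) k} : ℝ) ≤ D ^ H * r ^ ((dep k + o) % H) := by
    intro o k hk hHk
    have hjH := Nat.mod_lt (dep k + o) hH
    obtain ⟨c, hc⟩ := hforce o ((dep k + o) % H) k hk le_rfl (hjH.le.trans hHk)
    set j := (dep k + o) % H with hj
    have hsub : ({lam | inL (o, lam) k} : Finset (Fin H → Fin D)) ⊆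
        Fintype.piFinset fun t : Fin H =>
          if 0 < t.val ∧ t.val ≤ j then {c t}ᶜ else Finset.univ := by
      intro lam hlam
      rw [Finset.mem_filter] at hlam
      rw [Fintype.mem_piFinset]
      intro t
      split_ifs with h
      · simpa using hc lam hlam.2 t (by omega) h.2
      · exact Finset.mem_univ _
    have h1 := Finset.card_le_card hsub
    rw [Fintype.card_piFinset] at h1
    have h2 : (∏ t : Fin H, #(if 0 < t.val ∧ t.val ≤ j then ({c t}ᶜ : Finset (Fin D))
        else Finset.univ) : ℝ) = D ^ H * r ^ j := by
      have h3 : ∀ t : Fin H, ((#(if 0 < t.val ∧ t.val ≤ j then ({c t}ᶜ : Finset (Fin D))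
          else Finset.univ) : ℕ) : ℝ) = D * if 0 < t.val ∧ t.val ≤ j then r else 1 := by
        intro t
        split_ifs
        · rw [Finset.card_compl, Finset.card_singleton, Fintype.card_fin, Nat.cast_sub hD, hr]
          field_simp; simp
        · simp
      rw [Finset.prod_congr rfl fun t _ => h3 t, Finset.prod_mul_distrib, Finset.prod_const,
        Finset.card_univ, Fintype.card_fin, Finset.prod_ite, Finset.prod_const_one, mul_one,
        Finset.prod_const]
      congr 2
      have : (Finset.univ.filter fun t : Fin H => 0 < t.val ∧ t.val ≤ j) =
          (Finset.Ioc (⟨0, hH⟩ : Fin H) ⟨j, hjH⟩) := by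
        ext t; simp [Fin.lt_def, Fin.le_def]
      rw [this, Fin.card_Ioc]; simp
    rw [← h2]; exact_mod_cast h1
  have hgeom : ∀ d, ∑ o ∈ range H, r ^ ((d + o) % H) ≤ D := by
    intro d
    have h1 : ∑ o ∈ range H, r ^ ((d + o) % H) = ∑ j ∈ range H, r ^ j := by
      have h2 := Nat.image_Ico_mod d H
      have h3 : ∑ o ∈ range H, r ^ ((d + o) % H) = ∑ i ∈ Finset.Ico d (d + H), r ^ (i % H) := by
        rw [Finset.sum_Ico_eq_sum_range, Nat.add_sub_cancel_left]
      rw [h3, ← h2, Finset.sum_image]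
      refine Finset.card_image_iff.1 ?_
      rw [h2]; simp
    rw [h1]
    have h2 := mul_neg_geom_sum r H
    have h3 : 1 - r = 1 / D := by rw [hr]; ring
    rw [h3] at h2
    have h4 : ∑ j ∈ range H, r ^ j = D * (1 - r ^ H) := by rw [← h2]; field_simp
    rw [h4]
    nlinarith [pow_nonneg hr0 H]
  set sh : Finset (Fin n) := {k | m ≤ k ∧ dep k < H} with hsh
  have hshcard : #sh ≤ H * D ^ H := by
    have hdepit : ∀ k, m ≤ k → par^[dep k] k = m := by
      intro k
      induction k using WellFoundedLT.induction with
      | _ k ih =>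
        intro hk
        rcases hk.eq_or_lt with rfl | hk
        · rw [hdep0]; rfl
        · rw [hdep k hk, Function.iterate_succ_apply]
          exact ih _ (hlt k hk) (hcross k hk)
    have hsub : sh ⊆ (range H).biUnion fun i => ({c | par^[i] c = m} : Finset (Fin n)) := by
      intro k hk
      rw [hsh, Finset.mem_filter] at hk
      exact Finset.mem_biUnion.2 ⟨dep k, Finset.mem_range.2 hk.2.2,
        Finset.mem_filter.2 ⟨Finset.mem_univ _, hdepit k hk.2.1⟩⟩
    refine (Finset.card_le_card hsub).trans ((Finset.card_biUnion_le_card_mul _ _ (D ^ H)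
      fun i hi => (card_iterate_fiber_le hch i m).trans ?_).trans (by rw [Finset.card_range]))
    exact Nat.pow_le_pow_right hD (Finset.mem_range.1 hi).le
  set Lf : ℕ × (Fin H → Fin D) → Finset (Fin n) := fun p => {k | m ≤ k ∧ inL p k} with hLf
  set Pf : Finset (ℕ × (Fin H → Fin D)) := range H ×ˢ Finset.univ with hPf
  have hPcard : (#Pf : ℝ) = H * D ^ H := by
    rw [hPf, Finset.card_product, Finset.card_range, Finset.card_univ, Fintype.card_fun,
      Fintype.card_fin, Fintype.card_fin]
    push_cast; rfl
  have havg : ∃ p ∈ Pf, (#(Lf p) : ℝ) ≤ H * D ^ H + n * D / H := by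
    refine Finset.exists_le_of_sum_le ⟨(0, fun _ => ⟨0, hD⟩), by simp [hPf]; omega⟩ ?_
    rw [Finset.sum_const, nsmul_eq_mul, hPcard]
    have h1 : ∀ p, (#(Lf p) : ℝ) ≤ #sh +
        ∑ k ∈ ({k | m ≤ k ∧ H ≤ dep k} : Finset (Fin n)), if inL p k then (1 : ℝ) else 0 := by
      intro p
      rw [Finset.sum_boole]
      have : Lf p ⊆ sh ∪ ({k | m ≤ k ∧ H ≤ dep k} : Finset (Fin n)).filter fun k => inL p k := by
        intro k hk
        simp only [hLf, hsh, Finset.mem_union, Finset.mem_filter, Finset.mem_univ,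
          true_and] at hk ⊢
        rcases lt_or_ge (dep k) H with h | h
        · exact Or.inl ⟨hk.1, h⟩
        · exact Or.inr ⟨⟨hk.1, h⟩, hk.2⟩
      exact_mod_cast (Finset.card_le_card this).trans (Finset.card_union_le _ _)
    calc ∑ p ∈ Pf, (#(Lf p) : ℝ) ≤ ∑ p ∈ Pf, ((#sh : ℝ) +
          ∑ k ∈ ({k | m ≤ k ∧ H ≤ dep k} : Finset (Fin n)), if inL p k then (1 : ℝ) else 0) :=
          Finset.sum_le_sum fun p _ => h1 p
      _ = #Pf * #sh + ∑ k ∈ ({k | m ≤ k ∧ H ≤ dep k} : Finset (Fin n)),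
          ∑ o ∈ range H, (#{lam | inL (o, lam) k} : ℝ) := by
          rw [Finset.sum_add_distrib, Finset.sum_const, nsmul_eq_mul, Finset.sum_comm]
          congr 1
          refine Finset.sum_congr rfl fun k _ => ?_
          rw [hPf, Finset.sum_product]
          refine Finset.sum_congr rfl fun o _ => ?_
          rw [Finset.sum_boole]
      _ ≤ H * D ^ H * (H * D ^ H) + ∑ k ∈ ({k | m ≤ k ∧ H ≤ dep k} : Finset (Fin n)),
          (D ^ H * D : ℝ) := by
          rw [hPcard]
          gcongr with k hk
          · exact_mod_cast hshcard
          · rw [Finset.mem_filter] at hk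
            calc _ ≤ ∑ o ∈ range H, (D ^ H * r ^ ((dep k + o) % H) : ℝ) :=
                  Finset.sum_le_sum fun o _ => hcount o k hk.2.1 hk.2.2
              _ ≤ _ := by
                  rw [← Finset.mul_sum]
                  gcongr
                  exact hgeom _
      _ ≤ H * D ^ H * (H * D ^ H) + n * (D ^ H * D : ℝ) := by
          rw [Finset.sum_const, nsmul_eq_mul]
          gcongr
          exact (Finset.card_le_univ _).trans (by simp)
      _ = _ := by field_simp
  obtain ⟨p, -, hp⟩ := havg
  set L := Lf p with hL
  have hmemL : ∀ k, k ∈ L ↔ m ≤ k ∧ inL p k := fun k => by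
    rw [hL, hLf]; simp
  have hmL : m ∈ L := (hmemL m).2 ⟨le_rfl, by rw [hinL0]; trivial⟩
  obtain ⟨ad, -, had⟩ := exists_par_rec hpar m 0
    fun k a => if par k ∈ L then 0 else D * a + (lab k).val + 1
  obtain ⟨brt, -, hbrt⟩ := exists_par_rec hpar m m fun k b => if par k ∈ L then k else b
  have hnot : ∀ k, m < k → k ∉ L → (dep k + p.1) % H ≠ 0 ∧ (par k ∈ L →
      lab k = p.2 ⟨(dep k + p.1) % H, Nat.mod_lt _ hH⟩) := by
    intro k hk hkL
    rw [hmemL, hinL p k hk] at hkL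
    push Not at hkL
    have := hkL hk.le
    exact ⟨this.1, fun h => this.2 ((hmemL _).1 h).2⟩
  have hbound : ∀ k, m < k → k ∉ L → ad k < (D + 1) ^ ((dep k + p.1) % H) := by
    intro k
    induction k using WellFoundedLT.induction with
    | _ k ih =>
      intro hk hkL
      rw [had k hk]
      split_ifs with h
      · positivity
      · have hmp : m < par k := lt_of_le_of_ne (hcross k hk)
          (by rintro h'; rw [← h'] at h; exact h hmL)
        have h1 := ih _ (hlt k hk) hmp h
        rw [← hdiff p.1 k hk (hnot k hk hkL).1, pow_succ]
        have h2 := (lab k).2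
        nlinarith
  refine ⟨L, ad, brt, hmL, fun l hl => ((hmemL l).1 hl).1, hp, ?_, ?_, ?_, ?_, ?_⟩
  · rintro l hl c c' rfl hc' hmc hmc' hcL hcL'
    have h1 := (hnot c hmc hcL).2 hl
    have h2 := (hnot c' hmc' hcL').2 (by rwa [hc'])
    refine hlab c c' hc'.symm ?_
    rw [h1, h2]
    rw [hdep c hmc, hdep c' hmc', hc']
  · intro k hk hkL
    exact (hbound k hk hkL).trans_le (Nat.pow_le_pow_right (by omega) (Nat.mod_lt _ hH).le)
  · intro k hk h
    rw [had k hk, hbrt k hk, if_pos h, if_pos h]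
    exact ⟨rfl, rfl⟩
  · intro k hk h
    rw [had k hk, hbrt k hk, if_neg h, if_neg h]
    refine ⟨rfl, by omega, ?_⟩
    rw [Nat.add_sub_cancel, add_comm, Nat.add_mul_div_left _ _ hD, Nat.div_eq_of_lt (lab k).2,
      zero_add]
  · intro k
    induction k using WellFoundedLT.induction with
    | _ k ih =>
      intro k' hk hk' hkL hkL' h1 h2
      rw [had k hk, had k' hk'] at h1
      rw [hbrt k hk, hbrt k' hk'] at h2
      by_cases h : par k ∈ L <;> by_cases h' : par k' ∈ L
      · rwa [if_pos h, if_pos h'] at h2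
      · rw [if_pos h, if_neg h'] at h1; omega
      · rw [if_neg h, if_pos h'] at h1; omega
      · rw [if_neg h, if_neg h'] at h1 h2
        have hl := (lab k).2
        have hl' := (lab k').2
        have h3 : ∀ a l : ℕ, l < D → (D * a + l) % D = l ∧ (D * a + l) / D = a := fun a l hl => by
          rw [Nat.mul_add_mod, Nat.mod_eq_of_lt hl, Nat.mul_add_div hD, Nat.div_eq_of_lt hl]
          exact ⟨rfl, rfl⟩
        have h4 := h3 (ad (par k)) _ hl
        have h5 := h3 (ad (par k')) _ hl'
        have h6 : D * ad (par k) + (lab k).val = D * ad (par k') + (lab k').val := by omega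
        rw [h6] at h4
        have hne : ∀ j, m < j → par j ∉ L → m < par j := fun j hj h =>
          lt_of_le_of_ne (hcross j hj) (by rintro h'; rw [← h'] at h; exact h hmL)
        have h7 := ih (par k) (hlt k hk) (par k') (hne k hk h) (hne k' hk' h') h h'
          (h4.2.symm.trans h5.2) h2
        exact hlab k k' h7 (Fin.ext (h4.1.symm.trans h5.1))

end TreeBodies

section TreeBundles
open scoped Classical

/-- The final part of a bounded degree tree contains a small set `L` such that most of the
remaining vertices can be arranged into isomorphic components, grouped into bundles consisting of
`q` corresponding components each. -/
theorem exists_bundles (D : ℕ) (hD : 1 ≤ D) {ε : ℝ} (hε : 0 < ε) :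
    ∃ K : ℕ, ∀ q : ℕ, 1 ≤ q → ∃ n₀ : ℕ, ∀ n ≥ n₀, ∀ (par : Fin n → Fin n) (m : Fin n),
      (∀ k : Fin n, k.val ≠ 0 → par k < k) → (∀ k, m < k → m ≤ par k) →
      (∀ v, #({c | par c = v} : Finset (Fin n)) ≤ D) →
      ∃ (L X : Finset (Fin n)) (grp : Fin n → Finset ℕ × ℕ) (cell : Fin n → ℕ),
        m ∈ L ∧ (∀ l ∈ L, m ≤ l) ∧ (∀ x ∈ X, m < x ∧ x ∉ L) ∧
        (#L : ℝ) + #({k | m < k ∧ k ∉ L ∧ k ∉ X} : Finset (Fin n)) ≤ ε * n ∧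
        (∀ l ∈ L, ∀ c c', par c = l → par c' = l → m < c → m < c' → c ∉ L → c' ∉ L → c = c') ∧
        (∀ k, m < k → k ∉ L → par k ∉ L → (k ∈ X ↔ par k ∈ X)) ∧
        (∀ x ∈ X, #{y ∈ X | grp y = grp x ∧ cell y = cell x} = q) ∧
        (∀ x ∈ X, ∀ y ∈ X, grp x = grp y → cell x = cell y → par x ∉ L → par y ∉ L ∧
          cell (par x) = cell (par y) ∧ (par x = par y → x = y)) ∧
        (∀ x ∈ X, par x ∉ L → grp x = grp (par x)) ∧
        ∀ x ∈ X, #{y ∈ X | grp y = grp x} ≤ q * K := by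
  obtain ⟨H, hH⟩ := exists_nat_gt (4 * D / ε)
  have hDr : (1 : ℝ) ≤ D := by exact_mod_cast hD
  have hHpos : 0 < (H : ℝ) := lt_of_le_of_lt (by positivity) hH
  have hH1 : 1 ≤ H := by exact_mod_cast hHpos
  set K := (D + 1) ^ H with hK
  refine ⟨K, fun q hq => ?_⟩
  obtain ⟨n₀, hn₀⟩ := exists_nat_gt ((H * D ^ H + 2 ^ K * q * K : ℝ) * (2 / ε))
  refine ⟨n₀, fun n hn par m hpar hcross hch => ?_⟩
  obtain ⟨L, ad, brt, hmL, hLm, hLcard, hLch, hadK, hroot, hnroot, hinj⟩ :=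
    exists_cut hpar hcross hD hch hH1
  set N : Finset (Fin n) := {k | m < k ∧ k ∉ L} with hN
  have hmemN : ∀ k, k ∈ N ↔ m < k ∧ k ∉ L := fun k => by simp [hN]
  set Bd : Finset (Fin n) := N.filter fun k => par k ∈ L with hBd
  set typ : Fin n → Finset ℕ := fun b => (N.filter fun k => brt k = b).image ad with htyp
  have hlt : ∀ k, m < k → par k < k := fun k hk => hpar k (by have := Fin.lt_def.1 hk; omega)
  have hparN : ∀ k ∈ N, par k ∉ L → par k ∈ N := fun k hk h => by
    rw [hmemN] at hk ⊢
    exact ⟨lt_of_le_of_ne (hcross k hk.1) (by rintro h'; rw [← h'] at h; exact h hmL), h⟩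
  have hbrtBd : ∀ k ∈ N, brt k ∈ Bd := by
    intro k
    induction k using WellFoundedLT.induction with
    | _ k ih =>
      intro hk
      have hk' := (hmemN k).1 hk
      by_cases h : par k ∈ L
      · rw [(hroot k hk'.1 h).2]; exact Finset.mem_filter.2 ⟨hk, h⟩
      · rw [(hnroot k hk'.1 h).1]
        exact ih _ (hlt k hk'.1) (hparN k hk h)
  obtain ⟨Bd', hBd', g, hg, hleft⟩ := exists_equal_typed_classes q hq Bd typ (range K).powerset
    (fun b _ => Finset.mem_powerset.2 fun a ha => by
      obtain ⟨k, hk, rfl⟩ := Finset.mem_image.1 ha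
      have := (hmemN k).1 (Finset.mem_filter.1 hk).1
      exact Finset.mem_range.2 (hadK k this.1 this.2))
  rw [Finset.card_powerset, Finset.card_range] at hleft
  replace hleft : #(Bd \ Bd') ≤ 2 ^ K * q := by convert hleft
  replace hg : ∀ b ∈ Bd', #{b' ∈ Bd' | typ b' = typ b ∧ g b' = g b} = q := fun b hb => by
    convert hg b hb
  set X := N.filter fun k => brt k ∈ Bd' with hX
  have hXN : ∀ x ∈ X, x ∈ N ∧ brt x ∈ Bd' := fun x hx => Finset.mem_filter.1 hx
  have hinjN : ∀ k ∈ N, ∀ k' ∈ N, ad k = ad k' → brt k = brt k' → k = k' := fun k hk k' hk' =>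
    hinj k k' ((hmemN k).1 hk).1 ((hmemN k').1 hk').1 ((hmemN k).1 hk).2 ((hmemN k').1 hk').2
  have hXpar : ∀ k, m < k → k ∉ L → par k ∉ L → (k ∈ X ↔ par k ∈ X) := by
    intro k hk hkL h
    have hkN := (hmemN k).2 ⟨hk, hkL⟩
    have h1 : ∀ x, x ∈ X ↔ x ∈ N ∧ brt x ∈ Bd' := fun x => Finset.mem_filter
    rw [h1, h1, (hnroot k hk h).1]
    exact ⟨fun h' => ⟨hparN k hkN h, h'.2⟩, fun h' => ⟨hkN, h'.2⟩⟩
  refine ⟨L, X, fun k => (typ (brt k), g (brt k)), ad, hmL, hLm,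
    fun x hx => (hmemN x).1 (hXN x hx).1, ?_, hLch, hXpar, ?_, ?_, ?_, ?_⟩
  · have h1 : #({k | m < k ∧ k ∉ L ∧ k ∉ X} : Finset (Fin n)) ≤ 2 ^ K * q * K := by
      have h2 : #({k | m < k ∧ k ∉ L ∧ k ∉ X} : Finset (Fin n)) ≤ #((Bd \ Bd') ×ˢ range K) := by
        refine Finset.card_le_card_of_injOn (fun k => (brt k, ad k)) ?_ ?_
        · intro k hk
          have hk' : m < k ∧ k ∉ L ∧ k ∉ X := by simpa using hk
          have hkN := (hmemN k).2 ⟨hk'.1, hk'.2.1⟩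
          rw [Finset.mem_coe, Finset.mem_product, Finset.mem_sdiff, Finset.mem_range]
          exact ⟨⟨hbrtBd k hkN, fun h => hk'.2.2 (Finset.mem_filter.2 ⟨hkN, h⟩)⟩,
            hadK k hk'.1 hk'.2.1⟩
        · intro k hk k' hk' h
          have hk1 : m < k ∧ k ∉ L ∧ k ∉ X := by simpa using hk
          have hk2 : m < k' ∧ k' ∉ L ∧ k' ∉ X := by simpa using hk'
          exact hinjN k ((hmemN k).2 ⟨hk1.1, hk1.2.1⟩) k' ((hmemN k').2 ⟨hk2.1, hk2.2.1⟩)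
            (congrArg Prod.snd h) (congrArg Prod.fst h)
      rw [Finset.card_product, Finset.card_range] at h2
      exact h2.trans (Nat.mul_le_mul_right _ hleft)
    have h1' : (#({k | m < k ∧ k ∉ L ∧ k ∉ X} : Finset (Fin n)) : ℝ) ≤ 2 ^ K * q * K := by
      exact_mod_cast h1
    have hnr : (n₀ : ℝ) ≤ n := by exact_mod_cast hn
    have h3 : (H * D ^ H + 2 ^ K * q * K : ℝ) ≤ ε / 2 * n := by
      have h4 := hn₀.le.trans hnr
      rw [← mul_div_assoc, div_le_iff₀ hε] at h4
      linarith
    have h4 : (n * D / H : ℝ) ≤ ε / 2 * n := by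
      rw [div_lt_iff₀ hε] at hH
      rw [div_le_iff₀ hHpos]
      nlinarith [(Nat.cast_nonneg n : (0 : ℝ) ≤ n)]
    linarith
  · intro x hx
    obtain ⟨hxN, hxB⟩ := hXN x hx
    rw [← hg _ hxB]
    refine Finset.card_bij (fun y _ => brt y) ?_ ?_ ?_
    · intro y hy
      simp only [Finset.mem_filter, Prod.mk.injEq] at hy ⊢
      exact ⟨(hXN y hy.1).2, hy.2.1⟩
    · intro y hy y' hy' h
      simp only [Finset.mem_filter] at hy hy'
      exact hinjN y (hXN y hy.1).1 y' (hXN y' hy'.1).1 (hy.2.2.trans hy'.2.2.symm) h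
    · intro b hb
      rw [Finset.mem_filter] at hb
      have h1 : ad x ∈ typ b := by
        rw [hb.2.1, htyp]
        exact Finset.mem_image.2 ⟨x, Finset.mem_filter.2 ⟨hxN, rfl⟩, rfl⟩
      obtain ⟨y, hy, hyx⟩ := Finset.mem_image.1 h1
      rw [Finset.mem_filter] at hy
      refine ⟨y, Finset.mem_filter.2 ⟨Finset.mem_filter.2 ⟨hy.1, ?_⟩, ?_, hyx⟩, hy.2⟩
      · rw [hy.2]; exact hb.1
      · simp only; rw [hy.2, hb.2.1, hb.2.2]
  · intro x hx y hy _ hcell hpx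
    have hx' := (hmemN x).1 (hXN x hx).1
    have hy' := (hmemN y).1 (hXN y hy).1
    have h1 := hnroot x hx'.1 hpx
    have hpy : par y ∉ L := fun h => h1.2.1 (hcell.trans (hroot y hy'.1 h).1)
    have h2 := hnroot y hy'.1 hpy
    refine ⟨hpy, by rw [← h1.2.2, ← h2.2.2, hcell], fun h => ?_⟩
    refine hinjN x (hXN x hx).1 y (hXN y hy).1 hcell ?_
    rw [h1.1, h2.1, h]
  · intro x hx hpx
    simp only
    rw [(hnroot x ((hmemN x).1 (hXN x hx).1).1 hpx).1]
  · intro x hx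
    obtain ⟨hxN, hxB⟩ := hXN x hx
    rw [← hg _ hxB, ← Finset.card_range K, ← Finset.card_product]
    refine Finset.card_le_card_of_injOn (fun k => (brt k, ad k)) ?_ ?_
    · intro y hy
      simp only [Finset.coe_filter, Set.mem_ofPred_eq, Prod.mk.injEq] at hy
      have := (hmemN y).1 (hXN y hy.1).1
      simp only [Finset.coe_product, Set.mem_prod, Finset.mem_coe, Finset.mem_filter,
        Finset.mem_range]
      exact ⟨⟨(hXN y hy.1).2, hy.2⟩, hadK y this.1 this.2⟩
    · intro y hy y' hy' h
      simp only [Finset.coe_filter, Set.mem_ofPred_eq] at hy hy'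
      exact hinjN y (hXN y hy.1).1 y' (hXN y' hy'.1).1
        (congrArg Prod.snd h) (congrArg Prod.fst h)

end TreeBundles

section Hits
open scoped Classical

/-- A binomial-type lower tail bound obtained from an exponential moment. -/
theorem pr_few_hits {Ω : Type*} [Fintype Ω] {w : Ω → ℝ} (hw : IsProb w) (X : Ω → ℕ) {c : ℝ}
    (hc0 : 0 ≤ c) {N : ℕ} (hc1 : c ≤ 1) (h : ∑ a, w a * (1 / 2 : ℝ) ^ X a ≤ (1 - c) ^ N) :
    pr w (fun a => (X a : ℝ) < c * N / 2) ≤ Real.exp (-(c * N / 2)) := by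
  have hN : (0 : ℝ) ≤ c * N / 2 := by positivity
  have h1 := pr_markov hw.nonneg (fun a => (1 / 2 : ℝ) ^ X a) (t := Real.exp (-(c * N / 2)))
    (fun a _ => by positivity) (Real.exp_pos _)
  have h2 : (1 - c) ^ N ≤ Real.exp (-(c * N)) := by
    calc (1 - c) ^ N ≤ Real.exp (-c) ^ N :=
          pow_le_pow_left₀ (by linarith) (by linarith [Real.add_one_le_exp (-c)]) N
      _ = _ := by rw [← Real.exp_nat_mul]; ring_nf
  calc _ ≤ _ := pr_mono hw.nonneg (fun a _ ha => ?_)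
    _ ≤ _ := h1
    _ ≤ Real.exp (-(c * N)) / Real.exp (-(c * N / 2)) := by gcongr; exact h.trans h2
    _ = _ := by rw [← Real.exp_sub]; ring_nf
  have h3 : (1 / 2 : ℝ) ≥ Real.exp (-1) := by
    have := Real.add_one_le_exp (1 : ℝ)
    rw [Real.exp_neg, ge_iff_le, ← one_div]
    exact one_div_le_one_div_of_le (by norm_num) (by linarith)
  calc Real.exp (-(c * N / 2)) ≤ Real.exp (-(X a : ℝ)) := by
        rw [Real.exp_le_exp]; linarith
    _ = Real.exp (-1) ^ X a := by rw [← Real.exp_nat_mul]; ring_nf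
    _ ≤ _ := pow_le_pow_left₀ (Real.exp_pos _).le h3 _

/-- Random greedy choices in which each of many disjoint blocks of positions has a constant
probability of hitting prescribed targets. -/
theorem exists_seq_choice_hits {n : ℕ} {V R : Type*} [Fintype V] (hn : 0 < n) (m : ℕ) (hm : m ≤ n)
    (f0 : Fin n → V) (Inv : ℕ → (Fin n → V) → Prop) (Opt : Fin n → (Fin n → V) → Finset V)
    {D : ℝ} (hD : 0 < D) (h0 : Inv 0 f0)
    (hopt : ∀ k : Fin n, k.val < m → ∀ f, Inv k f → D ≤ #(Opt k f))
    (hstep : ∀ k : Fin n, k.val < m → ∀ f, Inv k f → ∀ v ∈ Opt k f,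
      Inv (k + 1) (Function.update f k v))
    (I : Finset (Fin n)) (B : Fin n → Finset (Fin n)) (hB : (I : Set (Fin n)).PairwiseDisjoint B)
    (hBm : ∀ x ∈ I, ∀ i ∈ B x, i.val < m) {b : ℕ} (hBb : ∀ x ∈ I, #(B x) ≤ b)
    (tgt : R → Fin n → Fin n → Finset V) {p : ℝ} (hp0 : 0 ≤ p) (hp1 : p ≤ 1)
    (hhit : ∀ k : Fin n, k.val < m → ∀ f, Inv k f → ∀ r, ∀ x ∈ I, k ∈ B x →
      (∀ j ∈ B x, j < k → f j ∈ tgt r x j) → p * #(Opt k f) ≤ #{v ∈ Opt k f | v ∈ tgt r x k}) :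
    ∃ w : (Fin n → V) → ℝ, IsProb w ∧ (∀ f, w f ≠ 0 → Inv m f ∧ ∀ i, m ≤ i.val → f i = f0 i) ∧
      (∀ (S : Finset (Fin n)) (y : Fin n → V),
        pr w (fun f => ∀ i ∈ S, f i = y i) ≤ (1 / D) ^ #{i ∈ S | i.val < m}) ∧
      ∀ r, ∑ f, w f * (1 / 2 : ℝ) ^ #{x ∈ I | ∀ i ∈ B x, f i ∈ tgt r x i} ≤
        (1 - p ^ b / 2) ^ #I := by
  set e : ℕ → Fin n := fun k => if h : k < n then ⟨k, h⟩ else ⟨0, hn⟩ with he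
  have hek : ∀ k, k < m → (e k).val = k := fun k hk => by
    simp only [he]; rw [dif_pos (by omega)]
  have hei : ∀ i : Fin n, e i.val = i := fun i => by simp [he]
  set M : ℕ → R → (Fin n → V) → ℝ := fun k r f => ∏ x ∈ I,
    (if ∀ i ∈ B x, i.val < k → f i ∈ tgt r x i then 1 - p ^ #{i ∈ B x | k ≤ i.val} / 2 else 1)
    with hM
  have hMstep : ∀ k < m, ∀ f, Inv k f → ∀ r, ∑ v ∈ Opt (e k) f,
      M (k + 1) r (Function.update f (e k) v) ≤ #(Opt (e k) f) * M k r f := by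
    intro k hk f hf r
    set K := e k with hK
    have hKv : K.val = k := hek k hk
    have hsame : ∀ x ∈ I, K ∉ B x → ∀ v,
        (if ∀ i ∈ B x, i.val < k + 1 → Function.update f K v i ∈ tgt r x i then
          1 - p ^ #{i ∈ B x | k + 1 ≤ i.val} / 2 else 1) =
        (if ∀ i ∈ B x, i.val < k → f i ∈ tgt r x i then
          1 - p ^ #{i ∈ B x | k ≤ i.val} / 2 else 1) := by
      intro x hx hKx v
      have hne : ∀ i ∈ B x, i.val ≠ k := fun i hi h => hKx (by
        rwa [← Fin.ext (h.trans hKv.symm)])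
      have h1 : (∀ i ∈ B x, i.val < k + 1 → Function.update f K v i ∈ tgt r x i) ↔
          ∀ i ∈ B x, i.val < k → f i ∈ tgt r x i := by
        refine forall₂_congr fun i hi => ?_
        rw [Function.update_of_ne (fun h => hne i hi (by rw [h, hKv]))]
        have := hne i hi
        exact ⟨fun h h' => h (by omega), fun h h' => h (by omega)⟩
      have h2 : ({i ∈ B x | k + 1 ≤ i.val}) = {i ∈ B x | k ≤ i.val} :=
        Finset.filter_congr fun i hi => by have := hne i hi; omega
      rw [h2]
      simp only [h1]
    by_cases hex : ∃ x ∈ I, K ∈ B x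
    · obtain ⟨x, hx, hKx⟩ := hex
      have hother : ∀ y ∈ I.erase x, K ∉ B y := fun y hy h => by
        rw [Finset.mem_erase] at hy
        exact Finset.disjoint_left.1 (hB hy.2 hx hy.1) h hKx
      simp only [hM]
      rw [← Finset.mul_prod_erase I _ hx]
      have h1 : ∀ v, ∏ y ∈ I, (if ∀ i ∈ B y, i.val < k + 1 → Function.update f K v i ∈ tgt r y i
          then 1 - p ^ #{i ∈ B y | k + 1 ≤ i.val} / 2 else 1) =
          (if ∀ i ∈ B x, i.val < k + 1 → Function.update f K v i ∈ tgt r x i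
          then 1 - p ^ #{i ∈ B x | k + 1 ≤ i.val} / 2 else 1) * ∏ y ∈ I.erase x,
          (if ∀ i ∈ B y, i.val < k → f i ∈ tgt r y i then
          1 - p ^ #{i ∈ B y | k ≤ i.val} / 2 else 1) := fun v => by
        rw [← Finset.mul_prod_erase I _ hx]
        congr 1
        exact Finset.prod_congr rfl fun y hy => hsame y (Finset.mem_of_mem_erase hy) (hother y hy) v
      rw [Finset.sum_congr rfl fun v _ => h1 v, ← Finset.sum_mul, ← mul_assoc]
      refine mul_le_mul_of_nonneg_right ?_ (Finset.prod_nonneg fun y _ => ?_)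
      · by_cases hgood : ∀ i ∈ B x, i.val < k → f i ∈ tgt r x i
        · rw [if_pos hgood]
          have h2 := hhit K (by omega) f (by rwa [hKv]) r x hx hKx fun j hj hjK =>
            hgood j hj (by have := Fin.lt_def.1 hjK; omega)
          have h3 : #{i ∈ B x | k ≤ i.val} = #{i ∈ B x | k + 1 ≤ i.val} + 1 := by
            have : ({i ∈ B x | k ≤ i.val}) = insert K {i ∈ B x | k + 1 ≤ i.val} := by
              ext i
              simp only [Finset.mem_filter, Finset.mem_insert, Fin.ext_iff, hKv]
              constructor
              · rintro ⟨h, h'⟩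
                rcases h'.eq_or_lt with h'' | h''
                · exact Or.inl h''.symm
                · exact Or.inr ⟨h, h''⟩
              · rintro (h | h)
                · rw [Fin.ext (h.trans hKv.symm)]; exact ⟨hKx, hKv.ge⟩
                · exact ⟨h.1, by omega⟩
            rw [this, Finset.card_insert_of_notMem (by simp [hKv])]
          set c := p ^ #{i ∈ B x | k + 1 ≤ i.val} with hc
          have hc0 : 0 ≤ c := pow_nonneg hp0 _
          calc _ ≤ ∑ v ∈ Opt K f, (1 - c / 2 * if v ∈ tgt r x K then 1 else 0) := by
                refine Finset.sum_le_sum fun v _ => ?_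
                by_cases hv : v ∈ tgt r x K
                · rw [if_pos hv, if_pos, mul_one]
                  intro i hi hik
                  by_cases hiK : i = K
                  · rw [hiK, Function.update_self]; exact hv
                  · rw [Function.update_of_ne hiK]
                    refine hgood i hi ?_
                    have : i.val ≠ K.val := fun h => hiK (Fin.ext h)
                    omega
                · rw [if_neg hv, mul_zero, sub_zero]
                  split_ifs
                  · linarith
                  · exact le_rfl
            _ = #(Opt K f) - c / 2 * #{v ∈ Opt K f | v ∈ tgt r x K} := by
                rw [Finset.sum_sub_distrib, ← Finset.mul_sum, Finset.sum_boole]; simp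
            _ ≤ #(Opt K f) - c / 2 * (p * #(Opt K f)) := by gcongr
            _ = _ := by rw [h3, pow_succ]; ring
        · rw [if_neg hgood, mul_one]
          rw [Finset.sum_congr rfl fun v _ => if_neg ?_]
          · simp
          · intro h
            refine hgood fun i hi hik => ?_
            have := h i hi (by omega)
            rwa [Function.update_of_ne (by rintro rfl; omega)] at this
      · have : p ^ #{i ∈ B y | k ≤ i.val} ≤ 1 := pow_le_one₀ hp0 hp1
        split_ifs
        · linarith
        · norm_num
    · push Not at hex
      rw [Finset.sum_congr rfl fun v _ => Finset.prod_congr rfl fun x hx => hsame x hx (hex x hx) v]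
      simp [hM]
  obtain ⟨w, hw, hsupp, hspread, hmom⟩ := exists_seq_choice m e (fun a ha b hb hab => by
      have := congrArg Fin.val hab
      rwa [hek a ha, hek b hb] at this) f0 Inv (fun k => Opt (e k)) hD h0
    (fun k hk f hf => hopt (e k) (by rw [hek k hk]; exact hk) f (by rwa [hek k hk]))
    (fun k hk f hf v hv => by
      have := hstep (e k) (by rw [hek k hk]; exact hk) f (by rwa [hek k hk]) v hv
      rwa [hek k hk] at this) M hMstep
  refine ⟨w, hw, fun f hf => ⟨(hsupp f hf).1, fun i hi => (hsupp f hf).2 i fun k hk h => ?_⟩,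
    fun S y => ?_, fun r => ?_⟩
  · have := hek k hk; rw [h] at this; omega
  · have : ({i ∈ S | i.val < m}) = {i ∈ S | ∃ k < m, e k = i} :=
      Finset.filter_congr fun i _ => ⟨fun h => ⟨i.val, h, hei i⟩, by
        rintro ⟨k, hk, rfl⟩; rw [hek k hk]; exact hk⟩
    rw [this]
    exact hspread S y
  · calc _ = ∑ f, w f * M m r f := by
          refine Finset.sum_congr rfl fun f _ => ?_
          congr 1
          have h1 : ∀ x ∈ I, (if ∀ i ∈ B x, i.val < m → f i ∈ tgt r x i then
              1 - p ^ #{i ∈ B x | m ≤ i.val} / 2 else 1) =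
              if ∀ i ∈ B x, f i ∈ tgt r x i then (1 / 2 : ℝ) else 1 := by
            intro x hx
            have h2 : ({i ∈ B x | m ≤ i.val}) = ∅ := Finset.filter_eq_empty_iff.2 fun i hi => by
              have := hBm x hx i hi; omega
            have h3 : (∀ i ∈ B x, i.val < m → f i ∈ tgt r x i) ↔ ∀ i ∈ B x, f i ∈ tgt r x i :=
              forall₂_congr fun i hi => by simp [hBm x hx i hi]
            simp only [h3]
            rw [h2]; norm_num
          simp only [hM]
          rw [Finset.prod_congr rfl h1, Finset.prod_ite, Finset.prod_const, Finset.prod_const_one,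
            mul_one]
      _ ≤ M 0 r f0 := hmom r
      _ ≤ _ := by
          simp only [hM]
          calc _ ≤ ∏ x ∈ I, (1 - p ^ b / 2) := by
                have hle : ∀ a, p ^ a ≤ 1 := fun a => pow_le_one₀ hp0 hp1
                refine Finset.prod_le_prod (fun x _ => ?_) fun x hx => ?_
                · have := hle #{i ∈ B x | 0 ≤ i.val}
                  split_ifs
                  · linarith
                  · norm_num
                · rw [if_pos (fun i _ h => absurd h (Nat.not_lt_zero _))]
                  have : p ^ b ≤ p ^ #{i ∈ B x | 0 ≤ i.val} :=
                    pow_le_pow_of_le_one hp0 hp1 ((Finset.card_filter_le _ _).trans (hBb x hx))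
                  linarith
            _ = _ := by rw [Finset.prod_const]

end Hits

section Degrees
open scoped Classical

variable {n : ℕ}

/-- The neighbourhood of a vertex as a finite set. -/
noncomputable def nb (G : SimpleGraph (Fin n)) (v : Fin n) : Finset (Fin n) := {u | G.Adj v u}

theorem mem_nb {G : SimpleGraph (Fin n)} {v u : Fin n} : u ∈ nb G v ↔ G.Adj v u := by simp [nb]

variable {G : SimpleGraph (Fin n)} {δ : ℝ}

theorem card_common_ge (hG : ∀ v, (1 / 2 + δ) * n ≤ #(nb G v)) (a b : Fin n) :
    2 * δ * n ≤ #(nb G a ∩ nb G b) := by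
  have h1 := Finset.card_union_add_card_inter (nb G a) (nb G b)
  have h2 : #(nb G a ∪ nb G b) ≤ n := (Finset.card_le_univ _).trans (by simp)
  have h3 : (#(nb G a) : ℝ) + #(nb G b) ≤ n + #(nb G a ∩ nb G b) := by
    exact_mod_cast (h1 ▸ Nat.add_le_add_right h2 _ :)
  linarith [hG a, hG b]

theorem card_rich_ge (hδ : 0 ≤ δ) (hG : ∀ v, (1 / 2 + δ) * n ≤ #(nb G v)) (p : Fin n)
    {U : Finset (Fin n)} (hU : U.Nonempty) :
    δ * n ≤ #{g ∈ nb G p | δ * #U ≤ #(nb G g ∩ U)} := by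
  have hUpos : (0 : ℝ) < #U := by exact_mod_cast hU.card_pos
  have h1 : ∑ g ∈ nb G p, (#(nb G g ∩ U) : ℝ) = ∑ u ∈ U, (#(nb G p ∩ nb G u) : ℝ) := by
    have h2 := Finset.sum_card_bipartiteAbove_eq_sum_card_bipartiteBelow (s := nb G p) (t := U)
      (fun g u => G.Adj g u)
    have h3 : ∀ g, #(bipartiteAbove (fun g u => G.Adj g u) U g) = #(nb G g ∩ U) := fun g => by
      congr 1; ext u; simp [bipartiteAbove, mem_nb, and_comm]
    have h4 : ∀ u, #(bipartiteBelow (fun g u => G.Adj g u) (nb G p) u) = #(nb G p ∩ nb G u) :=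
      fun u => by
        congr 1; ext g; simp [bipartiteBelow, mem_nb, G.adj_comm]
    simp only [h3, h4] at h2
    exact_mod_cast h2
  have h2 : (#U : ℝ) * (2 * δ * n) ≤ ∑ u ∈ U, (#(nb G p ∩ nb G u) : ℝ) := by
    rw [← nsmul_eq_mul]
    exact Finset.card_nsmul_le_sum _ _ _ fun u _ => card_common_ge hG p u
  have h3 : ∑ g ∈ nb G p, (#(nb G g ∩ U) : ℝ) ≤
      ∑ g ∈ nb G p, ((if δ * #U ≤ #(nb G g ∩ U) then (#U : ℝ) else 0) + δ * #U) := by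
    refine Finset.sum_le_sum fun g _ => ?_
    split_ifs with h
    · have : (#(nb G g ∩ U) : ℝ) ≤ #U := by exact_mod_cast Finset.card_le_card inter_subset_right
      nlinarith
    · linarith
  rw [Finset.sum_add_distrib, Finset.sum_const, ← Finset.sum_filter, Finset.sum_const,
    nsmul_eq_mul, nsmul_eq_mul] at h3
  have h4 : (#(nb G p) : ℝ) ≤ n := by
    exact_mod_cast (Finset.card_le_univ _).trans (by simp)
  have h5 : (#(nb G p) : ℝ) * (δ * #U) ≤ n * (δ * #U) := by gcongr
  have h6 : (#U : ℝ) * (δ * n) ≤ #U * #{g ∈ nb G p | δ * #U ≤ #(nb G g ∩ U)} := by nlinarith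
  exact le_of_mul_le_mul_left h6 hUpos

theorem exists_pow_mul_exp_lt (j : ℕ) {c ε : ℝ} (hc : 0 < c) (hε : 0 < ε) :
    ∃ n₀ : ℕ, ∀ n : ℕ, n₀ ≤ n → (n : ℝ) ^ j * Real.exp (-(c * n)) < ε := by
  have h1 := (Real.tendsto_pow_mul_exp_neg_atTop_nhds_zero j).comp
    (tendsto_natCast_atTop_atTop.const_mul_atTop hc)
  have h2 := h1.eventually (gt_mem_nhds (show 0 < c ^ j * ε by positivity))
  obtain ⟨n₀, hn₀⟩ := Filter.eventually_atTop.1 h2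
  refine ⟨n₀, fun n hn => ?_⟩
  have h3 := hn₀ n hn
  simp only [Function.comp, mul_pow, mul_assoc] at h3
  exact lt_of_mul_lt_mul_left h3 (by positivity)

theorem floor_ge_half {η : ℝ} {n : ℕ} (h : 2 ≤ η * n) : η / 2 * n ≤ (⌊η * n⌋₊ : ℝ) := by
  have := Nat.lt_floor_add_one (η * n)
  linarith

/-- A small reservoir that contains many common neighbours of every pair of vertices. -/
theorem exists_reservoir {δ η : ℝ} (hδ : 0 < δ) (hδ1 : δ ≤ 1) (hη : 0 < η) (hηδ : η ≤ δ)
    (hη1 : η ≤ 1 / 2) :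
    ∃ n₀ : ℕ, ∀ n ≥ n₀, ∀ G : SimpleGraph (Fin n), (∀ v, (1 / 2 + δ) * n ≤ #(nb G v)) →
      ∃ W : Finset (Fin n), #W = ⌊η * n⌋₊ ∧
        ∀ a b, δ / 4 * ⌊η * n⌋₊ ≤ #(W ∩ (nb G a ∩ nb G b)) := by
  obtain ⟨n₁, hn₁⟩ := exists_pow_mul_exp_lt 2 (show 0 < δ / 4 * (η / 2) by positivity) one_pos
  obtain ⟨n₂, hn₂⟩ := exists_nat_gt (2 / η)
  refine ⟨max n₁ (n₂ + 1), fun n hn G hG => ?_⟩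
  have hnn1 : n₁ ≤ n := (le_max_left _ _).trans hn
  have hnn2 : n₂ + 1 ≤ n := (le_max_right _ _).trans hn
  have hn0 : 0 < n := by omega
  have hnr : (0 : ℝ) < n := by exact_mod_cast hn0
  have hηn : 2 ≤ η * n := by
    rw [div_lt_iff₀ hη] at hn₂
    have : (n₂ : ℝ) ≤ n := by exact_mod_cast (by omega : n₂ ≤ n)
    nlinarith
  set w := ⌊η * n⌋₊ with hw
  have hwr : (w : ℝ) ≤ η * n := Nat.floor_le (by positivity)
  have hwhalf := floor_ge_half hηn
  have hwn : w ≤ n := by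
    have : (w : ℝ) ≤ n := by nlinarith
    exact_mod_cast this
  have himg : ∀ (f : Fin n → Fin n) (k : Fin n), (#((Finset.Iio k).image f) : ℝ) ≤ k.val :=
    fun f k => by exact_mod_cast Finset.card_image_le.trans (Fin.card_Iio k).le
  have hIio : ∀ (k : Fin n), k.val < w → (k.val : ℝ) ≤ η * n := fun k hk =>
    le_trans (by exact_mod_cast hk.le) hwr
  have hOptQ : ∀ (f : Fin n → Fin n) (k : Fin n) (Q : Finset (Fin n)),
      (#Q : ℝ) ≤ #{v ∈ Finset.univ \ (Finset.Iio k).image f | v ∈ Q} + k.val := by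
    intro f k Q
    have h1 : Q ⊆ {v ∈ Finset.univ \ (Finset.Iio k).image f | v ∈ Q} ∪ (Finset.Iio k).image f := by
      intro v hv
      by_cases h : v ∈ (Finset.Iio k).image f
      · exact Finset.mem_union_right _ h
      · exact Finset.mem_union_left _ (by simp only [Finset.mem_filter, Finset.mem_sdiff]; exact
          ⟨⟨Finset.mem_univ _, h⟩, hv⟩)
    have h2 : (#Q : ℝ) ≤ #{v ∈ Finset.univ \ (Finset.Iio k).image f | v ∈ Q} +
        #((Finset.Iio k).image f) := by
      exact_mod_cast (Finset.card_le_card h1).trans (Finset.card_union_le _ _)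
    linarith [himg f k]
  obtain ⟨pw, hpw, hsupp, -, hmom⟩ := exists_seq_choice_hits hn0 w hwn (fun _ => ⟨0, hn0⟩)
    (fun k f => Set.InjOn f {i : Fin n | i.val < k})
    (fun k f => Finset.univ \ (Finset.Iio k).image f) (D := 1) one_pos
    (by intro a ha; simp at ha)
    (by
      intro k hk f _
      have h1 := hOptQ f k Finset.univ
      rw [Finset.card_univ, Fintype.card_fin, Finset.filter_true_of_mem (by simp)] at h1
      have := hIio k hk
      nlinarith)
    (by
      intro k hk f hf v hv a ha b hb hab
      simp only [Set.mem_ofPred_eq] at ha hb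
      simp only [Finset.mem_sdiff, Finset.mem_univ, true_and, Finset.mem_image,
        Finset.mem_Iio, not_exists, not_and] at hv
      by_cases hak : a = k <;> by_cases hbk : b = k
      · rw [hak, hbk]
      · rw [hak, Function.update_self, Function.update_of_ne hbk] at hab
        exact absurd hab.symm (hv b (lt_of_le_of_ne (Fin.le_def.2 (by omega)) hbk))
      · rw [hbk, Function.update_self, Function.update_of_ne hak] at hab
        exact absurd hab (hv a (lt_of_le_of_ne (Fin.le_def.2 (by omega)) hak))
      · rw [Function.update_of_ne hak, Function.update_of_ne hbk] at hab
        have hak' : a.val ≠ k.val := fun h => hak (Fin.ext h)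
        have hbk' : b.val ≠ k.val := fun h => hbk (Fin.ext h)
        exact hf (show a.val < k.val by omega) (show b.val < k.val by omega) hab)
    {i | i.val < w} (fun x => {x}) (by
      intro x _ y _ hxy
      simpa [Function.onFun] using hxy) (by simp) (b := 1) (by simp)
    (fun (r : Fin n × Fin n) _ _ => nb G r.1 ∩ nb G r.2) hδ.le hδ1 (by
      intro k hk f _ r x _ _ _
      have h1 := hOptQ f k (nb G r.1 ∩ nb G r.2)
      have h2 := card_common_ge hG r.1 r.2
      have h3 := hIio k hk
      have h4 : (#(Finset.univ \ (Finset.Iio k).image f) : ℝ) ≤ n := by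
        exact_mod_cast (Finset.card_le_univ _).trans (by simp)
      have h5 : η * n ≤ δ * n := by gcongr
      have h6 : δ * #(Finset.univ \ (Finset.Iio k).image f) ≤ δ * n := by gcongr
      convert (by linarith : δ * (#(Finset.univ \ (Finset.Iio k).image f) : ℝ) ≤
        #{v ∈ Finset.univ \ (Finset.Iio k).image f | v ∈ nb G r.1 ∩ nb G r.2}) )
  have hIcard : #({i | i.val < w} : Finset (Fin n)) = w := by
    rcases hwn.lt_or_eq with h | h
    · have : ({i | i.val < w} : Finset (Fin n)) = Finset.Iio ⟨w, h⟩ := by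
        ext i; simp [Fin.lt_def]
      rw [this, Fin.card_Iio]
    · rw [Finset.filter_true_of_mem fun i _ => by rw [h]; exact i.2]; simp [h]
  simp only [hIcard, pow_one, Finset.mem_singleton, forall_eq] at hmom
  have hbad := pr_union hpw.nonneg Finset.univ fun (r : Fin n × Fin n) (f : Fin n → Fin n) =>
    (#{x ∈ ({i | i.val < w} : Finset (Fin n)) | f x ∈ nb G r.1 ∩ nb G r.2} : ℝ) < δ / 2 * w / 2
  have hlt : pr pw (fun f => ∃ r ∈ (Finset.univ : Finset (Fin n × Fin n)),
      (#{x ∈ ({i | i.val < w} : Finset (Fin n)) | f x ∈ nb G r.1 ∩ nb G r.2} : ℝ) <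
        δ / 2 * w / 2) < 1 := by
    refine lt_of_le_of_lt hbad (lt_of_le_of_lt (Finset.sum_le_sum fun r _ =>
      pr_few_hits hpw (fun f => #{x ∈ ({i | i.val < w} : Finset (Fin n)) |
        f x ∈ nb G r.1 ∩ nb G r.2}) (by positivity) (by linarith) (hmom r)) ?_)
    rw [Finset.sum_const, Finset.card_univ, Fintype.card_prod, Fintype.card_fin, nsmul_eq_mul]
    refine lt_of_le_of_lt ?_ (hn₁ n hnn1)
    push_cast
    rw [← pow_two]
    gcongr
    nlinarith
  have hex : ∃ f, pw f ≠ 0 ∧ ¬ ∃ r ∈ (Finset.univ : Finset (Fin n × Fin n)),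
      (#{x ∈ ({i | i.val < w} : Finset (Fin n)) | f x ∈ nb G r.1 ∩ nb G r.2} : ℝ) <
        δ / 2 * w / 2 := by
    by_contra! h
    refine hlt.not_ge ?_
    rw [← hpw.sum_eq, pr]
    refine Finset.sum_le_sum fun f _ => ?_
    by_cases hf : pw f = 0
    · simp [hf]
    · rw [ind_of (h f hf), mul_one]
  obtain ⟨f, hf, hgood⟩ := hex
  have hinj := (hsupp f hf).1
  refine ⟨({i | i.val < w} : Finset (Fin n)).image f, ?_, fun a b => ?_⟩
  · rw [Finset.card_image_of_injOn (by simpa using hinj), hIcard]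
  · push Not at hgood
    have h1 := hgood (a, b) (Finset.mem_univ _)
    have h2 : #{x ∈ ({i | i.val < w} : Finset (Fin n)) | f x ∈ nb G a ∩ nb G b} ≤
        #(({i | i.val < w} : Finset (Fin n)).image f ∩ (nb G a ∩ nb G b)) := by
      refine Finset.card_le_card_of_injOn f (fun x hx => ?_) (hinj.mono fun x hx => ?_)
      · have hx' := Finset.mem_filter.1 (Finset.mem_coe.1 hx)
        exact Finset.mem_coe.2 (Finset.mem_inter.2 ⟨Finset.mem_image_of_mem _ hx'.1, hx'.2⟩)
      · have hx' := Finset.mem_filter.1 (Finset.mem_coe.1 hx)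
        simpa using hx'.1
    calc δ / 4 * (w : ℝ) = δ / 2 * w / 2 := by ring
      _ ≤ _ := h1
      _ ≤ _ := by exact_mod_cast h2

end Degrees

section Body
open scoped Classical

variable {n : ℕ} {G : SimpleGraph (Fin n)} {δ : ℝ}

/-- Many vertices `g` see many vertices `u ∈ N(c)` that in turn see a large part of `Q`. -/
noncomputable def richSet (G : SimpleGraph (Fin n)) (δ : ℝ) (U : Finset (Fin n)) : Finset (Fin n) :=
  {g | δ * #U ≤ #(nb G g ∩ U)}

theorem card_nb_inter_richSet (hδ : 0 ≤ δ) (hG : ∀ v, (1 / 2 + δ) * n ≤ #(nb G v)) (p : Fin n)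
    {U : Finset (Fin n)} (hU : U.Nonempty) : δ * n ≤ #(nb G p ∩ richSet G δ U) := by
  have h : nb G p ∩ richSet G δ U = {g ∈ nb G p | δ * #U ≤ #(nb G g ∩ U)} := by
    ext g; simp [richSet]
  rw [h]
  exact card_rich_ge hδ hG p hU

/-- The positions in the neighbourhood of `x` at which the images must lie in order that `x` can
absorb the vertex `r.2.2` and be moved to a common neighbour of `r.1` and `r.2.1`. -/
noncomputable def blockTarget (G : SimpleGraph (Fin n)) (δ : ℝ) (par : Fin n → Fin n)
    (r : Fin n × Fin n × Fin n) (x k : Fin n) : Finset (Fin n) :=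
  if k = par (par x) then richSet G δ (nb G r.2.2 ∩ richSet G δ (nb G r.1 ∩ nb G r.2.1))
  else if k = par x then nb G r.2.2 ∩ richSet G δ (nb G r.1 ∩ nb G r.2.1)
  else if k = x then nb G r.1 ∩ nb G r.2.1 else nb G r.2.2

theorem card_nb_inter_blockTarget (hn : 0 < n) (hδ : 0 < δ) (hδ1 : δ ≤ 1)
    (hG : ∀ v, (1 / 2 + δ) * n ≤ #(nb G v)) {par : Fin n → Fin n}
    (hpar0 : ∀ k : Fin n, k.val = 0 → par k = k)
    (hpar : ∀ k : Fin n, k.val ≠ 0 → par k < k) (r : Fin n × Fin n × Fin n) {x k : Fin n}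
    (hx : (par x).val ≠ 0) (f : Fin n → Fin n)
    (hf : ∀ j ∈ block par x, j < k → f j ∈ blockTarget G δ par r x j) :
    δ ^ 2 * n ≤ #(nb G (f (par k)) ∩ blockTarget G δ par r x k) := by
  have hnr : (0 : ℝ) < n := by exact_mod_cast hn
  have hδ2 : δ ^ 2 ≤ δ := by nlinarith
  have hQ := card_common_ge hG r.1 r.2.1
  set Q := nb G r.1 ∩ nb G r.2.1 with hQdef
  have hQ0 : Q.Nonempty := by
    have : (0 : ℝ) < #Q := lt_of_lt_of_le (by positivity) hQ
    exact Finset.card_pos.1 (by exact_mod_cast this)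
  have hU := card_nb_inter_richSet hδ.le hG r.2.2 hQ0
  set U := nb G r.2.2 ∩ richSet G δ Q with hUdef
  have hU0 : U.Nonempty := by
    have : (0 : ℝ) < #U := lt_of_lt_of_le (by positivity) hU
    exact Finset.card_pos.1 (by exact_mod_cast this)
  have hx0 : x.val ≠ 0 := fun h => hx (by rw [hpar0 x h]; exact h)
  have hpx := hpar x hx0
  have hppx := hpar _ hx
  have hm1 : par (par x) ∈ block par x := by simp [block]
  have hm2 : par x ∈ block par x := by simp [block]
  by_cases h1 : k = par (par x)
  · have : blockTarget G δ par r x k = richSet G δ U := by rw [blockTarget, if_pos h1]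
    rw [this]
    have := card_nb_inter_richSet hδ.le hG (f (par k)) hU0
    nlinarith
  by_cases h2 : k = par x
  · have h3 := hf _ hm1 (by rw [h2]; exact hppx)
    have h4 : blockTarget G δ par r x (par (par x)) = richSet G δ U := by
      rw [blockTarget, if_pos rfl]
    have h5 : blockTarget G δ par r x k = U := by rw [blockTarget, if_neg h1, if_pos h2]
    rw [h5, h2]
    rw [h4] at h3
    have h6 := (Finset.mem_filter.1 h3).2
    nlinarith
  by_cases h3 : k = x
  · have h4 := hf _ hm2 (by rw [h3]; exact hpx)
    have h5 : blockTarget G δ par r x (par x) = U := by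
      rw [blockTarget, if_neg hppx.ne', if_pos rfl]
    have h6 : blockTarget G δ par r x k = Q := by
      rw [blockTarget, if_neg h1, if_neg h2, if_pos h3]
    rw [h6, h3]
    rw [h5] at h4
    have h7 := (Finset.mem_filter.1 (Finset.mem_inter.1 h4).2).2
    nlinarith
  · have h6 : blockTarget G δ par r x k = nb G r.2.2 := by
      rw [blockTarget, if_neg h1, if_neg h2, if_neg h3]
    rw [h6]
    have := card_common_ge hG (f (par k)) r.2.2
    nlinarith

/-- The random embedding of an initial segment of the tree avoiding a small set `W`, such that
every vertex can be absorbed at many places. -/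
theorem exists_body (hδ : 0 < δ) (hδ1 : δ ≤ 1) {c : ℝ} (hc : 0 < c) :
    ∃ n₀ : ℕ, ∀ n ≥ n₀, ∀ G : SimpleGraph (Fin n), (∀ v, (1 / 2 + δ) * n ≤ #(nb G v)) →
    ∀ (W : Finset (Fin n)) (m : Fin n), (#W + m.val : ℝ) ≤ δ ^ 2 / 2 * n →
    ∀ par : Fin n → Fin n, (∀ k : Fin n, k.val = 0 → par k = k) →
    (∀ k : Fin n, k.val ≠ 0 → par k < k) → (∀ k, m < k → m ≤ par k) →
    ∀ I : Finset (Fin n), (I : Set (Fin n)).PairwiseDisjoint (block par) →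
    (∀ x ∈ I, x < m ∧ (par x).val ≠ 0 ∧ x ≠ par m ∧ #({c | par c = x} : Finset (Fin n)) ≤ 1) →
    c * n ≤ #I →
    ∃ w : (Fin n → Fin n) → ℝ, IsProb w ∧
      (∀ f, w f ≠ 0 → Set.InjOn f {i | i < m} ∧ (∀ i < m, f i ∉ W) ∧
        (∀ i < m, i.val ≠ 0 → G.Adj (f (par i)) (f i)) ∧
        ∀ a b d, δ ^ 8 * c / 64 * n ≤ #{x ∈ I | f x ∈ nb G a ∩ nb G b ∧ f (par x) ∈ nb G d ∧
          ∀ y, par y = x → f y ∈ nb G d}) ∧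
      ∀ (S : Finset (Fin n)) (y : Fin n → Fin n), pr w (fun f => ∀ i ∈ S, f i = y i) ≤
        2 * (2 / n) ^ #{i ∈ S | i < m} := by
  obtain ⟨n₁, hn₁⟩ := exists_pow_mul_exp_lt 3 (c := δ ^ 8 * c / 64) (by positivity)
    (ε := 1 / 2) (by norm_num)
  refine ⟨max n₁ 1, fun n hn G hG W m hWm par hpar0 hpar hcross I hI hIp hIc => ?_⟩
  have hnn1 : n₁ ≤ n := le_trans (le_max_left _ _) hn
  have hn0 : 0 < n := lt_of_lt_of_le one_pos (le_trans (le_max_right _ _) hn)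
  have hnr : (0 : ℝ) < n := by exact_mod_cast hn0
  set Opt : Fin n → (Fin n → Fin n) → Finset (Fin n) := fun k f =>
    nb G (f (par k)) \ (W ∪ (Finset.Iio k).image f) with hOpt
  have hOptQ : ∀ (f : Fin n → Fin n) (k : Fin n), k.val < m.val → ∀ Q : Finset (Fin n),
      (#(nb G (f (par k)) ∩ Q) : ℝ) ≤ #{v ∈ Opt k f | v ∈ Q} + δ ^ 2 / 2 * n := by
    intro f k hk Q
    have h1 : nb G (f (par k)) ∩ Q ⊆ {v ∈ Opt k f | v ∈ Q} ∪ (W ∪ (Finset.Iio k).image f) := by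
      intro v hv
      rw [Finset.mem_inter] at hv
      by_cases h : v ∈ W ∪ (Finset.Iio k).image f
      · exact Finset.mem_union_right _ h
      · exact Finset.mem_union_left _ (Finset.mem_filter.2 ⟨Finset.mem_sdiff.2 ⟨hv.1, h⟩, hv.2⟩)
    have h2 : #(nb G (f (par k)) ∩ Q) ≤ #{v ∈ Opt k f | v ∈ Q} + (#W + m.val) := by
      refine (Finset.card_le_card h1).trans ((Finset.card_union_le _ _).trans ?_)
      refine Nat.add_le_add_left ((Finset.card_union_le _ _).trans ?_) _
      refine Nat.add_le_add_left (Finset.card_image_le.trans ?_) _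
      rw [Fin.card_Iio]; exact hk.le
    have h3 : (#(nb G (f (par k)) ∩ Q) : ℝ) ≤ #{v ∈ Opt k f | v ∈ Q} + (#W + m.val) := by
      exact_mod_cast h2
    linarith
  obtain ⟨w, hw, hsupp, hspread, hmom⟩ := exists_seq_choice_hits hn0 m.val m.2.le
    (fun _ => ⟨0, hn0⟩)
    (fun k f => Set.InjOn f {i : Fin n | i.val < k} ∧ (∀ i : Fin n, i.val < k → f i ∉ W) ∧
      ∀ i : Fin n, i.val < k → i.val ≠ 0 → G.Adj (f (par i)) (f i))
    Opt (D := n / 2) (by positivity) (by simp)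
    (by
      intro k hk f _
      have h1 := hOptQ f k hk Finset.univ
      rw [Finset.inter_univ, Finset.filter_true_of_mem (by simp)] at h1
      nlinarith [hG (f (par k))])
    (by
      rintro k hk f ⟨hf1, hf2, hf3⟩ v hv
      simp only [hOpt, Finset.mem_sdiff, Finset.mem_union, Finset.mem_image, Finset.mem_Iio,
        not_or, not_exists, not_and] at hv
      have hlt : ∀ i : Fin n, i.val < k.val + 1 → i ≠ k → i.val < k.val := fun i hi hik => by
        have : i.val ≠ k.val := fun h => hik (Fin.ext h)
        omega
      refine ⟨fun a ha b hb hab => ?_, fun i hi => ?_, fun i hi hi0 => ?_⟩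
      · simp only [Set.mem_ofPred_eq] at ha hb
        by_cases hak : a = k <;> by_cases hbk : b = k
        · rw [hak, hbk]
        · rw [hak, Function.update_self, Function.update_of_ne hbk] at hab
          exact absurd hab.symm (hv.2.2 b (Fin.lt_def.2 (hlt b hb hbk)))
        · rw [hbk, Function.update_self, Function.update_of_ne hak] at hab
          exact absurd hab (hv.2.2 a (Fin.lt_def.2 (hlt a ha hak)))
        · rw [Function.update_of_ne hak, Function.update_of_ne hbk] at hab
          exact hf1 (hlt a ha hak) (hlt b hb hbk) hab
      · by_cases hik : i = k
        · rw [hik, Function.update_self]; exact hv.2.1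
        · rw [Function.update_of_ne hik]; exact hf2 i (hlt i hi hik)
      · by_cases hik : i = k
        · rw [hik] at hi0 ⊢
          rw [Function.update_self, Function.update_of_ne (hpar k hi0).ne]
          exact mem_nb.1 hv.1
        · have h1 := hlt i hi hik
          have h2 : par i ≠ k := fun h => by
            have := Fin.lt_def.1 (hpar i hi0)
            rw [h] at this; omega
          rw [Function.update_of_ne hik, Function.update_of_ne h2]
          exact hf3 i h1 hi0)
    I (block par) hI
    (by
      intro x hx i hi
      obtain ⟨h1, h2, h3, h4⟩ := hIp x hx
      have hx0 : x.val ≠ 0 := fun h => h2 (by rw [hpar0 x h]; exact h)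
      have h5 := Fin.lt_def.1 (hpar x hx0)
      have h6 := Fin.lt_def.1 (hpar _ h2)
      have h7 := Fin.lt_def.1 h1
      simp only [block, Finset.mem_union, Finset.mem_insert, Finset.mem_singleton,
        Finset.mem_filter, Finset.mem_univ, true_and] at hi
      rcases hi with (hi | hi | hi) | hi
      · rw [hi]; omega
      · rw [hi]; omega
      · rw [hi]; omega
      · by_contra h
        rcases (not_lt.1 h).eq_or_lt with h8 | h8
        · exact h3 (by rw [Fin.ext h8, hi])
        · have := Fin.le_def.1 (hcross i (Fin.lt_def.2 h8))
          rw [hi] at this; omega)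
    (b := 4)
    (by
      intro x hx
      have h1 : #({par (par x), par x, x} : Finset (Fin n)) ≤ 3 := Finset.card_le_three
      have := Finset.card_union_le {par (par x), par x, x} ({c | par c = x} : Finset (Fin n))
      have h2 := (hIp x hx).2.2.2
      rw [block]; omega)
    (blockTarget G δ par) (p := δ ^ 2 / 2) (by positivity) (by nlinarith)
    (by
      intro k hk f _ r x hx _ hf
      have h1 := card_nb_inter_blockTarget hn0 hδ hδ1 hG hpar0 hpar r (hIp x hx).2.1 f hf
      have h2 := hOptQ f k hk (blockTarget G δ par r x k)
      have h3 : (#(Opt k f) : ℝ) ≤ n := by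
        exact_mod_cast (Finset.card_le_univ _).trans (by simp)
      have h4 : δ ^ 2 / 2 * #(Opt k f) ≤ δ ^ 2 / 2 * n := by gcongr
      convert (by linarith : δ ^ 2 / 2 * (#(Opt k f) : ℝ) ≤
        #{v ∈ Opt k f | v ∈ blockTarget G δ par r x k}))
  obtain ⟨A, hA⟩ : ∃ A : Fin n × Fin n × Fin n → (Fin n → Fin n) → Finset (Fin n), ∀ r f,
    A r f = {x ∈ I | ∀ i ∈ block par x, f i ∈ blockTarget G δ par r x i} := ⟨_, fun _ _ => rfl⟩
  replace hmom : ∀ r, ∑ f, w f * (1 / 2 : ℝ) ^ #(A r f) ≤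
      (1 - (δ ^ 2 / 2) ^ 4 / 2) ^ #I := fun r => by
    simp only [hA]; convert hmom r
  have hbad := pr_union hw.nonneg Finset.univ fun (r : Fin n × Fin n × Fin n) (f : Fin n → Fin n) =>
    (#(A r f) : ℝ) < (δ ^ 2 / 2) ^ 4 / 2 * #I / 2
  have hp4 : (δ ^ 2 / 2) ^ 4 / 2 ≤ 1 := by
    have : (δ ^ 2 / 2) ^ 4 ≤ 1 := pow_le_one₀ (by positivity) (by nlinarith)
    linarith
  have hlt : pr w (fun f => ∃ r ∈ (Finset.univ : Finset (Fin n × Fin n × Fin n)),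
      (#(A r f) : ℝ) < (δ ^ 2 / 2) ^ 4 / 2 * #I / 2) ≤ 1 / 2 := by
    refine hbad.trans ((Finset.sum_le_sum fun r _ =>
      pr_few_hits hw (fun f => #(A r f)) (by positivity) hp4 (hmom r)).trans ?_)
    rw [Finset.sum_const, Finset.card_univ, Fintype.card_prod, Fintype.card_prod,
      Fintype.card_fin, nsmul_eq_mul]
    refine le_trans ?_ (hn₁ n hnn1).le
    push_cast
    have h1 : (n : ℝ) * (n * n) = n ^ 3 := by ring
    rw [h1]
    gcongr
    have h2 : δ ^ 8 * (c * n) ≤ δ ^ 8 * #I := by gcongr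
    nlinarith
  have hhalf := pr_compl hw fun f => ∃ r ∈ (Finset.univ : Finset (Fin n × Fin n × Fin n)),
      (#(A r f) : ℝ) < (δ ^ 2 / 2) ^ 4 / 2 * #I / 2
  obtain ⟨w', hw', hle, hsupp'⟩ := hw.exists_cond (E := fun f => ¬ ∃ r ∈
    (Finset.univ : Finset (Fin n × Fin n × Fin n)),
      (#(A r f) : ℝ) < (δ ^ 2 / 2) ^ 4 / 2 * #I / 2) (by linarith)
  refine ⟨w', hw', fun f hf => ?_, fun S y => ?_⟩
  · obtain ⟨h1, h2⟩ := hsupp' f hf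
    obtain ⟨⟨h3, h4, h5⟩, -⟩ := hsupp f h1
    refine ⟨fun a ha b hb => h3 (Fin.lt_def.1 ha) (Fin.lt_def.1 hb),
      fun i hi => h4 i (Fin.lt_def.1 hi), fun i hi => h5 i (Fin.lt_def.1 hi), fun a b d => ?_⟩
    push Not at h2
    have h6 := h2 (a, b, d) (Finset.mem_univ _)
    have h7 : #(A (a, b, d) f) ≤ #{x ∈ I | f x ∈ nb G a ∩ nb G b ∧ f (par x) ∈ nb G d ∧
          ∀ y, par y = x → f y ∈ nb G d} := by
      refine Finset.card_le_card fun x hx => ?_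
      obtain ⟨hxI, hxt⟩ := Finset.mem_filter.1 (hA _ _ ▸ hx)
      obtain ⟨h1, h2, -, -⟩ := hIp x hxI
      have hx0 : x.val ≠ 0 := fun h => h2 (by rw [hpar0 x h]; exact h)
      have hpx := hpar x hx0
      have hppx := hpar _ h2
      refine Finset.mem_filter.2 ⟨hxI, ?_, ?_, fun y hy => ?_⟩
      · have := hxt x (by simp [block])
        rwa [blockTarget, if_neg (hppx.trans hpx).ne', if_neg hpx.ne', if_pos rfl] at this
      · have := hxt (par x) (by simp [block])
        rw [blockTarget, if_neg hppx.ne', if_pos rfl] at this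
        exact (Finset.mem_inter.1 this).1
      · have := hxt y (by simp [block, hy])
        have hy0 : y.val ≠ 0 := fun h => hx0 (by rw [← hy, hpar0 y h]; exact h)
        have hxy := hpar y hy0
        rw [hy] at hxy
        rwa [blockTarget, if_neg (hppx.trans (hpx.trans hxy)).ne', if_neg (hpx.trans hxy).ne',
          if_neg hxy.ne'] at this
    have h8 : (#(A (a, b, d) f) : ℝ) ≤ _ := Nat.cast_le.2 h7
    have h9 : δ ^ 8 * (c * n) ≤ δ ^ 8 * #I := by gcongr
    nlinarith
  · refine (pr_le_mul hle _).trans ?_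
    have h1 := hspread S y
    rw [one_div_div] at h1
    have h2 : #{i ∈ S | i.val < m.val} = #{i ∈ S | i < m} := rfl
    rw [h2] at h1
    gcongr

end Body

section Matchings
open scoped Classical

variable {n : ℕ} {G : SimpleGraph (Fin n)} {δ : ℝ}

theorem sum_prod_piFinset_ite {ι V : Type*} [Fintype ι] [DecidableEq ι] (C : Finset ι)
    (U : Finset V) (v : V) (h : V → ℝ) :
    ∑ y ∈ Fintype.piFinset (fun i => if i ∈ C then U else {v}), ∏ i ∈ C, h (y i) =
      (∑ u ∈ U, h u) ^ #C := by
  have h1 : ∀ y : ι → V, ∏ i ∈ C, h (y i) = ∏ i, if i ∈ C then h (y i) else 1 := fun y => by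
    rw [Finset.prod_ite_mem, Finset.univ_inter]
  rw [Finset.sum_congr rfl fun y _ => h1 y]
  rw [← Finset.prod_univ_sum (fun i => if i ∈ C then U else {v})
    (fun i u => if i ∈ C then h u else 1)]
  have h2 : ∀ i, ∑ u ∈ (if i ∈ C then U else {v}), (if i ∈ C then h u else 1) =
      if i ∈ C then ∑ u ∈ U, h u else 1 := fun i => by
    by_cases hi : i ∈ C <;> simp [hi]
  rw [Finset.prod_congr rfl fun i _ => h2 i, Finset.prod_ite_mem, Finset.univ_inter,
    Finset.prod_const]

theorem card_few_hits_le (hδ : 0 < δ) (hδ1 : δ < 1) {U A : Finset (Fin n)} (hA : A ⊆ U)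
    (hUA : (1 / 2 + δ) * #U ≤ #A) (C : Finset (Fin n)) (v : Fin n) :
    (#{y ∈ Fintype.piFinset (fun i => if i ∈ C then U else {v}) |
      2 * #{i ∈ C | y i ∈ A} ≤ #C} : ℝ) ≤ ((1 - δ ^ 2 / 2) * #U) ^ #C := by
  have hs : 0 < 1 - δ := by linarith
  set P := Fintype.piFinset (fun i => if i ∈ C then U else {v}) with hP
  have h1 : ∑ y ∈ P, ∏ i ∈ C, (if y i ∈ A then (1 - δ) ^ 2 else 1) =
      (∑ u ∈ U, if u ∈ A then (1 - δ) ^ 2 else 1) ^ #C :=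
    sum_prod_piFinset_ite C U v fun u => if u ∈ A then (1 - δ) ^ 2 else 1
  clear_value P
  have h2 : ∑ u ∈ U, (if u ∈ A then (1 - δ) ^ 2 else 1) = #U - #A * (1 - (1 - δ) ^ 2) := by
    have h3 : ∀ u ∈ U, (if u ∈ A then (1 - δ) ^ 2 else 1) =
        1 - if u ∈ A then 1 - (1 - δ) ^ 2 else 0 := fun u _ => by split_ifs <;> ring
    rw [Finset.sum_congr rfl h3, Finset.sum_sub_distrib, Finset.sum_ite_mem,
      Finset.inter_eq_right.2 hA]
    simp only [Finset.sum_const, nsmul_eq_mul, mul_one]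
  have h4 : ∑ u ∈ U, (if u ∈ A then (1 - δ) ^ 2 else 1) ≤ (1 - δ) * ((1 - δ ^ 2 / 2) * #U) := by
    rw [h2]
    have h5 : (1 / 2 + δ) * #U * (1 - (1 - δ) ^ 2) ≤ #A * (1 - (1 - δ) ^ 2) := by
      refine mul_le_mul_of_nonneg_right hUA (by nlinarith)
    have h6 : (1 : ℝ) - (1 / 2 + δ) * (1 - (1 - δ) ^ 2) ≤ (1 - δ) * (1 - δ ^ 2 / 2) := by
      nlinarith [pow_pos hδ 2, mul_pos hδ (pow_pos hδ 2)]
    have h7 : (0 : ℝ) ≤ #U := by positivity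
    nlinarith
  have h5 : (0 : ℝ) ≤ ∑ u ∈ U, (if u ∈ A then (1 - δ) ^ 2 else 1) :=
    Finset.sum_nonneg fun u _ => by split_ifs <;> positivity
  have h6 : (#{y ∈ P | 2 * #{i ∈ C | y i ∈ A} ≤ #C} : ℝ) * (1 - δ) ^ #C ≤
      (1 - δ) ^ #C * ((1 - δ ^ 2 / 2) * #U) ^ #C := by
    rw [← mul_pow]
    refine le_trans ?_ (pow_le_pow_left₀ h5 h4 _)
    have h7 : ∀ y ∈ P.filter (fun y => 2 * #{i ∈ C | y i ∈ A} ≤ #C),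
        (1 - δ) ^ #C ≤ ∏ i ∈ C, (if y i ∈ A then (1 - δ) ^ 2 else 1) := fun y hy => by
      rw [← Finset.prod_filter, Finset.prod_const, ← pow_mul]
      exact pow_le_pow_of_le_one hs.le (by linarith) (Finset.mem_filter.1 hy).2
    have h8 := Finset.card_nsmul_le_sum _ _ _ h7
    rw [nsmul_eq_mul] at h8
    rw [← h1]
    exact h8.trans (Finset.sum_le_sum_of_subset_of_nonneg (Finset.filter_subset _ _) fun y _ _ =>
        Finset.prod_nonneg fun i _ => by split_ifs <;> positivity)
  rw [mul_comm] at h6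
  exact le_of_mul_le_mul_left h6 (by positivity)

/-- A vertex has more than half of the possible neighbours in a random set, with probability
exponentially close to one. -/
theorem pr_few_nbrs (hδ : 0 < δ) (hδ1 : δ < 1) {U : Finset (Fin n)} (hU : 0 < #U)
    (hG : ∀ v, (1 / 2 + δ) * #U ≤ #(nb G v ∩ U)) {w : (Fin n → Fin n) → ℝ} (hw : IsProb w)
    {x : Fin n} {C : Finset (Fin n)} (hx : x ∉ C)
    (hwU : ∀ σ, w σ ≠ 0 → ∀ i ∈ insert x C, σ i ∈ U)
    (hsp : ∀ y : Fin n → Fin n, pr w (fun σ => ∀ i ∈ insert x C, σ i = y i) ≤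
      2 / (#U : ℝ) ^ (#C + 1)) :
    pr w (fun σ => 2 * #{i ∈ C | σ i ∈ nb G (σ x)} ≤ #C) ≤ 2 * (1 - δ ^ 2 / 2) ^ #C := by
  have hUr : (0 : ℝ) < #U := by exact_mod_cast hU
  set Y : Fin n → Finset (Fin n → Fin n) := fun v =>
    {y ∈ Fintype.piFinset (fun i => if i ∈ C then U else {v}) |
      2 * #{i ∈ C | y i ∈ nb G v ∩ U} ≤ #C} with hY
  calc _ ≤ pr w (fun σ => ∃ v ∈ U, ∃ y ∈ Y v, ∀ i ∈ insert x C, σ i = y i) := by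
        refine pr_mono hw.nonneg fun σ hσ hb => ?_
        have h1 := hwU σ hσ
        refine ⟨σ x, h1 x (Finset.mem_insert_self _ _), fun i => if i ∈ C then σ i else σ x,
          Finset.mem_filter.2 ⟨Fintype.mem_piFinset.2 fun i => ?_, ?_⟩, fun i hi => ?_⟩
        · by_cases hi : i ∈ C
          · simpa [hi] using h1 i (Finset.mem_insert_of_mem hi)
          · simp [hi]
        · convert hb using 3
          refine Finset.filter_congr fun i hi => ?_
          simp [hi, h1 i (Finset.mem_insert_of_mem hi)]
        · rcases Finset.mem_insert.1 hi with hi | hi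
          · simp only [hi, if_neg hx]
          · simp only [if_pos hi]
    _ ≤ ∑ v ∈ U, ∑ y ∈ Y v, pr w (fun σ => ∀ i ∈ insert x C, σ i = y i) :=
        (pr_union hw.nonneg _ _).trans (Finset.sum_le_sum fun v _ => pr_union hw.nonneg _ _)
    _ ≤ ∑ v ∈ U, ∑ y ∈ Y v, 2 / (#U : ℝ) ^ (#C + 1) :=
        Finset.sum_le_sum fun v _ => Finset.sum_le_sum fun y _ => hsp y
    _ ≤ ∑ v ∈ U, ((1 - δ ^ 2 / 2) * #U) ^ #C * (2 / (#U : ℝ) ^ (#C + 1)) := by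
        refine Finset.sum_le_sum fun v _ => ?_
        rw [Finset.sum_const, nsmul_eq_mul]
        refine mul_le_mul_of_nonneg_right ?_ (by positivity)
        exact card_few_hits_le hδ hδ1 Finset.inter_subset_right (hG v) C v
    _ = _ := by
        rw [Finset.sum_const, nsmul_eq_mul, mul_pow, pow_succ (#U : ℝ)]
        generalize (1 - δ ^ 2 / 2) ^ #C = z
        field_simp

theorem exists_matching_of_half {C C' : Finset (Fin n)} {q : ℕ} (hC : #C = q) (hC' : #C' = q)
    {σ : Fin n → Fin n} (h1 : ∀ x ∈ C, q ≤ 2 * #{i ∈ C' | σ i ∈ nb G (σ x)})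
    (h2 : ∀ x ∈ C', q ≤ 2 * #{i ∈ C | σ i ∈ nb G (σ x)}) :
    ∃ ρ : Fin n → Fin n, Set.InjOn ρ C ∧ ∀ x ∈ C, ρ x ∈ C' ∧ G.Adj (σ x) (σ (ρ x)) := by
  set t : C → Finset (Fin n) := fun x => {i ∈ C' | σ i ∈ nb G (σ x)} with ht
  have hall : ∀ S : Finset C, #S ≤ #(S.biUnion t) := by
    intro S
    by_contra! hlt
    have hSq : #S ≤ q := by
      rw [← hC, ← Fintype.card_coe C]; exact Finset.card_le_univ _
    have hsub : S.biUnion t ⊆ C' := Finset.biUnion_subset.2 fun x _ => Finset.filter_subset _ _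
    obtain ⟨b, hb, hbn⟩ : ∃ b ∈ C', b ∉ S.biUnion t := by
      by_contra! h
      have := Finset.card_le_card (show C' ⊆ S.biUnion t from h)
      omega
    have h3 : #{i ∈ C | σ i ∈ nb G (σ b)} + #(S.map (Function.Embedding.subtype _)) ≤ #C := by
      rw [← Finset.card_union_of_disjoint]
      · refine Finset.card_le_card (Finset.union_subset (Finset.filter_subset _ _) fun i hi => ?_)
        obtain ⟨s, -, rfl⟩ := Finset.mem_map.1 hi
        exact s.2
      · rw [Finset.disjoint_right]
        intro i hi hi'
        obtain ⟨s, hs, rfl⟩ := Finset.mem_map.1 hi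
        refine hbn (Finset.mem_biUnion.2 ⟨s, hs, Finset.mem_filter.2 ⟨hb, ?_⟩⟩)
        exact mem_nb.2 (mem_nb.1 (Finset.mem_filter.1 hi').2).symm
    rw [Finset.card_map] at h3
    obtain ⟨s, hs⟩ : S.Nonempty := Finset.card_pos.1 (by omega)
    have h4 := Finset.card_le_card (Finset.subset_biUnion_of_mem t hs)
    have h5 : q ≤ 2 * #(t s) := h1 s s.2
    have h6 := h2 b hb
    omega
  obtain ⟨f, hf, hft⟩ := (Finset.all_card_le_biUnion_card_iff_exists_injective t).1 hall
  refine ⟨fun x => if h : x ∈ C then f ⟨x, h⟩ else x, fun x hx y hy hxy => ?_, fun x hx => ?_⟩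
  · rw [Finset.mem_coe] at hx hy
    simp only [hx, hy, dif_pos] at hxy
    simpa using hf hxy
  · have := Finset.mem_filter.1 (hft ⟨x, hx⟩)
    simp only [hx, dif_pos]
    exact ⟨this.1, mem_nb.1 this.2⟩

/-- Two disjoint random sets of the same size are matched with probability exponentially close
to one. -/
theorem pr_no_matching (hδ : 0 < δ) (hδ1 : δ < 1) {U : Finset (Fin n)} (hU : 0 < #U)
    (hG : ∀ v, (1 / 2 + δ) * #U ≤ #(nb G v ∩ U)) {w : (Fin n → Fin n) → ℝ} (hw : IsProb w)
    {C C' : Finset (Fin n)} {q : ℕ} (hC : #C = q) (hC' : #C' = q) (hd : Disjoint C C')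
    (hwU : ∀ σ, w σ ≠ 0 → ∀ i ∈ C ∪ C', σ i ∈ U)
    (hsp : ∀ S ⊆ C ∪ C', #S = q + 1 → ∀ y : Fin n → Fin n, pr w (fun σ => ∀ i ∈ S, σ i = y i) ≤
      2 / (#U : ℝ) ^ (q + 1)) :
    pr w (fun σ => ¬ ∃ ρ : Fin n → Fin n, Set.InjOn ρ C ∧
      ∀ x ∈ C, ρ x ∈ C' ∧ G.Adj (σ x) (σ (ρ x))) ≤ 4 * q * (1 - δ ^ 2 / 2) ^ q := by
  have key : ∀ A B : Finset (Fin n), #A = q → #B = q → Disjoint A B → A ∪ B ⊆ C ∪ C' →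
      ∀ x ∈ A, pr w (fun σ => 2 * #{i ∈ B | σ i ∈ nb G (σ x)} ≤ q) ≤
        2 * (1 - δ ^ 2 / 2) ^ q := by
    intro A B hA hB hAB hsub x hx
    have hxB := Finset.disjoint_left.1 hAB hx
    have h1 : insert x B ⊆ C ∪ C' := fun i hi => hsub (by
      rcases Finset.mem_insert.1 hi with rfl | h
      · exact Finset.mem_union_left _ hx
      · exact Finset.mem_union_right _ h)
    have := pr_few_nbrs hδ hδ1 hU hG hw hxB (fun σ hσ i hi => hwU σ hσ i (h1 hi)) (fun y => by
      rw [hB]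
      exact hsp _ h1 (by rw [Finset.card_insert_of_notMem hxB, hB]) y)
    rwa [hB] at this
  calc _ ≤ pr w (fun σ => ∃ b ∈ (Finset.univ : Finset Bool), (∃ x ∈ cond b C C',
        2 * #{i ∈ cond b C' C | σ i ∈ nb G (σ x)} ≤ q)) := by
        refine pr_mono hw.nonneg fun σ _ hσ => ?_
        by_contra! h
        refine hσ (exists_matching_of_half hC hC' (fun x hx => ?_) fun x hx => ?_)
        · exact (h true (Finset.mem_univ _) x hx).le
        · exact (h false (Finset.mem_univ _) x hx).le
    _ ≤ ∑ b : Bool, ∑ x ∈ cond b C C', pr w (fun σ =>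
        2 * #{i ∈ cond b C' C | σ i ∈ nb G (σ x)} ≤ q) :=
        (pr_union hw.nonneg _ _).trans (Finset.sum_le_sum fun b _ => pr_union hw.nonneg _ _)
    _ ≤ ∑ b : Bool, ∑ x ∈ cond b C C', 2 * (1 - δ ^ 2 / 2) ^ q := by
        refine Finset.sum_le_sum fun b _ => Finset.sum_le_sum fun x hx => ?_
        cases b
        · exact key C' C hC' hC hd.symm (by rw [Finset.union_comm]) x hx
        · exact key C C' hC hC' hd subset_rfl x hx
    _ = _ := by
        rw [Fintype.sum_bool]
        simp [hC, hC']
        ring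

end Matchings

section Bulk
open scoped Classical

/-- The image of a probability mass function. -/
theorem exists_map {α β : Type*} [Fintype α] [Fintype β] {w : α → ℝ} (hw : IsProb w)
    (F : α → β) : ∃ w' : β → ℝ, IsProb w' ∧ (∀ b, w' b ≠ 0 → ∃ a, w a ≠ 0 ∧ F a = b) ∧
      ∀ E : β → Prop, pr w' E = pr w fun a => E (F a) := by
  have hsum : ∀ a (h : β → ℝ), ∑ b, ind (F a = b) * h b = h (F a) := fun a h => by
    rw [Finset.sum_eq_single (F a) (fun b _ hb => by rw [ind_not hb.symm, zero_mul]) (by simp),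
      ind_of rfl, one_mul]
  refine ⟨mix w fun a b => ind (F a = b), hw.mix fun a _ => ⟨fun b => ind_nonneg _, ?_⟩,
    fun b hb => ?_, fun E => ?_⟩
  · simpa using hsum a fun _ => 1
  · obtain ⟨a, ha, hab⟩ := mix_ne_zero hb
    exact ⟨a, ha, by_contra fun h => hab (ind_not h)⟩
  · rw [pr_mix, pr]
    exact Finset.sum_congr rfl fun a _ => by rw [pr, hsum]

variable {n : ℕ}

/-- A decomposition of a part `X` of the tree into groups of isomorphic pieces; corresponding
vertices of the `q` pieces in a group form a cell. -/
structure IsBundling (par : Fin n → Fin n) (m : Fin n) (L X : Finset (Fin n))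
    (grp : Fin n → Finset ℕ × ℕ) (cell : Fin n → ℕ) (q : ℕ) : Prop where
  lt : ∀ x ∈ X, m < x ∧ x ∉ L
  mem_iff : ∀ k, m < k → k ∉ L → par k ∉ L → (k ∈ X ↔ par k ∈ X)
  card_cell : ∀ x ∈ X, #{y ∈ X | grp y = grp x ∧ cell y = cell x} = q
  cell_par : ∀ x ∈ X, ∀ y ∈ X, grp x = grp y → cell x = cell y → par x ∉ L → par y ∉ L ∧
    cell (par x) = cell (par y) ∧ (par x = par y → x = y)
  grp_par : ∀ x ∈ X, par x ∉ L → grp x = grp (par x)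

/-- The vertices of `X` in the same cell as `x`. -/
noncomputable def cellOf (X : Finset (Fin n)) (grp : Fin n → Finset ℕ × ℕ) (cell : Fin n → ℕ)
    (x : Fin n) : Finset (Fin n) := {y ∈ X | grp y = grp x ∧ cell y = cell x}

/-- The images of `A` can be matched into the images of `B` inside `G`. -/
def Matched (G : SimpleGraph (Fin n)) (σ : Fin n → Fin n) (A B : Finset (Fin n)) : Prop :=
  ∃ ρ : Fin n → Fin n, Set.InjOn ρ A ∧ ∀ x ∈ A, ρ x ∈ B ∧ G.Adj (σ x) (σ (ρ x))

variable {par : Fin n → Fin n} {m : Fin n} {L X : Finset (Fin n)}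
  {grp : Fin n → Finset ℕ × ℕ} {cell : Fin n → ℕ} {q : ℕ} {G : SimpleGraph (Fin n)}

theorem mem_cellOf {x y : Fin n} :
    y ∈ cellOf X grp cell x ↔ y ∈ X ∧ grp y = grp x ∧ cell y = cell x := Finset.mem_filter

theorem cellOf_congr {x y : Fin n} (h1 : grp x = grp y) (h2 : cell x = cell y) :
    cellOf X grp cell x = cellOf X grp cell y := by rw [cellOf, cellOf, h1, h2]

theorem IsBundling.par_mem (hB : IsBundling par m L X grp cell q) {x : Fin n} (hx : x ∈ X)
    (hpx : par x ∉ L) : par x ∈ X :=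
  (hB.mem_iff x (hB.lt x hx).1 (hB.lt x hx).2 hpx).1 hx

theorem IsBundling.cell_par_ne (hB : IsBundling par m L X grp cell q)
    (hpar : ∀ k : Fin n, k.val ≠ 0 → par k < k) :
    ∀ x ∈ X, par x ∉ L → cell (par x) ≠ cell x := by
  intro x
  induction x using WellFoundedLT.induction with
  | ind x ih =>
    intro hx hpx h
    have h1 := hB.par_mem hx hpx
    obtain ⟨h2, h3, -⟩ := hB.cell_par x hx _ h1 (hB.grp_par x hx hpx) h.symm hpx
    have := Fin.lt_def.1 (hB.lt x hx).1
    exact ih _ (hpar x (by omega)) h1 h2 h3.symm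

/-- Whether one of the matchings needed for the group of `x` is missing. -/
def IsBad (G : SimpleGraph (Fin n)) (σ par : Fin n → Fin n) (L X : Finset (Fin n))
    (grp : Fin n → Finset ℕ × ℕ) (cell : Fin n → ℕ) (x : Fin n) : Prop :=
  ∃ y ∈ X, grp y = grp x ∧ par y ∉ L ∧
    ¬ Matched G σ (cellOf X grp cell (par y)) (cellOf X grp cell y)

theorem isBad_congr {σ : Fin n → Fin n} {x y : Fin n} (h : grp x = grp y) :
    IsBad G σ par L X grp cell x ↔ IsBad G σ par L X grp cell y := by
  rw [IsBad, IsBad, h]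

theorem IsBundling.exists_rearrangement (hB : IsBundling par m L X grp cell q)
    (hpar : ∀ k : Fin n, k.val ≠ 0 → par k < k) (σ : Fin n → Fin n) :
    ∃ τ : Fin n → Fin n, (∀ x ∈ X, τ x ∈ cellOf X grp cell x) ∧ Set.InjOn τ X ∧
      ∀ x ∈ X, par x ∉ L → ¬ IsBad G σ par L X grp cell x → G.Adj (σ (τ (par x))) (σ (τ x)) := by
  have hR : ∀ A B : Finset (Fin n), ∃ ρ : Fin n → Fin n, Matched G σ A B →
      Set.InjOn ρ A ∧ ∀ x ∈ A, ρ x ∈ B ∧ G.Adj (σ x) (σ (ρ x)) := fun A B => by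
    by_cases h : Matched G σ A B
    · obtain ⟨ρ, hρ⟩ := h
      exact ⟨ρ, fun _ => hρ⟩
    · exact ⟨id, fun h' => absurd h' h⟩
  choose R hR using hR
  obtain ⟨τ, -, hτ⟩ := exists_par_rec hpar m m fun k t =>
    if par k ∈ L ∨ IsBad G σ par L X grp cell k then k else
      R (cellOf X grp cell (par k)) (cellOf X grp cell k) t
  have hbase : ∀ x ∈ X, par x ∈ L ∨ IsBad G σ par L X grp cell x → τ x = x := fun x hx h => by
    rw [hτ x (hB.lt x hx).1, if_pos h]
  have hrec : ∀ x ∈ X, par x ∉ L → ¬ IsBad G σ par L X grp cell x →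
      τ x = R (cellOf X grp cell (par x)) (cellOf X grp cell x) (τ (par x)) := fun x hx h h' => by
    rw [hτ x (hB.lt x hx).1, if_neg (not_or.2 ⟨h, h'⟩)]
  have hplt : ∀ x ∈ X, par x < x := fun x hx => hpar x (by
    have := Fin.lt_def.1 (hB.lt x hx).1; omega)
  have hmatch : ∀ x ∈ X, par x ∉ L → ¬ IsBad G σ par L X grp cell x →
      Matched G σ (cellOf X grp cell (par x)) (cellOf X grp cell x) := fun x hx h h' => by
    by_contra hm
    exact h' ⟨x, hx, rfl, h, hm⟩
  have hcell : ∀ x ∈ X, τ x ∈ cellOf X grp cell x := by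
    intro x
    induction x using WellFoundedLT.induction with
    | ind x ih =>
      intro hx
      by_cases h : par x ∈ L ∨ IsBad G σ par L X grp cell x
      · rw [hbase x hx h]
        exact mem_cellOf.2 ⟨hx, rfl, rfl⟩
      · obtain ⟨h1, h2⟩ := not_or.1 h
        rw [hrec x hx h1 h2]
        exact ((hR _ _ (hmatch x hx h1 h2)).2 _ (ih _ (hplt x hx) (hB.par_mem hx h1))).1
  refine ⟨τ, hcell, ?_, fun x hx h1 h2 => ?_⟩
  · intro x
    induction x using WellFoundedLT.induction with
    | ind x ih =>
      intro hx y hy hxy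
      rw [Finset.mem_coe] at hx hy
      have hcx := mem_cellOf.1 (hcell x hx)
      have hcy := mem_cellOf.1 (hcell y hy)
      have hg : grp x = grp y := by rw [← hcx.2.1, ← hcy.2.1, hxy]
      have hc : cell x = cell y := by rw [← hcx.2.2, ← hcy.2.2, hxy]
      have hbb := isBad_congr (G := G) (par := par) (L := L) (X := X) (cell := cell) (σ := σ) hg
      by_cases h : par x ∈ L ∨ IsBad G σ par L X grp cell x
      · rw [hbase x hx h, hbase y hy] at hxy
        · exact hxy
        · refine h.imp (fun h' => by_contra fun h'' => ?_) hbb.1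
          exact (hB.cell_par y hy x hx hg.symm hc.symm h'').1 h'
      · obtain ⟨h1, h2⟩ := not_or.1 h
        obtain ⟨h3, h4, h5⟩ := hB.cell_par x hx y hy hg hc h1
        have hpx := hB.par_mem hx h1
        have hpy := hB.par_mem hy h3
        have hgp : grp (par x) = grp (par y) := by
          rw [← hB.grp_par x hx h1, ← hB.grp_par y hy h3, hg]
        rw [hrec x hx h1 h2, hrec y hy h3 (fun h' => h2 (hbb.2 h')), ← cellOf_congr hgp h4,
          ← cellOf_congr hg hc] at hxy
        refine h5 (ih _ (hplt x hx) hpx hpy ((hR _ _ (hmatch x hx h1 h2)).1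
          (hcell _ hpx) ?_ hxy))
        rw [cellOf_congr hgp h4]
        exact hcell _ hpy
  · rw [hrec x hx h1 h2]
    exact ((hR _ _ (hmatch x hx h1 h2)).2 _ (hcell _ (hB.par_mem hx h1))).2

/-- A random injection composed with a permutation of the cells is still spread. -/
theorem pr_comp_rearrangement_le (hB : IsBundling par m L X grp cell q) {N : ℕ} (hXN : #X ≤ N)
    {w : (Fin n → Fin n) → ℝ} (hw : IsProb w)
    (hsp : ∀ S ⊆ X, ∀ y : Fin n → Fin n, pr w (fun σ => ∀ i ∈ S, σ i = y i) ≤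
      1 / (N.descFactorial #S : ℝ))
    (τ : (Fin n → Fin n) → Fin n → Fin n) (hτ : ∀ σ, (∀ x ∈ X, τ σ x ∈ cellOf X grp cell x) ∧
      Set.InjOn (τ σ) X) {S : Finset (Fin n)} (hS : S ⊆ X) (y : Fin n → Fin n) :
    pr w (fun σ => ∀ i ∈ S, σ (τ σ i) = y i) ≤ (3 * q / N) ^ #S := by
  set Z := Fintype.piFinset (fun i => if i ∈ S then cellOf X grp cell i else {i}) with hZ
  have hcard : #Z = q ^ #S := by
    rw [hZ, Fintype.card_piFinset]
    have h1 : ∀ i, #(if i ∈ S then cellOf X grp cell i else {i}) = if i ∈ S then q else 1 :=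
      fun i => by
        by_cases hi : i ∈ S
        · rw [if_pos hi, if_pos hi, cellOf, hB.card_cell i (hS hi)]
        · rw [if_neg hi, if_neg hi, Finset.card_singleton]
    rw [Finset.prod_congr rfl fun i _ => h1 i, Finset.prod_ite_mem, Finset.univ_inter,
      Finset.prod_const]
  calc _ ≤ pr w (fun σ => ∃ z ∈ Z.filter (fun z => Set.InjOn z S), ∀ i ∈ S, σ (z i) = y i) := by
        refine pr_mono hw.nonneg fun σ _ hσ => ⟨fun i => if i ∈ S then τ σ i else i,
          Finset.mem_filter.2 ⟨Fintype.mem_piFinset.2 fun i => ?_, fun i hi j hj hij => ?_⟩,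
          fun i hi => ?_⟩
        · by_cases hi : i ∈ S
          · simpa [hi] using (hτ σ).1 i (hS hi)
          · simp [hi]
        · rw [Finset.mem_coe] at hi hj
          simp only [hi, hj, if_true] at hij
          exact (hτ σ).2 (hS hi) (hS hj) hij
        · simpa [hi] using hσ i hi
    _ ≤ ∑ z ∈ Z.filter (fun z => Set.InjOn z S), pr w (fun σ => ∀ i ∈ S, σ (z i) = y i) :=
        pr_union hw.nonneg _ _
    _ ≤ ∑ z ∈ Z.filter (fun z => Set.InjOn z S), (3 / N : ℝ) ^ #S := by
        refine Finset.sum_le_sum fun z hz => ?_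
        obtain ⟨hzZ, hzi⟩ := Finset.mem_filter.1 hz
        have hzX : S.image z ⊆ X := fun j hj => by
          obtain ⟨i, hi, rfl⟩ := Finset.mem_image.1 hj
          have := Fintype.mem_piFinset.1 hzZ i
          rw [if_pos hi] at this
          exact (mem_cellOf.1 this).1
        have hci : #(S.image z) = #S := Finset.card_image_of_injOn hzi
        have h1 := hsp _ hzX (fun j => if h : ∃ i ∈ S, z i = j then y h.choose else j)
        rw [hci] at h1
        refine le_trans (pr_mono hw.nonneg fun σ _ hσ j hj => ?_) (h1.trans
          (one_div_descFactorial_le ((Finset.card_le_card hS).trans hXN)))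
        obtain ⟨i, hi, hij⟩ := Finset.mem_image.1 hj
        have hex : ∃ i ∈ S, z i = j := ⟨i, hi, hij⟩
        rw [dif_pos hex]
        have h2 := hσ _ hex.choose_spec.1
        rwa [hex.choose_spec.2] at h2
    _ ≤ ∑ z ∈ Z, (3 / N : ℝ) ^ #S :=
        Finset.sum_le_sum_of_subset_of_nonneg (Finset.filter_subset _ _)
          fun _ _ _ => by positivity
    _ = _ := by
        rw [Finset.sum_const, hcard, nsmul_eq_mul]
        push_cast
        rw [← mul_pow]
        ring

/-- The random embedding of the bulk of the tree. -/
theorem exists_bulk {δ : ℝ} (hδ : 0 < δ) (hδ1 : δ < 1) (hB : IsBundling par m L X grp cell q)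
    (hpar : ∀ k : Fin n, k.val ≠ 0 → par k < k) {K : ℕ}
    (hK : ∀ x ∈ X, #{y ∈ X | grp y = grp x} ≤ q * K) {U : Finset (Fin n)} (hXU : #X ≤ #U)
    (hqU : 2 * (q + 1) ^ 2 ≤ #U) (hG : ∀ v, (1 / 2 + δ) * #U ≤ #(nb G v ∩ U)) :
    ∃ w : (Fin n → Fin n) → ℝ, IsProb w ∧ (∀ φ, w φ ≠ 0 → Set.InjOn φ X ∧ (∀ x ∈ X, φ x ∈ U) ∧
      ∃ Y ⊆ X, (#Y : ℝ) ≤ 8 * q ^ 2 * K * (1 - δ ^ 2 / 2) ^ q * n + 1 ∧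
        (∀ x ∈ X, par x ∉ L → (x ∈ Y ↔ par x ∈ Y)) ∧
        ∀ x ∈ X, par x ∉ L → x ∉ Y → G.Adj (φ (par x)) (φ x)) ∧
      ∀ S ⊆ X, ∀ y : Fin n → Fin n, pr w (fun φ => ∀ i ∈ S, φ i = y i) ≤
        2 * (3 * q / #U) ^ #S := by
  obtain ⟨w, hw, hsupp, hsp⟩ := exists_random_injection (fun i : Fin n => i) hXU
  replace hsp : ∀ S ⊆ X, ∀ y : Fin n → Fin n, pr w (fun σ => ∀ i ∈ S, σ i = y i) ≤
      1 / ((#U).descFactorial #S : ℝ) := hsp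
  have hU0 : 0 < #U := lt_of_lt_of_le (by positivity) hqU
  set β : ℝ := 4 * q ^ 2 * K * (1 - δ ^ 2 / 2) ^ q with hβ
  have hρ : 0 ≤ 1 - δ ^ 2 / 2 := by nlinarith
  have hβ0 : 0 ≤ β := by positivity
  have hbad : ∀ x ∈ X, pr w (fun σ => IsBad G σ par L X grp cell x) ≤ β := by
    intro x hx
    calc _ ≤ pr w (fun σ => ∃ y ∈ {y ∈ {y ∈ X | grp y = grp x} | par y ∉ L},
          ¬ Matched G σ (cellOf X grp cell (par y)) (cellOf X grp cell y)) := by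
          refine pr_mono hw.nonneg fun σ _ hσ => ?_
          obtain ⟨y, hy, hy1, hy2, hy3⟩ := hσ
          exact ⟨y, Finset.mem_filter.2 ⟨Finset.mem_filter.2 ⟨hy, hy1⟩, hy2⟩, hy3⟩
      _ ≤ ∑ y ∈ {y ∈ {y ∈ X | grp y = grp x} | par y ∉ L}, pr w (fun σ =>
          ¬ Matched G σ (cellOf X grp cell (par y)) (cellOf X grp cell y)) :=
          pr_union hw.nonneg _ _
      _ ≤ ∑ y ∈ {y ∈ {y ∈ X | grp y = grp x} | par y ∉ L}, 4 * q * (1 - δ ^ 2 / 2) ^ q := by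
          refine Finset.sum_le_sum fun y hy => ?_
          obtain ⟨hy1, hpy⟩ := Finset.mem_filter.1 hy
          have hyX := (Finset.mem_filter.1 hy1).1
          have hpX := hB.par_mem hyX hpy
          have hsub : cellOf X grp cell (par y) ∪ cellOf X grp cell y ⊆ X :=
            Finset.union_subset (Finset.filter_subset _ _) (Finset.filter_subset _ _)
          refine pr_no_matching hδ hδ1 hU0 hG hw (hB.card_cell _ hpX) (hB.card_cell _ hyX) ?_
            (fun σ hσ i hi => (hsupp σ hσ).2.2 i (hsub hi)) fun S hS hSq z => ?_
          · refine Finset.disjoint_left.2 fun i hi hi' => hB.cell_par_ne hpar y hyX hpy ?_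
            rw [← (mem_cellOf.1 hi).2.2, ← (mem_cellOf.1 hi').2.2]
          · refine (hsp S (hS.trans hsub) z).trans ?_
            rw [hSq]
            have h1 := pow_le_two_mul_descFactorial hqU
            have h2 : (0 : ℝ) < (#U : ℝ) ^ (q + 1) := by positivity
            have h3 : (0 : ℝ) < ((#U).descFactorial (q + 1) : ℝ) := by linarith
            rw [div_le_div_iff₀ h3 h2, one_mul]
            exact h1
      _ ≤ _ := by
          rw [Finset.sum_const, nsmul_eq_mul]
          have h1 : (#{y ∈ {y ∈ X | grp y = grp x} | par y ∉ L} : ℝ) ≤ q * K := by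
            exact_mod_cast (Finset.card_le_card (Finset.filter_subset _ _)).trans (hK x hx)
          calc _ ≤ (q * K : ℝ) * (4 * q * (1 - δ ^ 2 / 2) ^ q) := by gcongr
            _ = _ := by rw [hβ]; ring
  set Bd : (Fin n → Fin n) → Finset (Fin n) := fun σ =>
    {x ∈ X | IsBad G σ par L X grp cell x} with hBd
  have hXn : (#X : ℝ) ≤ n := by exact_mod_cast (Finset.card_le_univ X).trans (by simp)
  have hmean : ∑ σ, w σ * (#(Bd σ) : ℝ) ≤ β * #X := by
    have h1 : ∀ σ, (#(Bd σ) : ℝ) = ∑ x ∈ X, ind (IsBad G σ par L X grp cell x) := fun σ => by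
      rw [hBd, Finset.card_filter]
      push_cast
      refine Finset.sum_congr rfl fun x _ => ?_
      split_ifs with h
      · rw [ind_of h]
      · rw [ind_not h]
    simp_rw [h1, Finset.mul_sum]
    rw [Finset.sum_comm, mul_comm, ← nsmul_eq_mul]
    exact Finset.sum_le_card_nsmul _ _ _ hbad
  have ht : 0 < 2 * β * #X + 1 := by positivity
  have hmk := pr_markov hw.nonneg (fun σ => (#(Bd σ) : ℝ)) (fun _ _ => by positivity) ht
  have hhalf : (∑ σ, w σ * (#(Bd σ) : ℝ)) / (2 * β * #X + 1) ≤ 1 / 2 := by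
    rw [div_le_iff₀ ht]; linarith
  have hcompl := pr_compl hw fun σ => 2 * β * #X + 1 ≤ (#(Bd σ) : ℝ)
  obtain ⟨w', hw', hle, hsupp'⟩ := hw.exists_cond
    (E := fun σ => ¬ 2 * β * #X + 1 ≤ (#(Bd σ) : ℝ)) (by linarith)
  choose τ hτ1 hτ2 hτ3 using fun σ => hB.exists_rearrangement (G := G) hpar σ
  obtain ⟨w'', hw'', hsupp'', hpr⟩ := exists_map hw' fun σ i => σ (τ σ i)
  refine ⟨w'', hw'', fun φ hφ => ?_, fun S hS y => ?_⟩
  · obtain ⟨σ, hσ, rfl⟩ := hsupp'' φ hφ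
    obtain ⟨hσ1, hσ2⟩ := hsupp' σ hσ
    obtain ⟨-, hinj, hσU⟩ := hsupp σ hσ1
    have hτX : ∀ x ∈ X, τ σ x ∈ X := fun x hx => (mem_cellOf.1 (hτ1 σ x hx)).1
    refine ⟨fun x hx y hy hxy => hτ2 σ hx hy (hinj (hτX x hx) (hτX y hy) hxy),
      fun x hx => hσU _ (hτX x hx), Bd σ, Finset.filter_subset _ _, ?_, fun x hx hpx => ?_,
      fun x hx hpx hxY => hτ3 σ x hx hpx fun h => hxY (Finset.mem_filter.2 ⟨hx, h⟩)⟩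
    · have h1 : 2 * β * #X ≤ 2 * β * n := by gcongr
      have h2 := not_le.1 hσ2
      rw [hβ] at h1 h2
      linarith
    · have h1 : ∀ z, z ∈ Bd σ ↔ z ∈ X ∧ IsBad G σ par L X grp cell z := fun z =>
        Finset.mem_filter
      rw [h1, h1, isBad_congr (hB.grp_par x hx hpx)]
      simp [hx, hB.par_mem hx hpx]
  · rw [hpr]
    refine (pr_le_mul hle _).trans ?_
    gcongr
    exact pr_comp_rearrangement_le hB hXU hw hsp τ (fun σ => ⟨hτ1 σ, hτ2 σ⟩) hS y

end Bulk

section Greedy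
open scoped Classical

theorem exists_enum_of_key {ι : Type*} [Inhabited ι] (Y : Finset ι) (key : ι → ℕ)
    (hkey : Set.InjOn key Y) :
    ∃ e : ℕ → ι, Set.InjOn e (Set.Iio #Y) ∧ (∀ i, i ∈ Y ↔ ∃ k < #Y, e k = i) ∧
      ∀ a < #Y, ∀ b < #Y, a < b → key (e a) < key (e b) := by
  have hc : #(Y.image key) = #Y := Finset.card_image_of_injOn hkey
  set o := (Y.image key).orderEmbOfFin hc with ho
  have hex : ∀ k : Fin #Y, ∃ i ∈ Y, key i = o k := fun k =>
    Finset.mem_image.1 (Finset.orderEmbOfFin_mem (Y.image key) hc k)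
  choose e he hek using hex
  refine ⟨fun k => if h : k < #Y then e ⟨k, h⟩ else default, fun a ha b hb hab => ?_,
    fun i => ⟨fun hi => ?_, ?_⟩, fun a ha b hb hab => ?_⟩
  · rw [Set.mem_Iio] at ha hb
    simp only [dif_pos ha, dif_pos hb] at hab
    have h1 : o ⟨a, ha⟩ = o ⟨b, hb⟩ := by rw [← hek, ← hek, hab]
    simpa using o.injective h1
  · have h1 : key i ∈ Set.range o := by
      rw [ho, Finset.range_orderEmbOfFin]; simpa using ⟨i, hi, rfl⟩
    obtain ⟨k, hk⟩ := h1
    refine ⟨k, k.2, ?_⟩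
    simp only [dif_pos k.2]
    exact hkey (he _) hi ((hek _).trans hk)
  · rintro ⟨k, hk, rfl⟩
    simp only [dif_pos hk]
    exact he _
  · simp only [dif_pos ha, dif_pos hb, hek]
    exact o.strictMono hab

/-- Random greedy embedding of the positions in `Y` into distinct elements of `W`, subject to
constraints that only involve positions treated earlier. -/
theorem exists_greedy {ι V : Type*} [Fintype ι] [DecidableEq ι] [Fintype V] [DecidableEq V]
    [Inhabited ι] (Y : Finset ι) (key : ι → ℕ) (hkey : Set.InjOn key Y) (φ₀ : ι → V)
    (W : Finset V) (Cn : ι → (ι → V) → V → Prop)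
    (hloc : ∀ i ∈ Y, ∀ f f' : ι → V, (∀ j, j ∉ Y ∨ key j < key i → f j = f' j) → ∀ v,
      Cn i f v → Cn i f' v)
    {D : ℝ} (hD : 0 < D) (hcount : ∀ i ∈ Y, ∀ f, D + #Y ≤ #{v ∈ W | Cn i f v}) :
    ∃ w : (ι → V) → ℝ, IsProb w ∧
      (∀ f, w f ≠ 0 → (∀ i, i ∉ Y → f i = φ₀ i) ∧ Set.InjOn f Y ∧
        ∀ i ∈ Y, f i ∈ W ∧ Cn i f (f i)) ∧
      ∀ (S : Finset ι) (y : ι → V),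
        pr w (fun f => ∀ i ∈ S, f i = y i) ≤ (1 / D) ^ #{i ∈ S | i ∈ Y} := by
  obtain ⟨e, he, heY, hem⟩ := exists_enum_of_key Y key hkey
  have hne : ∀ k < #Y, ∀ a < #Y, a ≠ k → e a ≠ e k := fun k hk a ha hak h => hak (he ha hk h)
  have heq : ∀ k < #Y, ∀ a < k, ∀ j, j ∉ Y ∨ key j < key (e a) → j ≠ e k := by
    rintro k hk a hak j (hj | hj) rfl
    · exact hj ((heY _).2 ⟨k, hk, rfl⟩)
    · have := hem a (hak.trans hk) k hk hak
      omega
  have heq' : ∀ k < #Y, ∀ j, j ∉ Y ∨ key j < key (e k) → j ≠ e k := by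
    rintro k hk j (hj | hj) rfl
    · exact hj ((heY _).2 ⟨k, hk, rfl⟩)
    · omega
  obtain ⟨w, hw, hsupp, hsp, -⟩ := exists_seq_choice (R := Unit) #Y e he φ₀
    (fun k f => (∀ a < k, ∀ b < k, f (e a) = f (e b) → a = b) ∧
      ∀ a < k, f (e a) ∈ W ∧ Cn (e a) f (f (e a)))
    (fun k f => {v ∈ W | Cn (e k) f v} \ (Finset.range k).image fun a => f (e a)) hD (by simp)
    (by
      intro k hk f _
      have h1 := hcount (e k) ((heY _).2 ⟨k, hk, rfl⟩) f
      have h2 := Finset.le_card_sdiff ((Finset.range k).image fun a => f (e a))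
        {v ∈ W | Cn (e k) f v}
      have h3 : #((Finset.range k).image fun a => f (e a)) ≤ k :=
        Finset.card_image_le.trans (by simp)
      have h4 : (#{v ∈ W | Cn (e k) f v} : ℝ) ≤
          #({v ∈ W | Cn (e k) f v} \ (Finset.range k).image fun a => f (e a)) + #Y := by
        exact_mod_cast (by omega)
      linarith)
    (by
      rintro k hk f ⟨hf1, hf2⟩ v hv
      obtain ⟨hv1, hv2⟩ := Finset.mem_sdiff.1 hv
      obtain ⟨hvW, hvC⟩ := Finset.mem_filter.1 hv1
      have hv3 : ∀ a < k, f (e a) ≠ v := fun a ha h =>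
        hv2 (Finset.mem_image.2 ⟨a, Finset.mem_range.2 ha, h⟩)
      have hup : ∀ a < k, Function.update f (e k) v (e a) = f (e a) := fun a ha =>
        Function.update_of_ne (hne k hk a (ha.trans hk) ha.ne) _ _
      refine ⟨fun a ha b hb hab => ?_, fun a ha => ?_⟩
      · rcases Nat.lt_succ_iff_lt_or_eq.1 ha with ha | rfl <;>
          rcases Nat.lt_succ_iff_lt_or_eq.1 hb with hb | rfl
        · rw [hup a ha, hup b hb] at hab
          exact hf1 a ha b hb hab
        · rw [hup a ha, Function.update_self] at hab
          exact absurd hab (hv3 a ha)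
        · rw [hup b hb, Function.update_self] at hab
          exact absurd hab.symm (hv3 b hb)
        · rfl
      · rcases Nat.lt_succ_iff_lt_or_eq.1 ha with ha | rfl
        · rw [hup a ha]
          refine ⟨(hf2 a ha).1, hloc _ ((heY _).2 ⟨a, ha.trans hk, rfl⟩) f _ (fun j hj => ?_) _
            (hf2 a ha).2⟩
          rw [Function.update_of_ne (heq k hk a ha j hj)]
        · rw [Function.update_self]
          refine ⟨hvW, hloc _ ((heY _).2 ⟨a, hk, rfl⟩) f _ (fun j hj => ?_) _ hvC⟩
          rw [Function.update_of_ne (heq' a hk j hj)])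
    (fun _ _ _ => 1) (by simp)
  refine ⟨w, hw, fun f hf => ?_, fun S y => ?_⟩
  · obtain ⟨⟨h1, h2⟩, h3⟩ := hsupp f hf
    refine ⟨fun i hi => h3 i fun k hk h => hi ((heY i).2 ⟨k, hk, h⟩), fun i hi j hj hij => ?_,
      fun i hi => ?_⟩
    · obtain ⟨a, ha, rfl⟩ := (heY i).1 hi
      obtain ⟨b, hb, rfl⟩ := (heY j).1 hj
      rw [h1 a ha b hb hij]
    · obtain ⟨a, ha, rfl⟩ := (heY i).1 hi
      exact h2 a ha
  · have h1 := hsp S y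
    have h2 : #{i ∈ S | i ∈ Y} = #{i ∈ S | ∃ k < #Y, e k = i} :=
      congrArg _ (Finset.filter_congr fun i _ => heY i)
    rw [h2]
    convert h1

end Greedy

section Absorb
open scoped Classical

variable {n : ℕ}

theorem exists_swap_fun {J : Finset (Fin n)} {ξ : Fin n → Fin n} (hξ : Set.InjOn ξ J)
    (hJ : ∀ j ∈ J, ξ j ∉ J) : ∃ τ : Fin n → Fin n, Function.Injective τ ∧
      (∀ j ∈ J, τ j = ξ j) ∧ (∀ j ∈ J, τ (ξ j) = j) ∧ ∀ k ∉ J, (∀ j ∈ J, ξ j ≠ k) → τ k = k := by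
  set τ : Fin n → Fin n := fun k =>
    if k ∈ J then ξ k else if h : ∃ j ∈ J, ξ j = k then h.choose else k with hτ
  have h1 : ∀ j ∈ J, τ j = ξ j := fun j hj => by simp only [hτ, if_pos hj]
  have h2 : ∀ j ∈ J, τ (ξ j) = j := fun j hj => by
    have hex : ∃ j' ∈ J, ξ j' = ξ j := ⟨j, hj, rfl⟩
    simp only [hτ, if_neg (hJ j hj), dif_pos hex]
    exact hξ hex.choose_spec.1 hj hex.choose_spec.2
  have h3 : ∀ k ∉ J, (∀ j ∈ J, ξ j ≠ k) → τ k = k := fun k hk hk' => by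
    have hex : ¬ ∃ j ∈ J, ξ j = k := by rintro ⟨j, hj, h⟩; exact hk' j hj h
    simp only [hτ, if_neg hk, dif_neg hex]
  refine ⟨τ, Function.LeftInverse.injective (g := τ) fun k => ?_, h1, h2, h3⟩
  by_cases hk : k ∈ J
  · rw [h1 k hk, h2 k hk]
  · by_cases hk' : ∃ j ∈ J, ξ j = k
    · obtain ⟨j, hj, rfl⟩ := hk'
      rw [h2 j hj, h1 j hj]
    · push Not at hk'
      rw [h3 k hk hk', h3 k hk hk']

theorem eq_of_mem_block {par : Fin n → Fin n} (hpar : ∀ k : Fin n, k.val ≠ 0 → par k < k)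
    {I : Finset (Fin n)} (hI : (I : Set (Fin n)).PairwiseDisjoint (block par)) {k : Fin n}
    (hk0 : k.val ≠ 0) (hk : k ∈ I) : par k ∉ I := by
  intro hp
  have hne : k ≠ par k := (hpar k hk0).ne'
  have h1 : par k ∈ block par k := by simp [block]
  have h2 : par k ∈ block par (par k) := by simp [block]
  exact Finset.disjoint_left.1 (hI hk hp hne) h1 h2

/-- The probability that a swapped embedding takes prescribed values. -/
theorem pr_swap_le {J : Finset (Fin n)} {φ π : Fin n → Fin n} (hφ : Set.InjOn φ {k | k ∉ J})
    (hπ : Function.Injective π) (hπφ : ∀ k ∉ J, π k = φ k) {w : (Fin n → Fin n) → ℝ}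
    (hw : IsProb w) {τ : (Fin n → Fin n) → Fin n → Fin n}
    (hsupp : ∀ ξ, w ξ ≠ 0 → (∀ j ∈ J, ξ j ∉ J) ∧ (∀ j ∈ J, τ ξ j = ξ j) ∧
      (∀ j ∈ J, τ ξ (ξ j) = j) ∧ (∀ k ∉ J, (∀ j ∈ J, ξ j ≠ k) → τ ξ k = k))
    {B : ℝ} (hB0 : 0 ≤ B) (hB1 : B ≤ 1)
    (hsp : ∀ S ⊆ J, ∀ y : Fin n → Fin n, pr w (fun ξ => ∀ j ∈ S, ξ j = y j) ≤ B ^ #S)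
    (S : Finset (Fin n)) (y : Fin n → Fin n) :
    pr w (fun ξ => ∀ k ∈ S, π (τ ξ k) = y k) ≤
      ind (∀ j ∈ S, j ∈ J → ∀ x ∈ S, x ∉ J → φ x ≠ y x → φ x = y j → π j = y x) *
        B ^ (#{k ∈ S | k ∈ J ∨ φ k ≠ y k} -
          #{j ∈ S | j ∈ J ∧ ∃ x ∈ S, x ∉ J ∧ φ x ≠ y x ∧ φ x = y j}) := by
  have hR : 0 ≤ ind (∀ j ∈ S, j ∈ J → ∀ x ∈ S, x ∉ J → φ x ≠ y x → φ x = y j → π j = y x) *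
        B ^ (#{k ∈ S | k ∈ J ∨ φ k ≠ y k} -
          #{j ∈ S | j ∈ J ∧ ∃ x ∈ S, x ∉ J ∧ φ x ≠ y x ∧ φ x = y j}) :=
    mul_nonneg (ind_nonneg _) (pow_nonneg hB0 _)
  by_cases hex : ∃ ξ₀, w ξ₀ ≠ 0 ∧ ∀ k ∈ S, π (τ ξ₀ k) = y k
  swap
  · push Not at hex
    have h0 : pr w (fun ξ => ∀ k ∈ S, π (τ ξ k) = y k) = 0 := by
      refine Finset.sum_eq_zero fun ξ _ => ?_
      by_cases hξ : w ξ = 0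
      · rw [hξ, zero_mul]
      · obtain ⟨k, hk, hk'⟩ := hex ξ hξ
        rw [ind_not (fun h => hk' (h k hk)), mul_zero]
    rw [h0]; exact hR
  obtain ⟨ξ₀, hξ₀, hE₀⟩ := hex
  have hA : ∀ ξ, w ξ ≠ 0 → (∀ k ∈ S, π (τ ξ k) = y k) → ∀ j ∈ S, j ∈ J → φ (ξ j) = y j := by
    intro ξ hξ hE j hjS hj
    obtain ⟨h1, h2, -, -⟩ := hsupp ξ hξ
    rw [← hE j hjS, h2 j hj, hπφ _ (h1 j hj)]
  have hD : ∀ ξ, w ξ ≠ 0 → (∀ k ∈ S, π (τ ξ k) = y k) → ∀ x ∈ S, x ∉ J → φ x ≠ y x →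
      ∃ j ∈ J, ξ j = x ∧ π j = y x := by
    intro ξ hξ hE x hxS hx hxy
    obtain ⟨-, -, h3, h4⟩ := hsupp ξ hξ
    by_contra hn
    push Not at hn
    by_cases hj : ∃ j ∈ J, ξ j = x
    · obtain ⟨j, hj, rfl⟩ := hj
      exact hn j hj rfl (by rw [← hE _ hxS, h3 j hj])
    · push Not at hj
      exact hxy (by rw [← hE x hxS, h4 x hx hj, hπφ x hx])
  obtain ⟨hJ₀, -, h3₀, -⟩ := hsupp ξ₀ hξ₀
  have hinj₀ : Set.InjOn ξ₀ J := fun a ha b hb hab => by rw [← h3₀ a ha, ← h3₀ b hb, hab]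
  have hind : ∀ j ∈ S, j ∈ J → ∀ x ∈ S, x ∉ J → φ x ≠ y x → φ x = y j → ξ₀ j = x ∧ π j = y x := by
    intro j hjS hj x hxS hx hxy hxj
    have h1 : ξ₀ j = x :=
      hφ (hJ₀ j hj) hx ((hA ξ₀ hξ₀ hE₀ j hjS hj).trans hxj.symm)
    obtain ⟨j', hj', h2, h4⟩ := hD ξ₀ hξ₀ hE₀ x hxS hx hxy
    have : j' = j := hinj₀ hj' hj (h2.trans h1.symm)
    exact ⟨h1, this ▸ h4⟩
  rw [ind_of (fun j hjS hj x hxS hx hxy hxj => (hind j hjS hj x hxS hx hxy hxj).2), one_mul]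
  set Q : Finset (Fin n) := {j | j ∈ J ∧ (j ∈ S ∨ (ξ₀ j ∈ S ∧ φ (ξ₀ j) ≠ y (ξ₀ j)))} with hQ
  have hQJ : Q ⊆ J := fun j hj => (Finset.mem_filter.1 hj).2.1
  calc pr w (fun ξ => ∀ k ∈ S, π (τ ξ k) = y k) ≤ pr w (fun ξ => ∀ j ∈ Q, ξ j = ξ₀ j) := by
        refine pr_mono hw.nonneg fun ξ hξ hE j hj => ?_
        obtain ⟨-, hjJ, hj⟩ := Finset.mem_filter.1 hj
        obtain ⟨h1, -, h3, -⟩ := hsupp ξ hξ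
        rcases hj with hj | ⟨hj, hjy⟩
        · exact hφ (h1 j hjJ) (hJ₀ j hjJ)
            ((hA ξ hξ hE j hj hjJ).trans (hA ξ₀ hξ₀ hE₀ j hj hjJ).symm)
        · obtain ⟨j', hj', h5, h6⟩ := hD ξ hξ hE _ hj (hJ₀ j hjJ) hjy
          obtain ⟨j₁, hj₁, h7, h8⟩ := hD ξ₀ hξ₀ hE₀ _ hj (hJ₀ j hjJ) hjy
          have h9 : j₁ = j := hinj₀ hj₁ hjJ h7
          have h10 : j' = j := by rw [← h9]; exact hπ (h6.trans h8.symm)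
          rw [← h5, h10]
    _ ≤ B ^ #Q := hsp Q hQJ ξ₀
    _ ≤ _ := by
        refine pow_le_pow_of_le_one hB0 hB1 ?_
        have h1 : ({k ∈ S | k ∈ J ∨ φ k ≠ y k} : Finset (Fin n)) ⊆
            {k ∈ S | k ∈ J} ∪ {k ∈ S | k ∉ J ∧ φ k ≠ y k} := by
          intro k hk
          obtain ⟨hkS, hk⟩ := Finset.mem_filter.1 hk
          by_cases hkJ : k ∈ J
          · exact Finset.mem_union_left _ (Finset.mem_filter.2 ⟨hkS, hkJ⟩)
          · exact Finset.mem_union_right _ (Finset.mem_filter.2 ⟨hkS, hkJ, hk.resolve_left hkJ⟩)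
        have h2 : #{k ∈ S | k ∉ J ∧ φ k ≠ y k} ≤
            #{j | j ∈ J ∧ (ξ₀ j ∈ S ∧ φ (ξ₀ j) ≠ y (ξ₀ j))} := by
          refine (Finset.card_le_card fun x hx => ?_).trans
            (Finset.card_image_le (f := ξ₀))
          obtain ⟨hxS, hx, hxy⟩ := Finset.mem_filter.1 hx
          obtain ⟨j, hj, rfl, -⟩ := hD ξ₀ hξ₀ hE₀ x hxS hx hxy
          exact Finset.mem_image.2 ⟨j, Finset.mem_filter.2 ⟨Finset.mem_univ _, hj, hxS, hxy⟩, rfl⟩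
        have h3 : ({k ∈ S | k ∈ J} ∪
            ({j | j ∈ J ∧ (ξ₀ j ∈ S ∧ φ (ξ₀ j) ≠ y (ξ₀ j))} : Finset (Fin n))) ⊆ Q := by
          intro k hk
          rcases Finset.mem_union.1 hk with hk | hk
          · obtain ⟨hkS, hkJ⟩ := Finset.mem_filter.1 hk
            exact Finset.mem_filter.2 ⟨Finset.mem_univ _, hkJ, Or.inl hkS⟩
          · obtain ⟨-, hkJ, hk⟩ := Finset.mem_filter.1 hk
            exact Finset.mem_filter.2 ⟨Finset.mem_univ _, hkJ, Or.inr hk⟩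
        have h4 : ({k ∈ S | k ∈ J} ∩
            ({j | j ∈ J ∧ (ξ₀ j ∈ S ∧ φ (ξ₀ j) ≠ y (ξ₀ j))} : Finset (Fin n))) ⊆
            {j ∈ S | j ∈ J ∧ ∃ x ∈ S, x ∉ J ∧ φ x ≠ y x ∧ φ x = y j} := by
          intro k hk
          obtain ⟨hk1, hk2⟩ := Finset.mem_inter.1 hk
          obtain ⟨hkS, hkJ⟩ := Finset.mem_filter.1 hk1
          obtain ⟨-, -, hk3, hk4⟩ := Finset.mem_filter.1 hk2
          exact Finset.mem_filter.2 ⟨hkS, hkJ, ξ₀ k, hk3, hJ₀ k hkJ, hk4,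
            hA ξ₀ hξ₀ hE₀ k hkS hkJ⟩
        have h5 := Finset.card_le_card h1
        have h6 := Finset.card_union_le ({k ∈ S | k ∈ J} : Finset (Fin n))
          {k ∈ S | k ∉ J ∧ φ k ≠ y k}
        have h7 := Finset.card_le_card h3
        have h8 := Finset.card_le_card h4
        have h9 := Finset.card_union_add_card_inter ({k ∈ S | k ∈ J} : Finset (Fin n))
          ({j | j ∈ J ∧ (ξ₀ j ∈ S ∧ φ (ξ₀ j) ≠ y (ξ₀ j))} : Finset (Fin n))
        omega

/-- Absorption: a partial embedding missing the vertices of `J ⊆ I` is completed by swapping the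
vertices of `J` with random vertices of `I`. -/
theorem exists_absorb {G : SimpleGraph (Fin n)} {par : Fin n → Fin n}
    (hpar : ∀ k : Fin n, k.val ≠ 0 → par k < k) {I J : Finset (Fin n)}
    (hI : (I : Set (Fin n)).PairwiseDisjoint (block par))
    (hI0 : ∀ x ∈ I, x.val ≠ 0 ∧ #({c | par c = x} : Finset (Fin n)) ≤ 1) (hJI : J ⊆ I)
    {φ : Fin n → Fin n} (hφ : Set.InjOn φ {k | k ∉ J})
    (hadj : ∀ k : Fin n, k.val ≠ 0 → k ∉ J → par k ∉ J → G.Adj (φ (par k)) (φ k))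
    {D : ℝ} (hD : 0 < D)
    (hcount : ∀ a b d, D + 2 * #J ≤ #{x ∈ I | φ x ∈ nb G a ∩ nb G b ∧ φ (par x) ∈ nb G d ∧
      ∀ y, par y = x → φ y ∈ nb G d})
    {B : ℝ} (hB1 : B ≤ 1) (hBD : 1 / D ≤ B) (hBJ : 3 / #J ≤ B) :
    ∃ w : (Fin n → Fin n) → ℝ, IsProb w ∧
      (∀ ψ, w ψ ≠ 0 → Function.Injective ψ ∧
        ∀ k : Fin n, k.val ≠ 0 → G.Adj (ψ (par k)) (ψ k)) ∧
      ∀ (S : Finset (Fin n)) (y : Fin n → Fin n), pr w (fun ψ => ∀ k ∈ S, ψ k = y k) ≤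
        B ^ #{k ∈ S | k ∈ J ∨ φ k ≠ y k} := by
  have hB0 : 0 ≤ B := le_trans (by positivity) hBD
  have hJc : #J = #(Finset.univ \ (Finset.univ \ J).image φ) := by
    rw [Finset.card_sdiff_of_subset (Finset.subset_univ _), Finset.card_image_of_injOn,
      Finset.card_sdiff_of_subset (Finset.subset_univ _)]
    · have := Finset.card_le_univ J
      rw [Finset.card_univ]; omega
    · intro a ha b hb hab
      exact hφ (by simpa using ha) (by simpa using hb) hab
  obtain ⟨w₁, hw₁, hs₁, hp₁⟩ := exists_random_injection φ hJc.le
  have hπ : ∀ π, w₁ π ≠ 0 → Function.Injective π ∧ ∀ k ∉ J, π k = φ k := by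
    intro π hπ
    obtain ⟨h1, h2, h3⟩ := hs₁ π hπ
    have h4 : ∀ a ∈ J, ∀ b ∉ J, π a ≠ π b := fun a ha b hb hab => by
      refine (Finset.mem_sdiff.1 (h3 a ha)).2 (Finset.mem_image.2 ⟨b, by simpa using hb, ?_⟩)
      rw [hab, h1 b hb]
    refine ⟨fun a b hab => ?_, h1⟩
    by_cases ha : a ∈ J <;> by_cases hb : b ∈ J
    · exact h2 ha hb hab
    · exact absurd hab (h4 a ha b hb)
    · exact absurd hab.symm (h4 b hb a ha)
    · exact hφ ha hb (by rw [← h1 a ha, ← h1 b hb, hab])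
  have hτ : ∀ ξ : Fin n → Fin n, ∃ τ : Fin n → Fin n, (Set.InjOn ξ J ∧ ∀ j ∈ J, ξ j ∉ J) →
      Function.Injective τ ∧ (∀ j ∈ J, τ j = ξ j) ∧ (∀ j ∈ J, τ (ξ j) = j) ∧
        ∀ k ∉ J, (∀ j ∈ J, ξ j ≠ k) → τ k = k := fun ξ => by
    by_cases h : Set.InjOn ξ J ∧ ∀ j ∈ J, ξ j ∉ J
    · obtain ⟨τ, hτ⟩ := exists_swap_fun h.1 h.2
      exact ⟨τ, fun _ => hτ⟩
    · exact ⟨ξ, fun h' => absurd h' h⟩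
  choose τ hτ using hτ
  have hgr : ∀ π : Fin n → Fin n, ∃ w : (Fin n → Fin n) → ℝ, IsProb w ∧
      (∀ ξ, w ξ ≠ 0 → Set.InjOn ξ J ∧ ∀ j ∈ J, ξ j ∈ I ∧ ξ j ∉ J ∧ G.Adj (φ (par j)) (φ (ξ j)) ∧
        (∀ c, par c = j → G.Adj (φ c) (φ (ξ j))) ∧ G.Adj (π j) (φ (par (ξ j))) ∧
        ∀ y, par y = ξ j → G.Adj (π j) (φ y)) ∧
      ∀ S ⊆ J, ∀ y : Fin n → Fin n, pr w (fun ξ => ∀ j ∈ S, ξ j = y j) ≤ B ^ #S := by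
    intro π
    rcases J.eq_empty_or_nonempty with hJ | ⟨j₀, -⟩
    · obtain ⟨w, hw, -, -⟩ := exists_random_injection (id : Fin n → Fin n) (le_refl #J)
      refine ⟨w, hw, fun ξ _ => by simp [hJ], fun S hS y => ?_⟩
      rw [hJ, Finset.subset_empty] at hS
      subst hS
      simpa using pr_le_one hw _
    have : Inhabited (Fin n) := ⟨j₀⟩
    obtain ⟨w, hw, hs, hp⟩ := exists_greedy J (fun i : Fin n => i.val)
      (fun a _ b _ hab => Fin.ext hab) (id : Fin n → Fin n) (I \ J)
      (fun j _ v => φ v ∈ nb G (φ (par j)) ∧ (∀ c, par c = j → φ v ∈ nb G (φ c)) ∧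
        φ (par v) ∈ nb G (π j) ∧ ∀ y, par y = v → φ y ∈ nb G (π j))
      (fun _ _ _ _ _ _ h => h) hD (by
        intro j hj _
        obtain ⟨b, hb⟩ : ∃ b, ∀ c, par c = j → φ c = b := by
          by_cases hc : ∃ c, par c = j
          · obtain ⟨c, hc⟩ := hc
            refine ⟨φ c, fun c' hc' => ?_⟩
            rw [Finset.card_le_one.1 (hI0 j (hJI hj)).2 c' (by simpa using hc') c
              (by simpa using hc)]
          · push Not at hc
            exact ⟨φ j, fun c' hc' => absurd hc' (hc c')⟩
        have h1 := hcount (φ (par j)) b (π j)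
        set Z : Finset (Fin n) := {x ∈ I | φ x ∈ nb G (φ (par j)) ∩ nb G b ∧
          φ (par x) ∈ nb G (π j) ∧ ∀ y, par y = x → φ y ∈ nb G (π j)} with hZ
        have h2 : Z \ J ⊆ {v ∈ I \ J | φ v ∈ nb G (φ (par j)) ∧
            (∀ c, par c = j → φ v ∈ nb G (φ c)) ∧
            φ (par v) ∈ nb G (π j) ∧ ∀ y, par y = v → φ y ∈ nb G (π j)} := by
          intro x hx
          obtain ⟨hx, hxJ⟩ := Finset.mem_sdiff.1 hx
          obtain ⟨hxI, hx1, hx2, hx3⟩ := Finset.mem_filter.1 hx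
          obtain ⟨hx4, hx5⟩ := Finset.mem_inter.1 hx1
          exact Finset.mem_filter.2 ⟨Finset.mem_sdiff.2 ⟨hxI, hxJ⟩, hx4,
            fun c hc => by rw [hb c hc]; exact hx5, hx2, hx3⟩
        have h3 := Finset.card_le_card h2
        have h4 := Finset.le_card_sdiff J Z
        have h5 : (#Z : ℝ) ≤ #(Z \ J) + #J := by exact_mod_cast (by omega)
        have h6 : (#(Z \ J) : ℝ) ≤ #{v ∈ I \ J | φ v ∈ nb G (φ (par j)) ∧
            (∀ c, par c = j → φ v ∈ nb G (φ c)) ∧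
            φ (par v) ∈ nb G (π j) ∧ ∀ y, par y = v → φ y ∈ nb G (π j)} := by exact_mod_cast h3
        refine le_trans ?_ (h6.trans (le_of_eq ?_))
        · linarith
        · congr!)
    refine ⟨w, hw, fun ξ hξ => ?_, fun S hS y => ?_⟩
    · obtain ⟨-, h1, h2⟩ := hs ξ hξ
      refine ⟨h1, fun j hj => ?_⟩
      obtain ⟨h3, h4, h5, h6, h7⟩ := h2 j hj
      obtain ⟨h8, h9⟩ := Finset.mem_sdiff.1 h3
      exact ⟨h8, h9, mem_nb.1 h4, fun c hc => mem_nb.1 (h5 c hc), mem_nb.1 h6,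
        fun y hy => mem_nb.1 (h7 y hy)⟩
    · refine (hp S y).trans ?_
      rw [Finset.filter_true_of_mem fun i hi => hS hi]
      exact pow_le_pow_left₀ (by positivity) hBD _
  choose κ hκ hκs hκp using hgr
  choose κ' hκ' hκs' hκp' using fun π => exists_map (hκ π) fun ξ k => π (τ ξ k)
  refine ⟨mix w₁ κ', hw₁.mix fun π _ => hκ' π, fun ψ hψ => ?_, fun S y => ?_⟩
  · obtain ⟨π, hπ0, hψ⟩ := mix_ne_zero hψ
    obtain ⟨ξ, hξ0, rfl⟩ := hκs' π ψ hψ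
    obtain ⟨hπi, hπφ⟩ := hπ π hπ0
    obtain ⟨hξi, hξ⟩ := hκs π ξ hξ0
    obtain ⟨t1, t2, t3, t4⟩ := hτ ξ ⟨hξi, fun j hj => (hξ j hj).2.1⟩
    refine ⟨hπi.comp t1, fun k hk0 => ?_⟩
    have hout : ∀ k, k ∉ I → τ ξ k = k := fun k hk =>
      t4 k (fun h => hk (hJI h)) fun j hj h => hk (h ▸ (hξ j hj).1)
    have hπo : ∀ k, k ∉ I → π k = φ k := fun k hk => hπφ k fun h => hk (hJI h)
    by_cases hkI : k ∈ I
    · have hpI := eq_of_mem_block hpar hI hk0 hkI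
      show G.Adj (π (τ ξ (par k))) (π (τ ξ k))
      rw [hout _ hpI, hπo _ hpI]
      by_cases hkJ : k ∈ J
      · obtain ⟨-, h1, h2, -⟩ := hξ k hkJ
        rw [t2 k hkJ, hπφ _ h1]
        exact h2
      · by_cases hk' : ∃ j ∈ J, ξ j = k
        · obtain ⟨j, hj, rfl⟩ := hk'
          rw [t3 j hj]
          exact (hξ j hj).2.2.2.2.1.symm
        · push Not at hk'
          rw [t4 k hkJ hk', hπφ k hkJ]
          exact hadj k hk0 hkJ fun h => hpI (hJI h)
    · show G.Adj (π (τ ξ (par k))) (π (τ ξ k))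
      rw [hout _ hkI, hπo _ hkI]
      by_cases hpJ : par k ∈ J
      · obtain ⟨-, h1, -, h2, -⟩ := hξ _ hpJ
        rw [t2 _ hpJ, hπφ _ h1]
        exact (h2 k rfl).symm
      · by_cases hk' : ∃ j ∈ J, ξ j = par k
        · obtain ⟨j, hj, hjk⟩ := hk'
          rw [← hjk, t3 j hj]
          exact (hξ j hj).2.2.2.2.2 k hjk.symm
        · push Not at hk'
          rw [t4 _ hpJ hk', hπφ _ hpJ]
          exact hadj k hk0 (fun h => hkI (hJI h)) hpJ
  · set Λ : Finset (Fin n) := {j ∈ S | j ∈ J ∧ ∃ x ∈ S, x ∉ J ∧ φ x ≠ y x ∧ φ x = y j} with hΛ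
    have hc : ∀ j, ∃ x, j ∈ Λ → x ∈ S ∧ x ∉ J ∧ φ x ≠ y x ∧ φ x = y j := fun j => by
      by_cases hj : j ∈ Λ
      · obtain ⟨-, -, x, hx⟩ := Finset.mem_filter.1 hj
        exact ⟨x, fun _ => hx⟩
      · exact ⟨j, fun h => absurd h hj⟩
    choose c hc using hc
    have hΛJ : Λ ⊆ J := fun j hj => (Finset.mem_filter.1 hj).2.1
    have hΛle : #Λ ≤ #{k ∈ S | k ∈ J ∨ φ k ≠ y k} := Finset.card_le_card fun j hj => by
      obtain ⟨h1, h2, -⟩ := Finset.mem_filter.1 hj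
      exact Finset.mem_filter.2 ⟨h1, Or.inl h2⟩
    rw [pr_mix]
    calc ∑ π, w₁ π * pr (κ' π) (fun ψ => ∀ k ∈ S, ψ k = y k)
        ≤ ∑ π, w₁ π * (ind (∀ j ∈ Λ, π j = y (c j)) *
            B ^ (#{k ∈ S | k ∈ J ∨ φ k ≠ y k} - #Λ)) := by
          refine Finset.sum_le_sum fun π _ => ?_
          by_cases h0 : w₁ π = 0
          · rw [h0, zero_mul, zero_mul]
          refine mul_le_mul_of_nonneg_left ?_ (hw₁.nonneg π)
          obtain ⟨hπi, hπφ⟩ := hπ π h0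
          rw [hκp' π]
          refine (pr_swap_le hφ hπi hπφ (hκ π) (fun ξ hξ0 => ?_) hB0 hB1 (hκp π) S
            y).trans ?_
          · obtain ⟨hξi, hξ⟩ := hκs π ξ hξ0
            obtain ⟨-, t2, t3, t4⟩ := hτ ξ ⟨hξi, fun j hj => (hξ j hj).2.1⟩
            exact ⟨fun j hj => (hξ j hj).2.1, t2, t3, t4⟩
          · refine mul_le_mul_of_nonneg_right (ind_mono fun h j hj => ?_) (pow_nonneg hB0 _)
            obtain ⟨h1, h2, h3, h4⟩ := hc j hj
            exact h j (Finset.mem_filter.1 hj).1 (hΛJ hj) (c j) h1 h2 h3 h4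
      _ = pr w₁ (fun π => ∀ j ∈ Λ, π j = y (c j)) *
            B ^ (#{k ∈ S | k ∈ J ∨ φ k ≠ y k} - #Λ) := by
          rw [pr, Finset.sum_mul]
          exact Finset.sum_congr rfl fun π _ => by ring
      _ ≤ B ^ #Λ * B ^ (#{k ∈ S | k ∈ J ∨ φ k ≠ y k} - #Λ) := by
          refine mul_le_mul_of_nonneg_right ?_ (pow_nonneg hB0 _)
          refine (hp₁ Λ hΛJ fun j => y (c j)).trans ?_
          rw [← hJc]
          exact (one_div_descFactorial_le (Finset.card_le_card hΛJ)).trans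
            (pow_le_pow_left₀ (by positivity) hBJ _)
      _ = _ := by rw [← pow_add, Nat.add_sub_cancel' hΛle]

end Absorb

section Connect
open scoped Classical

variable {n : ℕ}

/-- Random greedy embedding, into a reservoir `W`, of the cut vertices `L` together with all other
vertices in `Y`, joining up the pieces embedded so far by `φ`. -/
theorem exists_connect {G : SimpleGraph (Fin n)} {par : Fin n → Fin n} {m : Fin n}
    (hpar : ∀ k : Fin n, k.val ≠ 0 → par k < k) (hm0 : m.val ≠ 0)
    {L Y : Finset (Fin n)} (hmL : m ∈ L) (hLY : L ⊆ Y)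
    (hsib : ∀ l ∈ L, ∀ c c', par c = l → par c' = l → m < c → m < c' → c ∉ L → c' ∉ L → c = c')
    (hYm : ∀ k ∈ Y, m ≤ k) (hY : ∀ k, m < k → k ∉ L → par k ∉ L → (k ∈ Y ↔ par k ∈ Y))
    (φ : Fin n → Fin n) {W : Finset (Fin n)} {D : ℝ} (hD : 0 < D)
    (hW : ∀ a b, D + #Y ≤ #(W ∩ (nb G a ∩ nb G b))) :
    ∃ w : (Fin n → Fin n) → ℝ, IsProb w ∧
      (∀ f, w f ≠ 0 → (∀ i, i ∉ Y → f i = φ i) ∧ Set.InjOn f Y ∧ (∀ i ∈ Y, f i ∈ W) ∧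
        ∀ k, m ≤ k → (k ∈ Y ∨ par k ∈ Y) → G.Adj (f (par k)) (f k)) ∧
      ∀ (S : Finset (Fin n)) (y : Fin n → Fin n),
        pr w (fun f => ∀ i ∈ S, f i = y i) ≤ (1 / D) ^ #{i ∈ S | i ∈ Y} := by
  have : Inhabited (Fin n) := ⟨m⟩
  have hmk : ∀ {k : Fin n}, m ≤ k → k.val ≠ 0 := fun {k} h h0 => hm0 (by
    have := Fin.le_def.1 h; omega)
  have hmlt : ∀ {k : Fin n}, m ≤ k → k ∉ L → m < k := fun {k} h hk =>
    lt_of_le_of_ne h fun h' => hk (h' ▸ hmL)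
  set key : Fin n → ℕ := fun i => if i ∈ L then n + i.val else i.val with hkey
  have hk1 : ∀ i ∈ L, key i = n + i.val := fun i hi => by simp only [hkey, if_pos hi]
  have hk2 : ∀ i, i ∉ L → key i = i.val := fun i hi => by simp only [hkey, if_neg hi]
  obtain ⟨w, hw, hs, hp⟩ := exists_greedy Y key
    (fun a _ b _ hab => by
      have ha := a.2
      have hb := b.2
      by_cases haL : a ∈ L <;> by_cases hbL : b ∈ L
      · rw [hk1 a haL, hk1 b hbL] at hab; exact Fin.ext (by omega)
      · rw [hk1 a haL, hk2 b hbL] at hab; omega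
      · rw [hk2 a haL, hk1 b hbL] at hab; omega
      · rw [hk2 a haL, hk2 b hbL] at hab; exact Fin.ext hab) φ W
    (fun i f v => (i ∈ L ∨ par i ∉ L → v ∈ nb G (f (par i))) ∧
      (i ∈ L → ∀ c, par c = i → m < c → c ∉ L → v ∈ nb G (f c)))
    (by
      rintro i hi f f' hff v ⟨h1, h2⟩
      have hlt := Fin.lt_def.1 (hpar i (hmk (hYm i hi)))
      refine ⟨fun h => ?_, fun hiL c hc hmc hcL => ?_⟩
      · rw [← hff (par i) (Or.inr ?_)]
        · exact h1 h
        · have h3 := (par i).2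
          by_cases hiL : i ∈ L
          · rw [hk1 i hiL]
            by_cases hpL : par i ∈ L
            · rw [hk1 _ hpL]; omega
            · rw [hk2 _ hpL]; omega
          · rw [hk2 i hiL, hk2 _ (h.resolve_left hiL)]; exact hlt
      · rw [← hff c (Or.inr (by rw [hk1 i hiL, hk2 c hcL]; have := c.2; omega))]
        exact h2 hiL c hc hmc hcL) hD
    (by
      intro i hi f
      obtain ⟨b, hb⟩ : ∃ b, i ∈ L → ∀ c, par c = i → m < c → c ∉ L → f c = b := by
        by_cases hc : i ∈ L ∧ ∃ c, par c = i ∧ m < c ∧ c ∉ L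
        · obtain ⟨hiL, c, hc1, hc2, hc3⟩ := hc
          refine ⟨f c, fun _ c' h1 h2 h3 => ?_⟩
          rw [hsib i hiL c' c h1 hc1 h2 hc2 h3 hc3]
        · exact ⟨f i, fun hiL c h1 h2 h3 => absurd ⟨hiL, c, h1, h2, h3⟩ hc⟩
      refine (hW (f (par i)) b).trans (Nat.cast_le.2 (Finset.card_le_card fun v hv => ?_))
      obtain ⟨hvW, hv⟩ := Finset.mem_inter.1 hv
      obtain ⟨hv1, hv2⟩ := Finset.mem_inter.1 hv
      exact Finset.mem_filter.2 ⟨hvW, fun _ => hv1,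
        fun hiL c h1 h2 h3 => by rw [hb hiL c h1 h2 h3]; exact hv2⟩)
  refine ⟨w, hw, fun f hf => ?_, fun S y => ?_⟩
  · obtain ⟨h1, h2, h3⟩ := hs f hf
    refine ⟨h1, h2, fun i hi => (h3 i hi).1, fun k hmk' hk => ?_⟩
    by_cases hkL : k ∈ L
    · exact mem_nb.1 ((h3 k (hLY hkL)).2.1 (Or.inl hkL))
    by_cases hpL : par k ∈ L
    · exact (mem_nb.1 ((h3 _ (hLY hpL)).2.2 hpL k rfl (hmlt hmk' hkL) hkL)).symm
    have hkY : k ∈ Y := hk.elim id (hY k (hmlt hmk' hkL) hkL hpL).2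
    exact mem_nb.1 ((h3 k hkY).2.1 (Or.inr hpL))
  · refine (hp S y).trans (le_of_eq ?_)
    congr!

end Connect

section Assembly
open scoped Classical

variable {n : ℕ}

/-- Relative spread of a random function that differs from `g` only on `Z`. -/
theorem pr_le_of_override {w : (Fin n → Fin n) → ℝ} (hw : IsProb w) {Z X X' : Finset (Fin n)}
    {g : Fin n → Fin n} (hsupp : ∀ ψ, w ψ ≠ 0 → ∀ i ∈ X', i ∉ Z → ψ i = g i)
    (hXZ : ∀ i ∈ X', i ∉ X → i ∈ Z) {A B : ℝ} (hA : 0 ≤ A) (hB0 : 0 ≤ B) (hB1 : B ≤ 1)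
    (hsp : ∀ S ⊆ Z, ∀ y : Fin n → Fin n, pr w (fun ψ => ∀ i ∈ S, ψ i = y i) ≤ A * B ^ #S)
    (S : Finset (Fin n)) (hS : S ⊆ X') (y : Fin n → Fin n) :
    pr w (fun ψ => ∀ i ∈ S, ψ i = y i) ≤ A * B ^ #{i ∈ S | i ∉ X ∨ g i ≠ y i} := by
  by_cases h : ∃ i ∈ S, i ∉ Z ∧ g i ≠ y i
  · obtain ⟨i, hi, hiZ, hgi⟩ := h
    have h0 : pr w (fun ψ => ∀ i ∈ S, ψ i = y i) = 0 := by
      refine Finset.sum_eq_zero fun ψ _ => ?_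
      by_cases hψ : w ψ = 0
      · rw [hψ, zero_mul]
      · rw [ind_not (fun h => hgi (by rw [← h i hi, hsupp ψ hψ i (hS hi) hiZ])), mul_zero]
    rw [h0]; positivity
  · push Not at h
    calc _ ≤ pr w (fun ψ => ∀ i ∈ S ∩ Z, ψ i = y i) :=
          pr_mono hw.nonneg fun ψ _ h i hi => h i (Finset.mem_inter.1 hi).1
      _ ≤ A * B ^ #(S ∩ Z) := hsp _ Finset.inter_subset_right y
      _ ≤ _ := by
          refine mul_le_mul_of_nonneg_left (pow_le_pow_of_le_one hB0 hB1
            (Finset.card_le_card fun i hi => ?_)) hA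
          obtain ⟨hiS, hi⟩ := Finset.mem_filter.1 hi
          refine Finset.mem_inter.2 ⟨hiS, ?_⟩
          rcases hi with hi | hi
          · exact hXZ i (hS hiS) hi
          · by_contra hiZ
            exact hi (h i hiS hiZ)

/-- The vertices below `m` are embedded outside of `W`, with many candidates for absorption. -/
structure IsBody (G : SimpleGraph (Fin n)) (par : Fin n → Fin n) (m : Fin n)
    (I W : Finset (Fin n)) (c : ℝ) (f : Fin n → Fin n) : Prop where
  injOn : Set.InjOn f {i | i < m}
  notMem : ∀ i < m, f i ∉ W
  adj : ∀ i < m, i.val ≠ 0 → G.Adj (f (par i)) (f i)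
  count : ∀ a b d, c * n ≤ #{x ∈ I | f x ∈ nb G a ∩ nb G b ∧ f (par x) ∈ nb G d ∧
    ∀ y, par y = x → f y ∈ nb G d}

theorem IsBody.congr {G : SimpleGraph (Fin n)} {par : Fin n → Fin n} {m : Fin n}
    {I W : Finset (Fin n)} {c : ℝ} {f g : Fin n → Fin n} (h : IsBody G par m I W c f)
    (hpar : ∀ k : Fin n, k.val ≠ 0 → par k < k) (hcross : ∀ k, m < k → m ≤ par k)
    (hI : ∀ x ∈ I, x < m ∧ (par x).val ≠ 0 ∧ x ≠ par m ∧
      #({c | par c = x} : Finset (Fin n)) ≤ 1)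
    (hI0 : ∀ x ∈ I, x.val ≠ 0) (hfg : ∀ i < m, g i = f i) : IsBody G par m I W c g := by
  refine ⟨fun a ha b hb hab => h.injOn ha hb ?_, fun i hi => ?_, fun i hi hi0 => ?_,
    fun a b d => (h.count a b d).trans (Nat.cast_le.2 (Finset.card_le_card fun x hx => ?_))⟩
  · rwa [hfg a ha, hfg b hb] at hab
  · rw [hfg i hi]; exact h.notMem i hi
  · rw [hfg i hi, hfg _ ((hpar i hi0).trans hi)]; exact h.adj i hi hi0
  · obtain ⟨hxI, h1, h2, h3⟩ := Finset.mem_filter.1 hx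
    obtain ⟨hxm, -, hxp, -⟩ := hI x hxI
    refine Finset.mem_filter.2 ⟨hxI, ?_, ?_, fun y hy => ?_⟩
    · rw [hfg x hxm]; exact h1
    · rw [hfg _ ((hpar x (hI0 x hxI)).trans hxm)]; exact h2
    · rw [hfg y]
      · exact h3 y hy
      · rcases lt_trichotomy y m with h | rfl | h
        · exact h
        · exact absurd hy.symm hxp
        · exact absurd (hy ▸ hcross y h) (not_le.2 hxm)

/-- Besides the vertices below `m`, those in `X` are embedded; the edges that are still missing
are covered by few vertices. -/
structure IsBulk (G : SimpleGraph (Fin n)) (par : Fin n → Fin n) (m : Fin n)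
    (I J W L X : Finset (Fin n)) (c β : ℝ) (f : Fin n → Fin n) : Prop where
  body : IsBody G par m I W c f
  injOn : Set.InjOn f {i | (i < m ∨ i ∈ X) ∧ i ∉ J}
  notMem : ∀ x ∈ X, f x ∉ W
  adj : ∃ Y ⊆ X, (#Y : ℝ) ≤ β ∧ (∀ x ∈ X, par x ∉ L → (x ∈ Y ↔ par x ∈ Y)) ∧
    ∀ x ∈ X, par x ∉ L → x ∉ Y → G.Adj (f (par x)) (f x)

variable {G : SimpleGraph (Fin n)} {par : Fin n → Fin n} {m : Fin n}
  {I J W L X : Finset (Fin n)} {grp : Fin n → Finset ℕ × ℕ} {cell : Fin n → ℕ} {q K : ℕ} {c : ℝ}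

theorem exists_bulk_step {δ : ℝ} (hδ : 0 < δ) (hδ1 : δ < 1)
    (hG : ∀ v, (1 / 2 + δ) * n ≤ #(nb G v))
    (hpar : ∀ k : Fin n, k.val ≠ 0 → par k < k) (hcross : ∀ k, m < k → m ≤ par k)
    (hI : ∀ x ∈ I, x < m ∧ (par x).val ≠ 0 ∧ x ≠ par m ∧
      #({c | par c = x} : Finset (Fin n)) ≤ 1)
    (hI0 : ∀ x ∈ I, x.val ≠ 0) (hJI : J ⊆ I) (hJW : #J = #W)
    (hsmall : (#W + m.val : ℝ) ≤ δ / 2 * n)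
    (hB : IsBundling par m L X grp cell q)
    (hK : ∀ x ∈ X, #{y ∈ X | grp y = grp x} ≤ q * K) (hqn : 4 * (q + 1) ^ 2 ≤ n)
    {B : ℝ} (hB1 : B ≤ 1) (hqB : 6 * q / n ≤ B)
    {f : Fin n → Fin n} (hf : IsBody G par m I W c f) :
    ∃ w : (Fin n → Fin n) → ℝ, IsProb w ∧
      (∀ φ, w φ ≠ 0 →
        IsBulk G par m I J W L X c (8 * q ^ 2 * K * (1 - (δ / 2) ^ 2 / 2) ^ q * n + 1) φ) ∧
      ∀ S ⊆ ({i | i < m ∨ i ∈ X} : Finset (Fin n)), ∀ y : Fin n → Fin n,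
        pr w (fun φ => ∀ i ∈ S, φ i = y i) ≤
          2 * B ^ #{i ∈ S | i ∉ ({i | i < m} : Finset (Fin n)) ∨ f i ≠ y i} := by
  have hB0 : 0 ≤ B := le_trans (by positivity) hqB
  have hJm : ∀ j ∈ J, j < m := fun j hj => (hI j (hJI hj)).1
  have hn0 : (0 : ℝ) < n := by exact_mod_cast m.pos
  set P : Finset (Fin n) := (Finset.Iio m \ J).image f with hP
  have hPc : #P + #J = m.val := by
    rw [hP, Finset.card_image_of_injOn, Finset.card_sdiff_of_subset, Fin.card_Iio]
    · have := Finset.card_le_card (s := J) (t := Finset.Iio m) fun j hj =>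
        Finset.mem_Iio.2 (hJm j hj)
      rw [Fin.card_Iio] at this
      omega
    · exact fun j hj => Finset.mem_Iio.2 (hJm j hj)
    · intro a ha b hb hab
      exact hf.injOn (Finset.mem_Iio.1 (Finset.mem_sdiff.1 ha).1)
        (Finset.mem_Iio.1 (Finset.mem_sdiff.1 hb).1) hab
  have hWP : #(W ∪ P) = m.val := by
    rw [Finset.card_union_of_disjoint, ← hJW, add_comm, hPc]
    refine Finset.disjoint_right.2 fun v hv => ?_
    obtain ⟨i, hi, rfl⟩ := Finset.mem_image.1 hv
    exact hf.notMem i (Finset.mem_Iio.1 (Finset.mem_sdiff.1 hi).1)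
  set U : Finset (Fin n) := Finset.univ \ (W ∪ P) with hU
  have hUc : #U + m.val = n := by
    rw [hU, Finset.card_sdiff_of_subset (Finset.subset_univ _), hWP, Finset.card_univ,
      Fintype.card_fin]
    have := m.2; omega
  have hUr : (#U : ℝ) + m.val = n := by exact_mod_cast hUc
  have hUn : (n : ℝ) / 2 ≤ #U := by
    have h1 : (0 : ℝ) ≤ #W := Nat.cast_nonneg _
    nlinarith
  have hXU : #X ≤ #U := by
    have h1 : X ⊆ Finset.Ioi m := fun x hx => Finset.mem_Ioi.2 (hB.lt x hx).1
    have h2 := Finset.card_le_card h1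
    rw [Fin.card_Ioi] at h2
    omega
  have hqU : 2 * (q + 1) ^ 2 ≤ #U := by
    have h1 : (4 * (q + 1) ^ 2 : ℝ) ≤ n := by exact_mod_cast hqn
    have h2 : (2 * (q + 1) ^ 2 : ℝ) ≤ #U := by linarith
    exact_mod_cast h2
  have hGU : ∀ v, (1 / 2 + δ / 2) * #U ≤ #(nb G v ∩ U) := by
    intro v
    have h1 : nb G v ⊆ (nb G v ∩ U) ∪ (W ∪ P) := fun u hu => by
      by_cases h : u ∈ W ∪ P
      · exact Finset.mem_union_right _ h
      · exact Finset.mem_union_left _ (Finset.mem_inter.2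
          ⟨hu, Finset.mem_sdiff.2 ⟨Finset.mem_univ _, h⟩⟩)
    have h2 := (Finset.card_le_card h1).trans (Finset.card_union_le _ _)
    rw [hWP] at h2
    have h3 : (#(nb G v) : ℝ) ≤ #(nb G v ∩ U) + m.val := by exact_mod_cast h2
    have h4 := hG v
    have h5 : (0 : ℝ) ≤ #W := Nat.cast_nonneg _
    have h6 : (0 : ℝ) ≤ m.val := Nat.cast_nonneg _
    nlinarith
  obtain ⟨w, hw, hs, hp⟩ := exists_bulk (δ := δ / 2) (by positivity) (by linarith) hB hpar hK
    hXU hqU hGU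
  obtain ⟨w', hw', hs', hp'⟩ := exists_map hw fun φ i => if i < m then f i else φ i
  have hXm : ∀ x ∈ X, ¬ x < m := fun x hx => not_lt.2 (hB.lt x hx).1.le
  refine ⟨w', hw', fun φ hφ => ?_, fun S hS y => pr_le_of_override hw' (Z := X) (g := f)
    (fun ψ hψ i hi hiX => ?_) (fun i hi hi' => ?_) (by norm_num) hB0 hB1 (fun S hS y => ?_) S hS y⟩
  · obtain ⟨σ, hσ, rfl⟩ := hs' φ hφ
    obtain ⟨h1, h2, Y, hYX, hYc, hYcl, hYadj⟩ := hs σ hσ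
    have hUP : ∀ i < m, i ∉ J → f i ∉ U := fun i hi hiJ h =>
      (Finset.mem_sdiff.1 h).2 (Finset.mem_union_right _ (Finset.mem_image.2
        ⟨i, Finset.mem_sdiff.2 ⟨Finset.mem_Iio.2 hi, hiJ⟩, rfl⟩))
    refine ⟨hf.congr hpar hcross hI hI0 fun i hi => by simp only [if_pos hi], ?_, fun x hx h => ?_,
      Y, hYX, hYc, hYcl, fun x hx hxL hxY => ?_⟩
    · rintro a ⟨ha, haJ⟩ b ⟨hb, hbJ⟩ hab
      by_cases ham : a < m <;> by_cases hbm : b < m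
      · simp only [if_pos ham, if_pos hbm] at hab
        exact hf.injOn ham hbm hab
      · simp only [if_pos ham, if_neg hbm] at hab
        exact absurd (hab ▸ h2 b (hb.resolve_left hbm)) (hUP a ham haJ)
      · simp only [if_neg ham, if_pos hbm] at hab
        exact absurd (hab ▸ h2 a (ha.resolve_left ham)) (hUP b hbm hbJ)
      · simp only [if_neg ham, if_neg hbm] at hab
        exact h1 (ha.resolve_left ham) (hb.resolve_left hbm) hab
    · simp only [if_neg (hXm x hx)] at h
      exact (Finset.mem_sdiff.1 (h2 x hx)).2 (Finset.mem_union_left _ h)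
    · have hpX := (hB.mem_iff x (hB.lt x hx).1 (hB.lt x hx).2 hxL).1 hx
      simp only [if_neg (hXm x hx), if_neg (hXm _ hpX)]
      exact hYadj x hx hxL hxY
  · obtain ⟨σ, hσ, rfl⟩ := hs' ψ hψ
    have him : i < m := (Finset.mem_filter.1 hi).2.resolve_right hiX
    simp only [if_pos him]
  · exact (Finset.mem_filter.1 hi).2.resolve_left fun h =>
      hi' (Finset.mem_filter.2 ⟨Finset.mem_univ _, h⟩)
  · rw [hp']
    calc _ = pr w (fun φ => ∀ i ∈ S, φ i = y i) := by
          refine pr_congr fun φ _ => ?_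
          refine forall₂_congr fun i hi => ?_
          simp only [if_neg (hXm i (hS hi))]
      _ ≤ 2 * (3 * q / #U) ^ #S := hp S hS y
      _ ≤ 2 * B ^ #S := by
          refine mul_le_mul_of_nonneg_left (pow_le_pow_left₀ (by positivity) (le_trans ?_ hqB) _)
            (by norm_num)
          rw [div_le_div_iff₀ (by linarith) hn0]
          have : (0 : ℝ) ≤ q := Nat.cast_nonneg _
          nlinarith

end Assembly

section Connection
open scoped Classical

variable {n : ℕ} {G : SimpleGraph (Fin n)} {par : Fin n → Fin n} {m : Fin n}
  {I J W L X : Finset (Fin n)} {grp : Fin n → Finset ℕ × ℕ} {cell : Fin n → ℕ} {q : ℕ} {c : ℝ}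

theorem exists_connect_step (hpar : ∀ k : Fin n, k.val ≠ 0 → par k < k)
    (hcross : ∀ k, m < k → m ≤ par k) (hm0 : m.val ≠ 0)
    (hI : ∀ x ∈ I, x < m ∧ (par x).val ≠ 0 ∧ x ≠ par m ∧
      #({c | par c = x} : Finset (Fin n)) ≤ 1)
    (hI0 : ∀ x ∈ I, x.val ≠ 0) (hJI : J ⊆ I)
    (hmL : m ∈ L) (hL : ∀ l ∈ L, m ≤ l)
    (hsib : ∀ l ∈ L, ∀ c c', par c = l → par c' = l → m < c → m < c' → c ∉ L → c' ∉ L → c = c')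
    (hB : IsBundling par m L X grp cell q) {β D B : ℝ} (hD : 0 < D)
    (hW : ∀ a b, D + (#L + #({k | m < k ∧ k ∉ L ∧ k ∉ X} : Finset (Fin n)) + β) ≤
      #(W ∩ (nb G a ∩ nb G b)))
    (hB1 : B ≤ 1) (hDB : 1 / D ≤ B)
    {φ : Fin n → Fin n} (hφ : IsBulk G par m I J W L X c β φ) :
    ∃ w : (Fin n → Fin n) → ℝ, IsProb w ∧
      (∀ f, w f ≠ 0 → Set.InjOn f {k | k ∉ J} ∧
        (∀ k : Fin n, k.val ≠ 0 → k ∉ J → par k ∉ J → G.Adj (f (par k)) (f k)) ∧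
        ∀ a b d, c * n ≤ #{x ∈ I | f x ∈ nb G a ∩ nb G b ∧ f (par x) ∈ nb G d ∧
          ∀ y, par y = x → f y ∈ nb G d}) ∧
      ∀ (S : Finset (Fin n)) (y : Fin n → Fin n), pr w (fun f => ∀ i ∈ S, f i = y i) ≤
          1 * B ^ #{i ∈ S | i ∉ ({i | i < m ∨ i ∈ X} : Finset (Fin n)) ∨ φ i ≠ y i} := by
  have hB0 : 0 ≤ B := le_trans (by positivity) hDB
  obtain ⟨Yb, hYbX, hYbc, hYbcl, hYbadj⟩ := hφ.adj
  set Y : Finset (Fin n) := {k | m ≤ k ∧ (k ∉ X ∨ k ∈ Yb)} with hYdef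
  have hXL : ∀ x ∈ X, x ∉ L := fun x hx => (hB.lt x hx).2
  have hmY : ∀ k, k ∈ Y ↔ m ≤ k ∧ (k ∉ X ∨ k ∈ Yb) := fun k => by simp [hYdef]
  have hLY : L ⊆ Y := fun l hl => (hmY l).2 ⟨hL l hl, Or.inl fun h => hXL l h hl⟩
  have hYc : (#Y : ℝ) ≤ #L + #({k | m < k ∧ k ∉ L ∧ k ∉ X} : Finset (Fin n)) + β := by
    have h1 : Y ⊆ (L ∪ ({k | m < k ∧ k ∉ L ∧ k ∉ X} : Finset (Fin n))) ∪ Yb := fun k hk => by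
      obtain ⟨h1, h2⟩ := (hmY k).1 hk
      by_cases hb : k ∈ Yb
      · exact Finset.mem_union_right _ hb
      refine Finset.mem_union_left _ ?_
      by_cases hkL : k ∈ L
      · exact Finset.mem_union_left _ hkL
      · refine Finset.mem_union_right _ (Finset.mem_filter.2 ⟨Finset.mem_univ _,
          lt_of_le_of_ne h1 fun h => hkL (h ▸ hmL), hkL, h2.resolve_right hb⟩)
    have h2 := (Finset.card_le_card h1).trans ((Finset.card_union_le _ _).trans
      (Nat.add_le_add_right (Finset.card_union_le _ _) _))
    have h3 : (#Y : ℝ) ≤ #L + #({k | m < k ∧ k ∉ L ∧ k ∉ X} : Finset (Fin n)) + #Yb := by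
      exact_mod_cast h2
    linarith
  obtain ⟨w, hw, hs, hp⟩ := exists_connect hpar hm0 hmL hLY hsib (fun k hk => ((hmY k).1 hk).1)
    (fun k hmk hkL hpL => by
      have hpm := hcross k hmk
      have h1 := hB.mem_iff k hmk hkL hpL
      rw [hmY, hmY]
      by_cases hkX : k ∈ X
      · have h2 := hYbcl k hkX hpL
        have h3 := h1.1 hkX
        simp only [hmk.le, hpm, hkX, h3, not_true_eq_false, false_or, true_and, h2]
      · have h3 : par k ∉ X := fun h => hkX (h1.2 h)
        simp only [hmk.le, hpm, hkX, h3, not_false_eq_true, true_or, true_and])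
    φ hD (fun a b => le_trans (by linarith) (hW a b))
  have hJm : ∀ j ∈ J, j < m := fun j hj => (hI j (hJI hj)).1
  refine ⟨w, hw, fun f hf => ?_, fun S y => pr_le_of_override hw
    (Z := Y) (X' := Finset.univ) (g := φ)
    (fun ψ hψ i _ hi => (hs ψ hψ).1 i hi) (fun i _ hi => ?_) zero_le_one hB0 hB1
    (fun S hS y => ?_) S (Finset.subset_univ _) y⟩
  · obtain ⟨h1, h2, h3, h4⟩ := hs f hf
    have hlow : ∀ i < m, f i = φ i := fun i hi => h1 i fun h => not_le.2 hi ((hmY i).1 h).1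
    have hbody := hφ.body.congr hpar hcross hI hI0 hlow
    have hin : ∀ i, i ∉ Y → i < m ∨ i ∈ X := fun i hi => by
      by_contra hn
      push Not at hn
      exact hi ((hmY i).2 ⟨hn.1, Or.inl hn.2⟩)
    have hout : ∀ i, i ∉ Y → f i ∉ W := fun i hi => by
      rw [h1 i hi]
      exact (hin i hi).elim (hφ.body.notMem i) (hφ.notMem i)
    refine ⟨fun a ha b hb hab => ?_, fun k hk0 hkJ hpJ => ?_, hbody.count⟩
    · by_cases haY : a ∈ Y <;> by_cases hbY : b ∈ Y
      · exact h2 haY hbY hab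
      · exact absurd (hab ▸ h3 a haY) (hout b hbY)
      · exact absurd (hab ▸ h3 b hbY) (hout a haY)
      · exact hφ.injOn ⟨hin a haY, ha⟩ ⟨hin b hbY, hb⟩ (by rw [← h1 a haY, ← h1 b hbY, hab])
    · rcases lt_or_ge k m with hkm | hkm
      · exact hbody.adj k hkm hk0
      by_cases hY : k ∈ Y ∨ par k ∈ Y
      · exact h4 k hkm hY
      push Not at hY
      obtain ⟨hkY, hpY⟩ := hY
      have hkX : k ∈ X := (hin k hkY).resolve_left (not_lt.2 hkm)
      rw [h1 k hkY, h1 _ hpY]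
      exact hYbadj k hkX (fun h => hpY (hLY h)) fun h => hkY ((hmY k).2 ⟨hkm, Or.inr h⟩)
  · by_contra hiY
    refine hi (Finset.mem_filter.2 ⟨Finset.mem_univ _, ?_⟩)
    by_contra hn
    push Not at hn
    exact hiY ((hmY i).2 ⟨hn.1, Or.inl hn.2⟩)
  · refine (hp S y).trans ?_
    rw [Finset.filter_true_of_mem fun i hi => hS hi, one_mul]
    exact pow_le_pow_left₀ (by positivity) hDB _

end Connection

section Embedding
open scoped Classical

theorem exists_sq_mul_pow_le {A ρ ε : ℝ} (hρ0 : 0 ≤ ρ) (hρ : ρ < 1) (hε : 0 < ε) :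
    ∃ q : ℕ, 1 ≤ q ∧ A * ((q : ℝ) ^ 2 * ρ ^ q) ≤ ε := by
  have h1 := (tendsto_pow_const_mul_const_pow_of_abs_lt_one 2
    (r := ρ) (by rwa [abs_of_nonneg hρ0])).const_mul A
  rw [mul_zero] at h1
  obtain ⟨q, hq1, hq⟩ := ((Filter.eventually_ge_atTop 1).and
    (h1.eventually (gt_mem_nhds hε))).exists
  exact ⟨q, hq1, hq.le⟩

variable {n : ℕ} {G : SimpleGraph (Fin n)} {par : Fin n → Fin n} {m : Fin n}
  {I J W L X : Finset (Fin n)} {q K : ℕ} {δ c : ℝ}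

/-- Successive random extension of a distribution on bodies to one on embeddings. -/
theorem exists_spread_of_body {grp : Fin n → Finset ℕ × ℕ} {cell : Fin n → ℕ}
    (hδ : 0 < δ) (hδ1 : δ < 1) (hG : ∀ v, (1 / 2 + δ) * n ≤ #(nb G v))
    (hpar : ∀ k : Fin n, k.val ≠ 0 → par k < k) (hcross : ∀ k, m < k → m ≤ par k)
    (hm0 : m.val ≠ 0) (hIdis : (I : Set (Fin n)).PairwiseDisjoint (block par))
    (hI : ∀ x ∈ I, x < m ∧ (par x).val ≠ 0 ∧ x ≠ par m ∧
      #({c | par c = x} : Finset (Fin n)) ≤ 1)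
    (hI0 : ∀ x ∈ I, x.val ≠ 0) (hJI : J ⊆ I) (hJW : #J = #W)
    (hsmall : (#W + m.val : ℝ) ≤ δ / 2 * n) (hmL : m ∈ L) (hL : ∀ l ∈ L, m ≤ l)
    (hsib : ∀ l ∈ L, ∀ c c', par c = l → par c' = l → m < c → m < c' → c ∉ L → c' ∉ L → c = c')
    (hB : IsBundling par m L X grp cell q)
    (hgK : ∀ x ∈ X, #{y ∈ X | grp y = grp x} ≤ q * K) (hqn : 4 * (q + 1) ^ 2 ≤ n)
    {B : ℝ} (hB0 : 0 ≤ B) (hB4 : 4 * B ≤ 1) (hqB : 6 * q / n ≤ B)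
    {D₁ : ℝ} (hD₁ : 0 < D₁) (hDB₁ : 1 / D₁ ≤ 2 * B)
    (hW : ∀ a b, D₁ + (#L + #({k | m < k ∧ k ∉ L ∧ k ∉ X} : Finset (Fin n)) +
      (8 * q ^ 2 * K * (1 - (δ / 2) ^ 2 / 2) ^ q * n + 1)) ≤ #(W ∩ (nb G a ∩ nb G b)))
    {D₂ : ℝ} (hD₂ : 0 < D₂) (hDB₂ : 1 / D₂ ≤ 4 * B) (hJc : D₂ + 2 * #J ≤ c * n)
    (hJB : 3 / #J ≤ 4 * B)
    {w₁ : (Fin n → Fin n) → ℝ} (hw₁ : IsProb w₁) (hs₁ : ∀ f, w₁ f ≠ 0 → IsBody G par m I W c f)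
    (hp₁ : ∀ S ⊆ ({i | i < m} : Finset (Fin n)), ∀ y : Fin n → Fin n,
      pr w₁ (fun f => ∀ i ∈ S, f i = y i) ≤ 2 * B ^ #S) :
    ∃ w : (Fin n → Fin n) → ℝ, IsProb w ∧
      (∀ ψ, w ψ ≠ 0 → Function.Injective ψ ∧
        ∀ k : Fin n, k.val ≠ 0 → G.Adj (ψ (par k)) (ψ k)) ∧
      ∀ (S : Finset (Fin n)) (y : Fin n → Fin n),
        pr w (fun ψ => ∀ i ∈ S, ψ i = y i) ≤ 4 * (8 * B) ^ #S := by
  obtain ⟨β, hβ⟩ : ∃ β : ℝ, β = 8 * q ^ 2 * K * (1 - (δ / 2) ^ 2 / 2) ^ q * n + 1 := ⟨_, rfl⟩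
  rw [← hβ] at hW
  have hk2 : ∀ f, ∃ w : (Fin n → Fin n) → ℝ, w₁ f ≠ 0 → IsProb w ∧
      (∀ φ, w φ ≠ 0 → IsBulk G par m I J W L X c β φ) ∧
      ∀ S ⊆ ({i | i < m ∨ i ∈ X} : Finset (Fin n)), ∀ y : Fin n → Fin n,
        pr w (fun φ => ∀ i ∈ S, φ i = y i) ≤
          2 * B ^ #{i ∈ S | i ∉ ({i | i < m} : Finset (Fin n)) ∨ f i ≠ y i} := fun f => by
    by_cases hf : w₁ f = 0
    · exact ⟨fun _ => 0, fun h => absurd hf h⟩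
    · obtain ⟨w, hw⟩ := exists_bulk_step hδ hδ1 hG hpar hcross hI hI0 hJI hJW hsmall hB
        hgK hqn (B := B) (by linarith) hqB (hs₁ f hf)
      exact ⟨w, fun _ => hβ ▸ hw⟩
  choose κ₂ hκ₂ using hk2
  obtain ⟨w₂, hw₂def⟩ : ∃ w₂, w₂ = mix w₁ κ₂ := ⟨_, rfl⟩
  have hw₂ : IsProb w₂ := hw₂def ▸ hw₁.mix fun f hf => (hκ₂ f hf).1
  have hs₂ : ∀ φ, w₂ φ ≠ 0 → IsBulk G par m I J W L X c β φ := fun φ hφ => by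
    obtain ⟨f, hf, hφ⟩ := mix_ne_zero (hw₂def ▸ hφ)
    exact (hκ₂ f hf).2.1 φ hφ
  have hp₂ : ∀ S ⊆ ({i | i < m ∨ i ∈ X} : Finset (Fin n)), ∀ y : Fin n → Fin n,
      pr w₂ (fun φ => ∀ i ∈ S, φ i = y i) ≤ 4 * (2 * B) ^ #S := fun S hS y => by
    rw [hw₂def]
    have h := pr_mix_spread hw₁.nonneg (κ := κ₂) (X := ({i | i < m} : Finset (Fin n)))
      (A := 2) (A' := 2) (by norm_num) hB0 (fun S hS y => ?_)
      (fun f hf S hS y => (hκ₂ f hf).2.2 S hS y) S hS y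
    · exact h.trans (by norm_num)
    · exact hp₁ S hS y
  have hk3 : ∀ φ, ∃ w : (Fin n → Fin n) → ℝ, w₂ φ ≠ 0 → IsProb w ∧
      (∀ f, w f ≠ 0 → Set.InjOn f {k | k ∉ J} ∧
        (∀ k : Fin n, k.val ≠ 0 → k ∉ J → par k ∉ J → G.Adj (f (par k)) (f k)) ∧
        ∀ a b d, c * n ≤ #{x ∈ I | f x ∈ nb G a ∩ nb G b ∧ f (par x) ∈ nb G d ∧
          ∀ y, par y = x → f y ∈ nb G d}) ∧
      ∀ (S : Finset (Fin n)) (y : Fin n → Fin n), pr w (fun f => ∀ i ∈ S, f i = y i) ≤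
          1 * (2 * B) ^ #{i ∈ S | i ∉ ({i | i < m ∨ i ∈ X} : Finset (Fin n)) ∨ φ i ≠ y i} :=
    fun φ => by
    by_cases hφ : w₂ φ = 0
    · exact ⟨fun _ => 0, fun h => absurd hφ h⟩
    · obtain ⟨w, hw⟩ := exists_connect_step hpar hcross hm0 hI hI0 hJI hmL hL hsib hB
        hD₁ hW (by linarith) hDB₁ (hs₂ φ hφ)
      exact ⟨w, fun _ => hw⟩
  choose κ₃ hκ₃ using hk3
  obtain ⟨w₃, hw₃def⟩ : ∃ w₃, w₃ = mix w₂ κ₃ := ⟨_, rfl⟩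
  have hw₃ : IsProb w₃ := hw₃def ▸ hw₂.mix fun f hf => (hκ₃ f hf).1
  have hp₃ : ∀ (S : Finset (Fin n)) (y : Fin n → Fin n),
      pr w₃ (fun φ => ∀ i ∈ S, φ i = y i) ≤ 4 * (4 * B) ^ #S := fun S y => by
    rw [hw₃def]
    have h := pr_mix_spread hw₂.nonneg (κ := κ₃) (X' := Finset.univ) (A := 4) (A' := 1)
      zero_le_one (by positivity) hp₂
      (fun f hf S _ y => (hκ₃ f hf).2.2 S y) S (Finset.subset_univ _) y
    refine h.trans (le_of_eq ?_)
    rw [mul_one, ← mul_assoc]; norm_num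
  have hk4 : ∀ φ, ∃ w : (Fin n → Fin n) → ℝ, w₃ φ ≠ 0 → IsProb w ∧
      (∀ ψ, w ψ ≠ 0 → Function.Injective ψ ∧
        ∀ k : Fin n, k.val ≠ 0 → G.Adj (ψ (par k)) (ψ k)) ∧
      ∀ (S : Finset (Fin n)) (y : Fin n → Fin n), pr w (fun ψ => ∀ k ∈ S, ψ k = y k) ≤
        (4 * B) ^ #{k ∈ S | k ∈ J ∨ φ k ≠ y k} := fun φ => by
    by_cases hφ : w₃ φ = 0
    · exact ⟨fun _ => 0, fun h => absurd hφ h⟩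
    · obtain ⟨φ', hφ', hφφ⟩   := mix_ne_zero (hw₃def ▸ hφ)
      obtain ⟨h1, h2, h3⟩ := (hκ₃ φ' hφ').2.1 φ hφφ
      obtain ⟨w, hw⟩ := exists_absorb hpar hIdis (fun x hx => ⟨hI0 x hx, (hI x hx).2.2.2⟩) hJI h1
        h2 hD₂ (fun a b d => hJc.trans (h3 a b d)) hB4 hDB₂ hJB
      exact ⟨w, fun _ => hw⟩
  choose κ₄ hκ₄ using hk4
  refine ⟨mix w₃ κ₄, hw₃.mix fun f hf => (hκ₄ f hf).1, fun ψ hψ => ?_, fun S y => ?_⟩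
  · obtain ⟨f, hf, hψ⟩ := mix_ne_zero hψ
    exact (hκ₄ f hf).2.1 ψ hψ
  · have h := pr_mix_spread hw₃.nonneg (κ := κ₄) (X := Finset.univ \ J) (X' := Finset.univ)
      (A := 4) (A' := 1) zero_le_one (show 0 ≤ 4 * B by positivity) (fun S _ y => hp₃ S y)
      (fun f hf S _ y => ((hκ₄ f hf).2.2 S y).trans (le_of_eq ?_)) S (Finset.subset_univ _) y
    · refine h.trans (le_of_eq ?_)
      rw [mul_one, ← mul_assoc]; norm_num
    · rw [one_mul]
      congr 2
      refine Finset.filter_congr fun i _ => ?_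
      simp

set_option maxHeartbeats 2000000 in
/-- A spread probability distribution on embeddings of a spanning tree, given by its parent
function `par`, into a graph of minimum degree at least `(1 / 2 + δ) * n`. -/
theorem exists_spread_embedding (D : ℕ) (hD : 1 ≤ D) {δ : ℝ} (hδ : 0 < δ) (hδ1 : δ < 1) :
    ∃ C : ℝ, 1 ≤ C ∧ ∃ n₀ : ℕ, ∀ n ≥ n₀, ∀ G : SimpleGraph (Fin n),
    (∀ v, (1 / 2 + δ) * n ≤ #(nb G v)) → ∀ (par : Fin n → Fin n) (m : Fin n),
    (∀ k : Fin n, k.val = 0 → par k = k) → (∀ k : Fin n, k.val ≠ 0 → par k < k) →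
    (∀ k, m < k → m ≤ par k) → (∀ v, #({c | par c = v} : Finset (Fin n)) ≤ D) →
    δ ^ 2 / (8 * D) * n ≤ m.val → (m.val : ℝ) ≤ δ ^ 2 / 4 * n →
    ∃ w : (Fin n → Fin n) → ℝ, IsProb w ∧
      (∀ ψ, w ψ ≠ 0 → Function.Injective ψ ∧
        ∀ k : Fin n, k.val ≠ 0 → G.Adj (ψ (par k)) (ψ k)) ∧
      ∀ (S : Finset (Fin n)) (y : Fin n → Fin n),
        pr w (fun ψ => ∀ i ∈ S, ψ i = y i) ≤ C * (C / n) ^ #S := by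
  have hDr : (1 : ℝ) ≤ D := by exact_mod_cast hD
  have hD0 : (0 : ℝ) < D := by linarith
  have hδ2 : δ ^ 2 ≤ δ := by nlinarith
  obtain ⟨E, hE⟩ : ∃ x : ℝ, x = 2 + D + D ^ 2 := ⟨_, rfl⟩
  have hE1 : 1 ≤ E := by nlinarith
  have hE0 : 0 < E := by linarith
  obtain ⟨μ, hμ⟩ : ∃ x : ℝ, x = δ ^ 2 / (8 * D) := ⟨_, rfl⟩
  have hμ0 : 0 < μ := by rw [hμ]; positivity
  have hμδ : μ ≤ δ ^ 2 / 8 := by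
    rw [hμ]; exact div_le_div_of_nonneg_left (by positivity) (by norm_num) (by linarith)
  obtain ⟨c₁, hc₁⟩ : ∃ x : ℝ, x = μ / (16 * E) := ⟨_, rfl⟩
  have hc₁0 : 0 < c₁ := by rw [hc₁]; positivity
  have hc₁E : c₁ * (16 * E) = μ := by rw [hc₁]; field_simp
  have hc₁μ : c₁ ≤ μ := by nlinarith
  obtain ⟨c₂, hc₂⟩ : ∃ x : ℝ, x = δ ^ 8 * c₁ / 64 := ⟨_, rfl⟩
  have hc₂0 : 0 < c₂ := by rw [hc₂]; positivity
  have hc₂1 : c₂ ≤ c₁ := by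
    have : δ ^ 8 ≤ 1 := pow_le_one₀ hδ.le hδ1.le
    rw [hc₂]; nlinarith
  obtain ⟨η, hη⟩ : ∃ x : ℝ, x = c₂ / 4 := ⟨_, rfl⟩
  have hη0 : 0 < η := by rw [hη]; positivity
  obtain ⟨ε, hε⟩ : ∃ x : ℝ, x = δ * η / 64 := ⟨_, rfl⟩
  have hε0 : 0 < ε := by rw [hε]; positivity
  obtain ⟨K, hK⟩ := exists_bundles D hD hε0
  obtain ⟨q, hq1, hq⟩ := exists_sq_mul_pow_le (A := 8 * K) (ρ := 1 - (δ / 2) ^ 2 / 2)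
    (by nlinarith) (by nlinarith) hε0
  obtain ⟨n₁, hn₁⟩ := hK q hq1
  obtain ⟨n₂, hn₂⟩ := exists_body hδ hδ1.le hc₁0
  obtain ⟨n₃, hn₃⟩ := exists_reservoir hδ hδ1.le hη0 (by linarith) (by nlinarith)
  obtain ⟨C₀, hC₀⟩ : ∃ x : ℝ, x = 6 * q + 2 + 16 / (δ * η) + 2 / c₂ + 6 / η := ⟨_, rfl⟩
  have hq0 : (0 : ℝ) ≤ q := Nat.cast_nonneg q
  have s1 : 0 < 16 / (δ * η) := by positivity
  have s2 : 0 < 2 / c₂ := by positivity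
  have s3 : 0 < 6 / η := by positivity
  obtain ⟨n₄, hn₄⟩ := exists_nat_gt (4 * (2 + D) / μ + 2 / η + 1 / ε + 4 * (q + 1) ^ 2 + 4 * C₀)
  refine ⟨8 * C₀ + 4, by linarith, n₁ + n₂ + n₃ + n₄,
    fun n hn G hG par m hpar0 hpar hcross hch hmge hmle => ?_⟩
  rw [← hμ] at hmge
  have hn4 : 4 * (2 + D) / μ + 2 / η + 1 / ε + 4 * (q + 1) ^ 2 + 4 * C₀ < n :=
    hn₄.trans_le (by exact_mod_cast (by omega))
  have hn0 : (0 : ℝ) < n := by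
    have : 0 ≤ C₀ := by linarith
    exact lt_of_le_of_lt (by positivity) hn4
  have t1 : 0 < 4 * (2 + D) / μ := by positivity
  have t2 : 0 < 2 / η := by positivity
  have t3 : 0 < 1 / ε := by positivity
  have t4 : (0 : ℝ) ≤ 4 * (q + 1) ^ 2 := by positivity
  have u1 : 4 * (2 + D) ≤ μ * n := by
    have h : 4 * (2 + D) / μ ≤ n := by linarith
    rwa [div_le_iff₀' hμ0] at h
  have u2 : 2 ≤ η * n := by
    have h : 2 / η ≤ n := by linarith
    rwa [div_le_iff₀' hη0] at h
  have u3 : 1 ≤ ε * n := by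
    have h : 1 / ε ≤ n := by linarith
    rwa [div_le_iff₀' hε0] at h
  have u4 : 4 * (q + 1) ^ 2 ≤ n := by
    have : (4 * (q + 1) ^ 2 : ℝ) ≤ n := by linarith
    exact_mod_cast this
  have u5 : 4 * C₀ ≤ n := by linarith
  obtain ⟨W, hWc, hW⟩ := hn₃ n (by omega) G hG
  have hw1 : (⌊η * n⌋₊ : ℝ) ≤ η * n := Nat.floor_le (by positivity)
  have hw2 : η / 2 * n ≤ ⌊η * n⌋₊ := floor_ge_half u2
  obtain ⟨I, hIdis, hI, hIc⟩ := exists_blocks hcross hch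
  have hI0 : ∀ x ∈ I, x.val ≠ 0 := fun x hx h0 => by
    have := (hI x hx).2.1
    rw [hpar0 x h0] at this
    exact this h0
  have hIr : (m.val : ℝ) ≤ 8 * E * #I + 2 * (2 + D) := by rw [hE]; exact_mod_cast hIc
  have hIn : c₁ * n ≤ #I := by
    have h1 : c₁ * n * (8 * E) ≤ #I * (8 * E) := by
      have : c₁ * n * (8 * E) = μ * n / 2 := by rw [← hc₁E]; ring
      rw [this]
      linarith
    exact le_of_mul_le_mul_right h1 (by positivity)
  have hwI : ⌊η * n⌋₊ ≤ #I := by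
    have : (⌊η * n⌋₊ : ℝ) ≤ #I :=
      hw1.trans (le_trans (mul_le_mul_of_nonneg_right (by linarith) hn0.le) hIn)
    exact_mod_cast this
  obtain ⟨J, hJI, hJc⟩ := Finset.exists_subset_card_eq hwI
  have hJW : #J = #W := hJc.trans hWc.symm
  have hWm : (#W + m.val : ℝ) ≤ δ ^ 2 / 2 * n := by
    rw [hWc]
    have : η * n ≤ δ ^ 2 / 4 * n := mul_le_mul_of_nonneg_right (by linarith) hn0.le
    linarith
  obtain ⟨w₁, hw₁, hs₁, hp₁⟩ := hn₂ n (by omega) G hG W m hWm par hpar0 hpar hcross I hIdis hI hIn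
  obtain ⟨L, X, grp, cell, hmL, hL, hXlt, hLc, hsib, hXiff, hcc, hcp, hgp, hgK⟩ :=
    hn₁ n (by omega) par m hpar hcross hch
  have hB : IsBundling par m L X grp cell q := ⟨hXlt, hXiff, hcc, hcp, hgp⟩
  have hbody : ∀ f, w₁ f ≠ 0 → IsBody G par m I W c₂ f := fun f hf => by
    obtain ⟨h1, h2, h3, h4⟩ := hs₁ f hf
    rw [← hc₂] at h4
    exact ⟨h1, h2, h3, h4⟩
  have hm0 : m.val ≠ 0 := fun h => by
    rw [h, Nat.cast_zero] at hmge
    linarith [mul_pos hμ0 hn0]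
  have hB0 : 0 ≤ C₀ / n := div_nonneg (by linarith) hn0.le
  have hBC : ∀ x, x ≤ C₀ → x / n ≤ C₀ / n := fun x hx => div_le_div_of_nonneg_right hx hn0.le
  have hβ : 8 * q ^ 2 * K * (1 - (δ / 2) ^ 2 / 2) ^ q * n + 1 ≤ 2 * (ε * n) := by
    have h1 := mul_le_mul_of_nonneg_right hq hn0.le
    have h2 : 8 * q ^ 2 * K * (1 - (δ / 2) ^ 2 / 2) ^ q * n =
        8 * K * (q ^ 2 * (1 - (δ / 2) ^ 2 / 2) ^ q) * n := by ring
    rw [h2]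
    linarith
  refine Exists.imp (fun w hw => ⟨hw.1, hw.2.1, fun S y => (hw.2.2 S y).trans ?_⟩) <|
    exists_spread_of_body (B := C₀ / n) (D₁ := δ * η / 16 * n)
    (D₂ := c₂ / 2 * n) (c := c₂) hδ hδ1 hG hpar hcross hm0 hIdis hI hI0 hJI hJW
    (hWm.trans (mul_le_mul_of_nonneg_right (by linarith) hn0.le)) hmL hL hsib hB hgK u4 hB0
    (by rw [← mul_div_assoc]; exact (div_le_one hn0).2 u5) (hBC _ (by linarith)) (by positivity)
    ?_ (fun a b => ?_) (by positivity) ?_ ?_ ?_ hw₁ hbody fun S hS y => ?_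
  · have h1 : 8 * (C₀ / n) ≤ (8 * C₀ + 4) / n := by
      rw [← mul_div_assoc]
      exact div_le_div_of_nonneg_right (by linarith) hn0.le
    exact mul_le_mul (by linarith) (pow_le_pow_left₀ (by positivity) h1 _) (by positivity)
      (by linarith)
  · rw [show 1 / (δ * η / 16 * n) = 16 / (δ * η) / n by field_simp]
    exact (hBC _ (by linarith)).trans (by linarith)
  · refine le_trans ?_ (hW a b)
    have h1 := mul_le_mul_of_nonneg_left hw2 (show 0 ≤ δ / 4 by positivity)
    have h2 : δ / 4 * (η / 2 * n) = 8 * (ε * n) := by rw [hε]; ring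
    have h3 : δ * η / 16 * n = 4 * (ε * n) := by rw [hε]; ring
    rw [h3]
    linarith
  · rw [show 1 / (c₂ / 2 * n) = 2 / c₂ / n by field_simp]
    exact (hBC _ (by linarith)).trans (by linarith)
  · rw [hJc]
    have : η * n = c₂ * n / 4 := by rw [hη]; ring
    linarith
  · rw [hJc]
    calc (3 : ℝ) / ⌊η * n⌋₊ ≤ 3 / (η / 2 * n) :=
          div_le_div_of_nonneg_left (by norm_num) (by positivity) hw2
      _ = 6 / η / n := by field_simp; norm_num
      _ ≤ C₀ / n := hBC _ (by linarith)
      _ ≤ 4 * (C₀ / n) := by linarith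
  · refine (hp₁ S y).trans ?_
    rw [Finset.filter_true_of_mem fun i hi => (Finset.mem_filter.1 (hS hi)).2]
    exact mul_le_mul_of_nonneg_left (pow_le_pow_left₀ (by positivity)
      (hBC _ (by linarith)) _) (by norm_num)

end Embedding

section Final
open scoped Classical

theorem exists_mul_log_div_le_one (C : ℝ) : ∃ n₀ : ℕ, ∀ n ≥ n₀, C * Real.log n / n ≤ 1 := by
  have h := ((Real.isLittleO_log_id_atTop.tendsto_div_nhds_zero.const_mul C).comp
    tendsto_natCast_atTop_atTop).eventually (gt_mem_nhds (show C * 0 < 1 by norm_num))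
  obtain ⟨n₀, hn₀⟩ := Filter.eventually_atTop.1 h
  refine ⟨n₀, fun n hn => ?_⟩
  rw [mul_div_assoc]
  exact (hn₀ n hn).le

theorem containsCopy_fromEdgeSet {n : ℕ} {T : SimpleGraph (Fin n)} {f : Fin n ≃ Fin n}
    {par : Fin n → Fin n} (hf : ∀ i j, T.Adj (f i) (f j) ↔ treeAdj par i j)
    {φ : Fin n → Fin n} (hφ : Function.Injective φ) {F : Finset (Sym2 (Fin n))}
    (hF : treeEdges par φ ⊆ F) :
    ContainsCopy T (SimpleGraph.fromEdgeSet (↑F : Set (Sym2 (Fin n)))) := by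
  refine ⟨fun u => φ (f.symm u), hφ.comp f.symm.injective, fun u v huv => ?_⟩
  have hmem : ∀ k : Fin n, k.val ≠ 0 → s(φ k, φ (par k)) ∈ F := fun k hk =>
    hF (Finset.mem_image.2 ⟨k, Finset.mem_filter.2 ⟨Finset.mem_univ _, hk⟩, rfl⟩)
  rw [SimpleGraph.fromEdgeSet_adj]
  refine ⟨?_, fun h => huv.ne (f.symm.injective (hφ h))⟩
  have h := (hf (f.symm u) (f.symm v)).1 (by simpa using huv)
  rcases h with ⟨h0, h⟩ | ⟨h0, h⟩
  · simpa [h, Sym2.eq_swap] using hmem _ h0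
  · simpa [h] using hmem _ h0

theorem card_treeAdj_eq {n : ℕ} {T : SimpleGraph (Fin n)} {f : Fin n ≃ Fin n}
    {par : Fin n → Fin n} (hf : ∀ i j, T.Adj (f i) (f j) ↔ treeAdj par i j) (i : Fin n) :
    #{j | treeAdj par i j} = #(nb T (f i)) := by
  refine Finset.card_bij (fun j _ => f j) (fun j hj => ?_) (fun a _ b _ h => f.injective h)
    fun u hu => ⟨f.symm u, ?_, f.apply_symm_apply u⟩
  · exact mem_nb.2 ((hf i j).2 (Finset.mem_filter.1 hj).2)
  · refine Finset.mem_filter.2 ⟨Finset.mem_univ _, (hf _ _).1 ?_⟩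
    rw [f.apply_symm_apply]
    exact mem_nb.1 hu

theorem card_children_le {n : ℕ} {par : Fin n → Fin n} {Δ : ℕ}
    (h : ∀ i, #{j | treeAdj par i j} ≤ Δ) (v : Fin n) :
    #({c | par c = v} : Finset (Fin n)) ≤ Δ + 1 := by
  have hsub : ({c | par c = v} : Finset (Fin n)) ⊆
      ({j | treeAdj par v j} : Finset (Fin n)) ∪
        ({c | c.val = 0} : Finset (Fin n)) := fun c hc => by
    by_cases h0 : c.val = 0
    · exact Finset.mem_union_right _ (Finset.mem_filter.2 ⟨Finset.mem_univ _, h0⟩)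
    · exact Finset.mem_union_left _ (Finset.mem_filter.2 ⟨Finset.mem_univ _,
        Or.inl ⟨h0, (Finset.mem_filter.1 hc).2.symm⟩⟩)
  refine (Finset.card_le_card hsub).trans ((Finset.card_union_le _ _).trans
    (Nat.add_le_add (h v) (Finset.card_le_one.2 fun a ha b hb => Fin.ext ?_)))
  rw [(Finset.mem_filter.1 ha).2, (Finset.mem_filter.1 hb).2]

theorem exists_threshold_of_minDegree (Δ : ℕ) {δ : ℝ} (hδ : 0 < δ) (hδ1 : δ < 1) :
    ∃ C : ℝ, 0 < C ∧ ∀ γ : ℝ, 0 < γ → ∃ n₀ : ℕ, ∀ n : ℕ, n₀ ≤ n →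
    ∀ G : SimpleGraph (Fin n), (∀ v, (1 / 2 + δ) * n ≤ #(nb G v)) →
    ∀ T : SimpleGraph (Fin n), T.IsTree → (∀ v, #(nb T v) ≤ Δ) →
    ∀ E : Finset (Sym2 (Fin n)), (∀ u v, G.Adj u v → s(u, v) ∈ E) →
    1 - γ ≤ EE E (C * Real.log n / n) fun F =>
      ind (ContainsCopy T (SimpleGraph.fromEdgeSet (↑F : Set (Sym2 (Fin n))))) := by
  obtain ⟨D, hD⟩ : ∃ D, D = Δ + 1 := ⟨_, rfl⟩
  have hD1 : 1 ≤ D := by omega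
  have hDr : (1 : ℝ) ≤ D := by exact_mod_cast hD1
  have hD0 : (0 : ℝ) < D := by linarith
  obtain ⟨C₁, hC₁, n₁, hn₁⟩ := exists_spread_embedding D hD1 hδ hδ1
  obtain ⟨C, hC, hC'⟩ := exists_threshold_of_spread D hD1 C₁ hC₁
  refine ⟨C, hC, fun γ hγ => ?_⟩
  obtain ⟨n₂, hn₂⟩ := hC' γ hγ
  obtain ⟨n₃, hn₃⟩ := exists_mul_log_div_le_one C
  obtain ⟨μ, hμ⟩ : ∃ μ : ℝ, μ = δ ^ 2 / (4 * D) := ⟨_, rfl⟩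
  have hμ0 : 0 < μ := by rw [hμ]; positivity
  have hμD : D * μ = δ ^ 2 / 4 := by rw [hμ]; field_simp
  obtain ⟨n₄, hn₄⟩ := exists_nat_gt (2 / μ)
  refine ⟨n₁ + n₂ + n₃ + n₄, fun n hn G hG T hT hΔ E hE => ?_⟩
  have hn4 : 2 / μ ≤ n := hn₄.le.trans (by exact_mod_cast (by omega))
  have hn0 : (0 : ℝ) < n := lt_of_lt_of_le (by positivity) hn4
  have hμn : 2 ≤ μ * n := by rwa [div_le_iff₀' hμ0] at hn4
  have ha1 : (⌊μ * n⌋₊ : ℝ) ≤ μ * n := Nat.floor_le (by positivity)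
  have ha2 := floor_ge_half hμn
  have ha3 : (D : ℝ) * ⌊μ * n⌋₊ ≤ δ ^ 2 / 4 * n := by
    rw [← hμD, mul_assoc]
    exact mul_le_mul_of_nonneg_left ha1 hD0.le
  have hδn : δ ^ 2 / 4 * n < n := by
    have : δ ^ 2 / 4 < 1 := by nlinarith
    nlinarith
  obtain ⟨f, par, m, hpar0, hpar, hf, ham, hmD, hcross⟩ := exists_split_enum (D := D) hT hD1
    (fun v => le_trans (le_of_eq (congrArg Finset.card rfl)) ((hΔ v).trans (by omega)))
    (a := ⌊μ * n⌋₊) (Nat.le_floor (by push_cast; linarith))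
    (by exact_mod_cast ha3.trans_lt hδn)
  have hadj : ∀ i, #{j | treeAdj par i j} ≤ Δ := fun i => (card_treeAdj_eq hf i).le.trans (hΔ _)
  obtain ⟨w, hw, hs, hp⟩ := hn₁ n (by omega) G hG par m hpar0 hpar hcross
    (fun v => (card_children_le hadj v).trans (by omega)) (by
      have h1 : (⌊μ * n⌋₊ : ℝ) ≤ m.val := by exact_mod_cast ham
      have h2 : δ ^ 2 / (8 * D) * n = μ / 2 * n := by rw [hμ]; field_simp; norm_num
      rw [h2]
      exact ha2.trans h1) (le_trans (by exact_mod_cast hmD) ha3)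
  refine (hn₂ n (by omega) E par hpar (fun i => (hadj i).trans (by omega)) w hw (fun φ hφ => ?_)
    hp).trans (EE_mono ?_ (hn₃ n (by omega)) fun F _ => ind_mono ?_)
  · refine ⟨(hs φ hφ).1, fun e he => ?_⟩
    obtain ⟨k, hk, rfl⟩ := Finset.mem_image.1 he
    exact hE _ _ ((hs φ hφ).2 k (Finset.mem_filter.1 hk).2).symm
  · have := Real.log_natCast_nonneg n
    positivity
  · rintro ⟨φ, hφ, hF⟩
    exact containsCopy_fromEdgeSet hf (hs φ hφ).1 hF

end Final

/-- Robust bounded-degree spanning trees: for every `Δ` and `δ > 0` there is `C` such that for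
every `γ > 0`, for all sufficiently large `n`, if `G` is an `n`-vertex graph with
`δ(G) ≥ (1/2 + δ)n` and `T` is an `n`-vertex tree with `Δ(T) ≤ Δ`, then `G(C log n / n)`
contains a copy of `T` with probability at least `1 - γ`. -/
theorem statement5 :
    ∀ (Δ : ℕ) (δ : ℝ), 0 < δ → ∃ C : ℝ, 0 < C ∧ ∀ γ : ℝ, 0 < γ →
    ∃ n₀ : ℕ, ∀ n : ℕ, n₀ ≤ n →
    ∀ (G : SimpleGraph (Fin n)) (_ : DecidableRel G.Adj),
    (∀ v, (1 / 2 + δ) * n ≤ (G.degree v : ℝ)) →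
    ∀ (T : SimpleGraph (Fin n)) (_ : DecidableRel T.Adj),
    T.IsTree → (∀ v, T.degree v ≤ Δ) →
    1 - γ ≤ edgeProb G.edgeFinset (C * Real.log n / n)
      (fun E' => ContainsCopy T (SimpleGraph.fromEdgeSet (↑E' : Set (Sym2 (Fin n))))) := by
  intro Δ δ hδ
  obtain ⟨C, hC, hC'⟩ := exists_threshold_of_minDegree Δ (δ := min δ (1 / 2))
    (lt_min hδ (by norm_num)) ((min_le_right _ _).trans_lt (by norm_num))
  refine ⟨C, hC, fun γ hγ => ?_⟩
  obtain ⟨n₀, hn₀⟩ := hC' γ hγ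
  refine ⟨n₀, fun n hn G _ hG T _ hT hΔ => ?_⟩
  have hnb : ∀ (H : SimpleGraph (Fin n)) [DecidableRel H.Adj] v, #(nb H v) = H.degree v :=
    fun H _ v => by
      rw [← SimpleGraph.card_neighborFinset_eq_degree]
      congr 1
      ext u
      rw [mem_nb, SimpleGraph.mem_neighborFinset]
  rw [edgeProb_eq_EE]
  refine hn₀ n hn G (fun v => ?_) T hT (fun v => (hnb T v).le.trans (hΔ v)) _ fun u v huv =>
    SimpleGraph.mem_edgeFinset.2 huv
  rw [hnb]
  exact le_trans (mul_le_mul_of_nonneg_right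
    (by linarith [min_le_left δ (1 / 2)]) (Nat.cast_nonneg n)) (hG v)
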